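/- arXiv:1006.0129 — 2 statements merged into one kernel-verified Lean document; each statement's English description precedes it below -/
import Mathlib

section
/- Let k be a ring, G a group, and H a normal subgroup of G of index p^l for some prime p and some l ≥ 0. Let M be a kG-module and f a proper complexity function. Assume that for every subgroup E with H ≤ E ≤ G such that E/H is elementary abelian, cds_{kE}(M) ≤ f. Then cds_{kG}(M) ≤ f. -/
open CategoryTheory

noncomputable section

/-- `f : ℕ → ℝ≥0` is a proper complexity function. -/
def IsProperComplexityFunction (f : ℕ → NNReal) : Prop :=
  ∀ n : ℤ, ∃ c : NNReal, ∀ m : ℕ, 0 ≤ (m : ℤ) + n → f ((m : ℤ) + n).toNat < c * f m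

/-- The module `P` can be generated by at most `b` elements over `R`. -/
def RankLE (R : Type) [Ring R] (P : Type) [AddCommGroup P] [Module R P] (b : NNReal) : Prop :=
  ∃ s : Finset P, Submodule.span R (s : Set P) = ⊤ ∧ (s.card : NNReal) ≤ b

/-- `c_R(M) ≤ f` : `M` has a projective resolution whose `n`-th term has rank at most
`d * f n` for some constant `d`. -/
def ComplexityLE (R : Type) [Ring R] (M : ModuleCat.{0} R) (f : ℕ → NNReal) : Prop :=
  ∃ (P : ProjectiveResolution M) (d : NNReal),
    ∀ n : ℕ, RankLE R (P.complex.X n) (d * f n)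

/-- `cds_R(M) ≤ f` : complexity at most `f` up to a direct summand. -/
def CdsLE (R : Type) [Ring R] (M : ModuleCat.{0} R) (f : ℕ → NNReal) : Prop :=
  ∃ N : ModuleCat.{0} R, ComplexityLE R (ModuleCat.of R (M × N)) f

/-- The ring homomorphism `k[H] →+* k[G]` induced by the inclusion of a subgroup `H ≤ G`. -/
def subgroupRingHom (k : Type) [Ring k] {G : Type} [Group G] (H : Subgroup G) :
    MonoidAlgebra k H →+* MonoidAlgebra k G :=
  MonoidAlgebra.mapDomainRingHom k H.subtype

/-- Restriction of a `k[G]`-module to a `k[H]`-module, `H ≤ G`. -/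
def resMod (k : Type) [Ring k] {G : Type} [Group G] (H : Subgroup G)
    (M : ModuleCat.{0} (MonoidAlgebra k G)) : ModuleCat.{0} (MonoidAlgebra k H) :=
  (ModuleCat.restrictScalars (subgroupRingHom k H)).obj M

/-- A group is elementary abelian if it is isomorphic to `(ℤ/p)^r` for a prime `p`. -/
def IsElementaryAbelian (Q : Type) [Group Q] : Prop :=
  ∃ (p r : ℕ), p.Prime ∧ Nonempty (Q ≃* Multiplicative (Fin r → ZMod p))

/-- A group is `p`-elementary abelian if it is isomorphic to `(ℤ/p)^r`. -/
def IsPElementaryAbelian (p : ℕ) (Q : Type) [Group Q] : Prop :=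
  ∃ r : ℕ,
  Nonempty (Q ≃* Multiplicative (Fin r → ZMod p))

open Function

section ShortExact

variable {R : Type*} [Ring R] {A B C : Type*} [AddCommGroup A] [Module R A]
  [AddCommGroup B] [Module R B] [AddCommGroup C] [Module R C]

/-- The pair `i : A → B`, `q : B → C` is a short exact sequence. -/
structure IsSES (i : A →ₗ[R] B) (q : B →ₗ[R] C) : Prop where
  inj : Injective i
  surj : Surjective q
  exact : Exact i q

lemma IsSES.apply_apply {i : A →ₗ[R] B} {q : B →ₗ[R] C} (h : IsSES i q) (a : A) :
    q (i a) = 0 := h.exact.apply_apply_eq_zero a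

lemma IsSES.mem {i : A →ₗ[R] B} {q : B →ₗ[R] C} (h : IsSES i q) {b : B} (hb : q b = 0) :
    ∃ a, i a = b := (h.exact b).1 hb

lemma isSES_ker {q : B →ₗ[R] C} (hq : Surjective q) : IsSES (LinearMap.ker q).subtype q :=
  ⟨Subtype.val_injective, hq, fun b => by simp⟩

/-- A linear map whose values lie in the range of an injective map lifts along it. -/
lemma exists_lift_of_injective {i : A →ₗ[R] B} (hi : Injective i) (g : C →ₗ[R] B)
    (h : ∀ c, ∃ a, i a = g c) : ∃ g' : C →ₗ[R] A, ∀ c, i (g' c) = g c := by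
  choose g' hg' using h
  refine ⟨⟨⟨g', fun x y => hi ?_⟩, fun r x => hi ?_⟩, hg'⟩
  · simp [hg']
  · simp [hg']

/-- A linear map vanishing on the kernel of a surjective map descends along it. -/
lemma exists_desc_of_surjective {q : B →ₗ[R] C} (hq : Surjective q) (g : B →ₗ[R] A)
    (h : ∀ b, q b = 0 → g b = 0) : ∃ g' : C →ₗ[R] A, ∀ b, g' (q b) = g b := by
  choose s hs using hq
  have key : ∀ b c, q b = c → g b = g (s c) := fun b c hbc => by
    have := h (b - s c) (by simp [hs, hbc])
    rwa [map_sub, sub_eq_zero] at this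
  refine ⟨⟨⟨fun c => g (s c), fun x y => ?_⟩, fun r x => ?_⟩, fun b => (key b _ rfl).symm⟩
  · rw [← key (s x + s y) _ (by simp [hs]), map_add]
  · exact (key (r • s x) _ (by simp [hs])).symm.trans (map_smul g r _)

end ShortExact

section Rank

variable {R : Type} [Ring R] {P Q : Type} [AddCommGroup P] [Module R P]
  [AddCommGroup Q] [Module R Q]

lemma RankLE.mono {a b : NNReal} (h : RankLE R P a) (hab : a ≤ b) : RankLE R P b := by
  obtain ⟨s, hs, hc⟩ := h
  exact ⟨s, hs, hc.trans hab⟩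

lemma RankLE.of_surjective {a : NNReal} (h : RankLE R P a) (g : P →ₗ[R] Q)
    (hg : Surjective g) : RankLE R Q a := by
  classical
  obtain ⟨s, hs, hc⟩ := h
  refine ⟨s.image g, ?_, le_trans (by exact_mod_cast Finset.card_image_le) hc⟩
  rw [Finset.coe_image, Submodule.span_image, hs, Submodule.map_top, LinearMap.range_eq_top.2 hg]

lemma RankLE.prod {a b : NNReal} (h : RankLE R P a) (h' : RankLE R Q b) :
    RankLE R (P × Q) (a + b) := by
  classical
  obtain ⟨s, hs, hc⟩ := h
  obtain ⟨t, ht, hd⟩ := h'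
  refine ⟨s.image (LinearMap.inl R P Q) ∪ t.image (LinearMap.inr R P Q), ?_, ?_⟩
  · rw [Finset.coe_union, Submodule.span_union, Finset.coe_image, Finset.coe_image,
      Submodule.span_image, Submodule.span_image, hs, ht, Submodule.map_top, Submodule.map_top,
      LinearMap.sup_range_inl_inr]
  · have h1 : ((s.image (LinearMap.inl R P Q) ∪ t.image (LinearMap.inr R P Q)).card : NNReal) ≤
        (s.card : NNReal) + t.card := by
      exact_mod_cast (Finset.card_union_le _ _).trans
        (add_le_add Finset.card_image_le Finset.card_image_le)
    exact h1.trans (add_le_add hc hd)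

lemma rankLE_of_subsingleton [Subsingleton P] (b : NNReal) : RankLE R P b :=
  ⟨∅, Subsingleton.elim _ _, by simp⟩

lemma RankLE.finite {a : NNReal} (h : RankLE R P a) : Module.Finite R P :=
  ⟨⟨h.choose, h.choose_spec.1⟩⟩

lemma exists_rankLE_of_finite (R P : Type) [Ring R] [AddCommGroup P] [Module R P]
    [Module.Finite R P] : ∃ a : NNReal, RankLE R P a := by
  obtain ⟨s, hs⟩ := Module.Finite.fg_top (R := R) (M := P)
  exact ⟨s.card, s, hs, le_rfl⟩

end Rank

section Syzygies

/-- `M` has a projective resolution, given by its syzygies, whose `n`-th term is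
generated by at most `β n` elements. -/
def HasSyz (R : Type) [Ring R] (M : Type) [AddCommGroup M] [Module R M]
    (β : ℕ → NNReal) : Prop :=
  ∃ (K P : ℕ → ModuleCat.{0} R) (i : ∀ n, K (n + 1) →ₗ[R] P n) (q : ∀ n, P n →ₗ[R] K n),
    Nonempty (K 0 ≃ₗ[R] M) ∧
      ∀ n, Module.Projective R (P n) ∧ RankLE R (P n) (β n) ∧ IsSES (i n) (q n)

variable {R : Type} [Ring R] {A B C : Type} [AddCommGroup A] [Module R A]
  [AddCommGroup B] [Module R B] [AddCommGroup C] [Module R C]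

lemma HasSyz.of_equiv {β : ℕ → NNReal} (h : HasSyz R A β) (e : A ≃ₗ[R] B) : HasSyz R B β := by
  obtain ⟨K, P, i, q, ⟨e'⟩, h⟩ := h
  exact ⟨K, P, i, q, ⟨e'.trans e⟩, h⟩

lemma HasSyz.mono {β γ : ℕ → NNReal} (h : HasSyz R A β) (hβ : ∀ n, β n ≤ γ n) :
    HasSyz R A γ := by
  obtain ⟨K, P, i, q, e, h⟩ := h
  exact ⟨K, P, i, q, e, fun n => ⟨(h n).1, (h n).2.1.mono (hβ n), (h n).2.2⟩⟩

lemma HasSyz.cons {β : ℕ → NNReal} {i : A →ₗ[R] B} {q : B →ₗ[R] C} (hiq : IsSES i q)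
    [Module.Projective R B] (hB : RankLE R B (β 0)) (hA : HasSyz R A fun n => β (n + 1)) :
    HasSyz R C β := by
  obtain ⟨K, P, j, r, ⟨e⟩, h⟩ := hA
  refine ⟨fun n => n.casesOn (ModuleCat.of R C) K, fun n => n.casesOn (ModuleCat.of R B) P,
    fun n => match n with
      | 0 => i ∘ₗ e.toLinearMap
      | n + 1 => j n,
    fun n => match n with
      | 0 => q
      | n + 1 => r n, ⟨LinearEquiv.refl R C⟩, fun n => ?_⟩
  cases n with
  | zero =>
    refine ⟨‹_›, hB, ⟨hiq.inj.comp e.injective, hiq.surj, fun b => ?_⟩⟩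
    refine (hiq.exact b).trans ⟨?_, ?_⟩
    · rintro ⟨a, rfl⟩
      exact ⟨e.symm a, by simp⟩
    · rintro ⟨a, rfl⟩
      exact ⟨e a, rfl⟩
  | succ n => exact h n

lemma HasSyz.tail {β : ℕ → NNReal} (h : HasSyz R C β) :
    ∃ (K P : ModuleCat.{0} R) (i : K →ₗ[R] P) (q : P →ₗ[R] C), Module.Projective R P ∧
      RankLE R P (β 0) ∧ IsSES i q ∧ HasSyz R K fun n => β (n + 1) := by
  obtain ⟨K, P, i, q, ⟨e⟩, h⟩ := h
  refine ⟨K 1, P 0, i 0, e.toLinearMap ∘ₗ q 0, (h 0).1, (h 0).2.1, ⟨(h 0).2.2.inj, ?_, ?_⟩,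
    fun n => K (n + 1), fun n => P (n + 1), fun n => i (n + 1), fun n => q (n + 1),
    ⟨LinearEquiv.refl _ _⟩, fun n => h (n + 1)⟩
  · exact e.surjective.comp (h 0).2.2.surj
  · intro b
    simpa using (h 0).2.2.exact b

/-- One step of the horseshoe construction. -/
lemma exists_horseshoe_step {A' C' P Q : Type} [AddCommGroup A'] [Module R A']
    [AddCommGroup C'] [Module R C'] [AddCommGroup P] [Module R P] [AddCommGroup Q] [Module R Q]
    [Module.Projective R Q] {i : A →ₗ[R] B} {q : B →ₗ[R] C} (h : IsSES i q)
    {j : A' →ₗ[R] P} {r : P →ₗ[R] A} (hA : IsSES j r)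
    {m : C' →ₗ[R] Q} {s : Q →ₗ[R] C} (hC : IsSES m s) :
    ∃ (B' : ModuleCat.{0} R) (u : B' →ₗ[R] P × Q) (v : P × Q →ₗ[R] B) (i' : A' →ₗ[R] B')
      (q' : B' →ₗ[R] C'), IsSES u v ∧ IsSES i' q' := by
  obtain ⟨t, ht⟩ := Module.projective_lifting_property q s h.surj
  have ht' : ∀ y, q (t y) = s y := fun y => LinearMap.congr_fun ht y
  let v : P × Q →ₗ[R] B := LinearMap.coprod (i ∘ₗ r) t
  have hv : ∀ x y, v (x, y) = i (r x) + t y := fun x y => by simp [v]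
  have hqv : ∀ z, q (v z) = s z.2 := fun z => by
    rw [← Prod.mk.eta (p := z), hv, map_add, h.apply_apply, ht', zero_add]
  have hvs : Surjective v := fun b => by
    obtain ⟨y, hy⟩ := hC.surj (q b)
    obtain ⟨a, ha⟩ := h.mem (b := b - t y) (by rw [map_sub, ht', hy, sub_self])
    obtain ⟨x, rfl⟩ := hA.surj a
    exact ⟨(x, y), by rw [hv, ha, sub_add_cancel]⟩
  obtain ⟨q', hq'⟩ := exists_lift_of_injective hC.inj
    (LinearMap.snd R P Q ∘ₗ (LinearMap.ker v).subtype) (fun z => hC.mem (by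
      have := hqv z.1
      rw [LinearMap.mem_ker.1 z.2, map_zero] at this
      exact this.symm))
  let i' : A' →ₗ[R] LinearMap.ker v := LinearMap.codRestrict _ (LinearMap.inl R P Q ∘ₗ j)
    (fun a => by simp [hv, hA.apply_apply])
  refine ⟨ModuleCat.of R (LinearMap.ker v), (LinearMap.ker v).subtype, v, i', q',
    isSES_ker hvs, ⟨?_, ?_, ?_⟩⟩
  · intro a b hab
    have := congrArg (fun z : LinearMap.ker v => z.1.1) hab
    exact hA.inj this
  · intro c
    obtain ⟨a, ha⟩ := h.mem (b := t (m c)) (by rw [ht', hC.apply_apply])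
    obtain ⟨x, rfl⟩ := hA.surj a
    refine ⟨⟨(-x, m c), by simp [hv, ha]⟩, hC.inj ?_⟩
    rw [hq']
    rfl
  · rintro ⟨⟨x, y⟩, hz⟩
    have e1 : m (q' ⟨(x, y), hz⟩) = y := hq' _
    constructor
    · intro h0
      rw [h0, map_zero] at e1
      subst e1
      rw [LinearMap.mem_ker, hv, map_zero, add_zero] at hz
      obtain ⟨a, ha⟩ := hA.mem (h.inj (hz.trans (map_zero i).symm))
      exact ⟨a, Subtype.ext (Prod.ext ha rfl)⟩
    · rintro ⟨a, ha⟩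
      have : y = 0 := (congrArg (fun z : LinearMap.ker v => z.1.2) ha).symm
      apply hC.inj
      rw [e1, this, map_zero]

lemma HasSyz.ext {α γ : ℕ → NNReal} {i : A →ₗ[R] B} {q : B →ₗ[R] C} (h : IsSES i q)
    (hA : HasSyz R A α) (hC : HasSyz R C γ) : HasSyz R B fun n => α n + γ n := by
  obtain ⟨KA, PA, j, r, ⟨eA⟩, hA⟩ := hA
  obtain ⟨KC, PC, m, s, ⟨eC⟩, hC⟩ := hC
  let T : ℕ → Type 1 := fun n => Σ B : ModuleCat.{0} R,
    {x : (KA n →ₗ[R] B) × (B →ₗ[R] KC n) // IsSES x.1 x.2}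
  have step : ∀ n (t : T n), ∃ t' : T (n + 1), ∃ (u : t'.1 →ₗ[R] PA n × PC n)
      (v : PA n × PC n →ₗ[R] t.1), IsSES u v := by
    rintro n ⟨B, ⟨⟨i, q⟩, h⟩⟩
    have := (hC n).1
    obtain ⟨B', u, v, i', q', huv, h'⟩ := exists_horseshoe_step h (hA n).2.2 (hC n).2.2
    exact ⟨⟨B', ⟨(i', q'), h'⟩⟩, u, v, huv⟩
  choose next u v huv using step
  let t0 : T 0 := ⟨ModuleCat.of R B, ⟨(i ∘ₗ eA.toLinearMap, eC.symm.toLinearMap ∘ₗ q),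
    ⟨h.inj.comp eA.injective, eC.symm.surjective.comp h.surj, fun b => by
      simp only [LinearMap.comp_apply, LinearEquiv.coe_coe, EmbeddingLike.map_eq_zero_iff]
      refine (h.exact b).trans ⟨?_, ?_⟩
      · rintro ⟨a, rfl⟩
        exact ⟨eA.symm a, by simp⟩
      · rintro ⟨a, rfl⟩
        exact ⟨eA a, rfl⟩⟩⟩⟩
  let t : ∀ n, T n := fun n => Nat.rec t0 next n
  refine ⟨fun n => (t n).1, fun n => ModuleCat.of R (PA n × PC n), fun n => u n (t n),
    fun n => v n (t n), ⟨LinearEquiv.refl R B⟩, fun n => ⟨?_, ?_, huv n (t n)⟩⟩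
  · haveI := (hA n).1
    have := (hC n).1
    exact inferInstanceAs (Module.Projective R (PA n × PC n))
  · exact (hA n).2.1.prod (hC n).2.1

lemma hasSyz_of_subsingleton [Subsingleton A] (β : ℕ → NNReal) : HasSyz R A β :=
  ⟨fun _ => ModuleCat.of R A, fun _ => ModuleCat.of R A, fun _ => LinearMap.id,
    fun _ => LinearMap.id, ⟨LinearEquiv.refl R A⟩, fun n => ⟨inferInstanceAs (Module.Projective R A),
      rankLE_of_subsingleton (P := A) _,
      ⟨injective_of_subsingleton (α := A) _, fun x => ⟨x, rfl⟩, fun x => ⟨fun _ => ⟨x, rfl⟩,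
        fun _ => Subsingleton.elim (α := A) _ _⟩⟩⟩⟩

end Syzygies

section Resolutions

variable {R : Type} [Ring R]

lemma HasSyz.complexityLE {M : ModuleCat.{0} R} {f : ℕ → NNReal} {d : NNReal}
    (h : HasSyz R M fun n => d * f n) : ComplexityLE R M f := by
  obtain ⟨K, P, i, q, ⟨e⟩, h⟩ := h
  let D : ∀ n, P (n + 1) ⟶ P n := fun n => ModuleCat.ofHom (i n ∘ₗ q (n + 1))
  have hD : ∀ n, D (n + 1) ≫ D n = 0 := fun n => by
    ext x
    simp [D, (h (n + 1)).2.2.apply_apply]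
  let X : ChainComplex (ModuleCat.{0} R) ℕ := ChainComplex.of P D hD
  let π0 : X.X 0 ⟶ M := ModuleCat.ofHom (e.toLinearMap ∘ₗ q 0)
  have hX10 : X.d 1 0 = D 0 := ChainComplex.of_d P D 0
  have hπ0 : X.d 1 0 ≫ π0 = 0 := by
    rw [hX10]
    ext x
    simp [D, π0, (h 0).2.2.apply_apply]
  have hex : ∀ n, X.ExactAt (n + 1) := fun n => by
    rw [HomologicalComplex.exactAt_iff' _ (n + 1 + 1) (n + 1) n (by simp) (by simp),
      ShortComplex.moduleCat_exact_iff]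
    intro x hx
    change (X.d (n + 1) n).hom x = 0 at hx
    rw [show X.d (n + 1) n = D n from ChainComplex.of_d P D n] at hx
    obtain ⟨y, hy⟩ := (h (n + 1)).2.2.mem ((h n).2.2.inj (hx.trans (map_zero _).symm))
    obtain ⟨z, rfl⟩ := (h (n + 2)).2.2.surj y
    refine ⟨z, ?_⟩
    change (X.d (n + 1 + 1) (n + 1)).hom z = x
    rw [show X.d (n + 1 + 1) (n + 1) = D (n + 1) from ChainComplex.of_d P D (n + 1)]
    exact hy
  refine ⟨ProjectiveResolution.mk (complex := X) (projective := fun n => ?_) (π := (ChainComplex.toSingle₀Equiv _ _).symm ⟨π0, hπ0⟩)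
    (quasiIso := ⟨fun n => ?_⟩), d, fun n => (h n).2.1⟩
  · have := (h n).1
    exact (IsProjective.iff_projective (P n)).1 this
  · cases n with
    | zero =>
      rw [ChainComplex.quasiIsoAt₀_iff, ShortComplex.quasiIso_iff_of_zeros']
      · let S : ShortComplex (ModuleCat.{0} R) := ShortComplex.mk (X.d 1 0) π0 hπ0
        have hS : S.Exact ∧ Epi S.g := by
          constructor
          · rw [ShortComplex.moduleCat_exact_iff]
            intro x hx
            change e (q 0 x) = 0 at hx
            obtain ⟨y, hy⟩ := (h 0).2.2.mem (e.injective (hx.trans (map_zero e).symm))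
            obtain ⟨z, rfl⟩ := (h 1).2.2.surj y
            refine ⟨z, ?_⟩
            change (X.d 1 0).hom z = x
            rw [hX10]
            exact hy
          · rw [ModuleCat.epi_iff_surjective]
            exact e.surjective.comp (h 0).2.2.surj
        refine (ShortComplex.exact_and_epi_g_iff_of_iso (S₂ := S) ?_).2 hS
        exact ShortComplex.isoMk (Iso.refl _) (Iso.refl _) (Iso.refl _)
          ((Category.id_comp _).trans (Category.comp_id _).symm)
          ((Category.id_comp π0).trans (Category.comp_id π0).symm)
      all_goals rfl
    | succ n =>
      rw [quasiIsoAt_iff_exactAt']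
      · exact hex n
      · apply ChainComplex.exactAt_succ_single_obj

lemma ComplexityLE.hasSyz {M : ModuleCat.{0} R} {f : ℕ → NNReal} (h : ComplexityLE R M f) :
    ∃ d : NNReal, HasSyz R M fun n => d * f n := by
  obtain ⟨P, d, h⟩ := h
  refine ⟨d, ?_⟩
  let D : ∀ n, P.complex.X (n + 1) →ₗ[R] P.complex.X n := fun n => (P.complex.d (n + 1) n).hom
  have hD : ∀ n, Exact (D (n + 1)) (D n) := fun n => by
    have := P.exact_succ n
    rw [ShortComplex.ShortExact.moduleCat_exact_iff_function_exact] at this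
    exact this
  have hproj : ∀ n, Module.Projective R (P.complex.X n) := fun n =>
    (IsProjective.iff_projective _).2 (P.projective n)
  have hrange : HasSyz R (LinearMap.range (D 0)) fun n => d * f (n + 1) := by
    refine ⟨fun n => ModuleCat.of R (LinearMap.range (D n)), fun n => P.complex.X (n + 1),
      fun n => (LinearMap.range (D (n + 1))).subtype, fun n => (D n).rangeRestrict,
      ⟨LinearEquiv.refl _ _⟩, fun n => ⟨hproj _, h _, Subtype.val_injective,
        LinearMap.surjective_rangeRestrict _, fun x => ?_⟩⟩
    rw [← ZeroMemClass.coe_eq_zero]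
    refine (hD n x).trans ?_
    simp
  have h0 := P.exact₀
  rw [ShortComplex.ShortExact.moduleCat_exact_iff_function_exact] at h0
  have hep : Epi (P.π.f 0) := inferInstance
  have hs : Surjective (P.π.f 0).hom := (ModuleCat.epi_iff_surjective _).1 hep
  have hses : IsSES (LinearMap.range (D 0)).subtype (P.π.f 0).hom :=
    ⟨Subtype.val_injective, hs, fun x => (h0 x).trans (by
      simp only [Submodule.coe_subtype, Subtype.range_coe_subtype]
      rfl)⟩
  have := hproj 0
  exact HasSyz.cons (β := fun n => d * f n) hses (h 0) hrange

end Resolutions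

section Complexity

lemma IsProperComplexityFunction.pos {f : ℕ → NNReal} (hf : IsProperComplexityFunction f)
    (n : ℕ) : 0 < f n := by
  obtain ⟨c, hc⟩ := hf 0
  have := hc n (by simp)
  simp only [add_zero, Int.toNat_natCast] at this
  rcases eq_or_ne (f n) 0 with h | h
  · simp [h] at this
  · exact pos_iff_ne_zero.2 h

lemma IsProperComplexityFunction.exists_shift {f : ℕ → NNReal}
    (hf : IsProperComplexityFunction f) :
    ∃ c : NNReal, ∀ n, f (n + 1) ≤ c * f n ∧ f n ≤ c * f (n + 1) := by
  obtain ⟨c, hc⟩ := hf 1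
  obtain ⟨c', hc'⟩ := hf (-1)
  refine ⟨c + c', fun n => ⟨?_, ?_⟩⟩
  · have := hc n (by positivity)
    rw [show ((n : ℤ) + 1).toNat = n + 1 by omega] at this
    exact this.le.trans (by rw [add_mul]; exact le_self_add)
  · have := hc' (n + 1) (by simp)
    rw [show (((n + 1 : ℕ) : ℤ) + -1).toNat = n by omega] at this
    exact this.le.trans (by rw [add_mul]; exact le_add_self)

/-- The unbundled form of `ComplexityLE`. -/
def HasCx (R : Type) [Ring R] (f : ℕ → NNReal) (M : Type) [AddCommGroup M] [Module R M] : Prop :=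
  ∃ d : NNReal, HasSyz R M fun n => d * f n

/-- The unbundled form of `CdsLE`. -/
def HasCds (R : Type) [Ring R] (f : ℕ → NNReal) (M : Type) [AddCommGroup M] [Module R M] :
    Prop :=
  ∃ N : ModuleCat.{0} R, HasCx R f (M × N)

variable {R : Type} [Ring R] {f : ℕ → NNReal} {A B C : Type} [AddCommGroup A] [Module R A]
  [AddCommGroup B] [Module R B] [AddCommGroup C] [Module R C]

lemma cdsLE_iff_hasCds {M : ModuleCat.{0} R} : CdsLE R M f ↔ HasCds R f M :=
  ⟨fun ⟨N, h⟩ => ⟨N, h.hasSyz⟩, fun ⟨N, ⟨_, h⟩⟩ => ⟨N, HasSyz.complexityLE h⟩⟩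

lemma HasCx.of_equiv (h : HasCx R f A) (e : A ≃ₗ[R] B) : HasCx R f B :=
  ⟨_, h.choose_spec.of_equiv e⟩

lemma HasCx.ext {i : A →ₗ[R] B} {q : B →ₗ[R] C} (h : IsSES i q) (hA : HasCx R f A)
    (hC : HasCx R f C) : HasCx R f B := by
  obtain ⟨a, ha⟩ := hA
  obtain ⟨c, hc⟩ := hC
  exact ⟨a + c, by simpa only [add_mul] using HasSyz.ext h ha hc⟩

lemma isSES_inl_snd : IsSES (LinearMap.inl R A B) (LinearMap.snd R A B) :=
  ⟨LinearMap.inl_injective, LinearMap.snd_surjective, Exact.inl_snd⟩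

lemma HasCx.prod (hA : HasCx R f A) (hB : HasCx R f B) : HasCx R f (A × B) :=
  HasCx.ext isSES_inl_snd hA hB

lemma HasCx.cons (hf : IsProperComplexityFunction f) {i : A →ₗ[R] B} {q : B →ₗ[R] C}
    (h : IsSES i q) [Module.Projective R B] [Module.Finite R B] (hA : HasCx R f A) :
    HasCx R f C := by
  obtain ⟨a, ha⟩ := hA
  obtain ⟨b, hb⟩ := exists_rankLE_of_finite R B
  obtain ⟨c, hc⟩ := hf.exists_shift
  refine ⟨b / f 0 + a * c, HasSyz.cons h (hb.mono ?_) (ha.mono fun n => ?_)⟩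
  · rw [add_mul, div_mul_cancel₀ _ (hf.pos 0).ne']
    exact le_self_add
  · rw [add_mul, mul_assoc]
    exact (mul_le_mul_right (hc n).2 a).trans le_add_self

lemma HasCx.tail (hf : IsProperComplexityFunction f) (hC : HasCx R f C) :
    ∃ (K P : ModuleCat.{0} R) (i : K →ₗ[R] P) (q : P →ₗ[R] C), Module.Projective R P ∧
      Module.Finite R P ∧ IsSES i q ∧ HasCx R f K := by
  obtain ⟨a, ha⟩ := hC
  obtain ⟨c, hc⟩ := hf.exists_shift
  obtain ⟨K, P, i, q, hP, hr, h, hK⟩ := ha.tail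
  refine ⟨K, P, i, q, hP, hr.finite, h, a * c, hK.mono fun n => ?_⟩
  rw [mul_assoc]
  exact mul_le_mul_right (hc n).1 a

lemma hasCx_of_subsingleton [Subsingleton A] : HasCx R f A := ⟨0, hasSyz_of_subsingleton _⟩

lemma hasCx_of_projective (hf : IsProperComplexityFunction f) [Module.Projective R A]
    [Module.Finite R A] : HasCx R f A :=
  HasCx.cons hf (i := (0 : PUnit →ₗ[R] A)) (q := LinearMap.id)
    ⟨injective_of_subsingleton _, surjective_id, fun x => by simp [eq_comm]⟩
    hasCx_of_subsingleton

lemma HasCx.hasCds (h : HasCx R f A) : HasCds R f A :=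
  ⟨ModuleCat.of R PUnit, h.of_equiv LinearEquiv.prodUnique.symm⟩

lemma hasCds_of_projective (hf : IsProperComplexityFunction f) [Module.Projective R A]
    [Module.Finite R A] : HasCds R f A := (hasCx_of_projective hf).hasCds

lemma hasCds_of_subsingleton [Subsingleton A] : HasCds R f A := hasCx_of_subsingleton.hasCds

/-- A retract splits off as a direct summand. -/
lemma exists_equiv_prod_ker {i : A →ₗ[R] B} {r : B →ₗ[R] A} (h : ∀ a, r (i a) = a) :
    Nonempty (B ≃ₗ[R] A × LinearMap.ker r) := by
  have hk : ∀ b, b - i (r b) ∈ LinearMap.ker r := fun b => by simp [h]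
  exact ⟨LinearEquiv.ofLinear
    (LinearMap.prod r (LinearMap.codRestrict _ (LinearMap.id - i ∘ₗ r) hk))
    (LinearMap.coprod i (LinearMap.ker r).subtype)
    (by ext x <;> simp [h, LinearMap.mem_ker.1 (Subtype.prop _)]) (by ext; simp)⟩

lemma HasCds.of_retract (hB : HasCds R f B) (i : A →ₗ[R] B) (r : B →ₗ[R] A)
    (h : ∀ a, r (i a) = a) : HasCds R f A := by
  obtain ⟨N, hN⟩ := hB
  obtain ⟨e⟩ := exists_equiv_prod_ker h
  exact ⟨ModuleCat.of R (LinearMap.ker r × N), hN.of_equiv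
    ((e.prodCongr (LinearEquiv.refl R N)).trans (LinearEquiv.prodAssoc R A _ N))⟩

lemma HasCds.of_equiv (hA : HasCds R f A) (e : A ≃ₗ[R] B) : HasCds R f B :=
  hA.of_retract e.symm.toLinearMap e.toLinearMap (by simp)

lemma HasCds.ext {i : A →ₗ[R] B} {q : B →ₗ[R] C} (h : IsSES i q) (hA : HasCds R f A)
    (hC : HasCds R f C) : HasCds R f B := by
  obtain ⟨A', hA⟩ := hA
  obtain ⟨C', hC⟩ := hC
  refine ⟨ModuleCat.of R (A' × C'), HasCx.ext (B := B × A' × C')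
    (i := LinearMap.prodMap i (LinearMap.inl R A' C'))
    (q := LinearMap.prodMap q (LinearMap.snd R A' C')) ⟨?_, ?_, ?_⟩ hA hC⟩
  · exact Injective.prodMap h.inj LinearMap.inl_injective
  · exact Surjective.prodMap h.surj Prod.snd_surjective
  · rintro ⟨b, a', c'⟩
    simp only [LinearMap.prodMap_apply, LinearMap.snd_apply, Prod.mk_eq_zero, Set.mem_range,
      Prod.exists, LinearMap.inl_apply, Prod.mk.injEq]
    constructor
    · rintro ⟨hb, rfl⟩
      obtain ⟨a, rfl⟩ := h.mem hb
      exact ⟨a, a', rfl, rfl, rfl⟩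
    · rintro ⟨a, a'', rfl, rfl, rfl⟩
      exact ⟨h.apply_apply a, rfl⟩

lemma HasCds.prod (hA : HasCds R f A) (hB : HasCds R f B) : HasCds R f (A × B) :=
  HasCds.ext isSES_inl_snd hA hB

lemma HasCx.ker (hf : IsProperComplexityFunction f) {i : A →ₗ[R] B} {q : B →ₗ[R] C}
    (h : IsSES i q) (hB : HasCx R f B) (hC : HasCx R f C) : HasCds R f A := by
  obtain ⟨K, P, j, r, hP, hfin, hjr, hK⟩ := hC.tail hf
  obtain ⟨s, hs⟩ := Module.projective_lifting_property q r h.surj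
  have hs' : ∀ y, q (s y) = r y := fun y => LinearMap.congr_fun hs y
  obtain ⟨t, ht⟩ := exists_lift_of_injective h.inj (s ∘ₗ j) (fun x => h.mem (by
    simp [hs', hjr.apply_apply]))
  replace ht : ∀ x, i (t x) = s (j x) := ht
  refine ⟨P, HasCx.ext (i := LinearMap.prod (-t) j) (q := LinearMap.coprod i s)
    ⟨?_, ?_, ?_⟩ hK hB⟩
  · exact fun x y hxy => hjr.inj (congrArg Prod.snd hxy)
  · intro b
    obtain ⟨y, hy⟩ := hjr.surj (q b)
    obtain ⟨a, ha⟩ := h.mem (b := b - s y) (by rw [map_sub, hs', hy, sub_self])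
    exact ⟨(a, y), by simp [ha]⟩
  · rintro ⟨a, y⟩
    simp only [LinearMap.coprod_apply, Set.mem_range, LinearMap.prod_apply, Function.prod_apply,
      LinearMap.neg_apply, Prod.mk.injEq]
    constructor
    · intro h0
      have h1 := congrArg q h0
      rw [map_add, h.apply_apply, hs', zero_add, map_zero] at h1
      obtain ⟨x, rfl⟩ := hjr.mem h1
      refine ⟨x, h.inj ?_, rfl⟩
      rw [map_neg, ht, neg_eq_iff_add_eq_zero, add_comm, h0]
    · rintro ⟨x, rfl, rfl⟩
      simp [ht]

lemma HasCds.ker (hf : IsProperComplexityFunction f) {i : A →ₗ[R] B} {q : B →ₗ[R] C}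
    (h : IsSES i q) (hB : HasCds R f B) (hC : HasCds R f C) : HasCds R f A := by
  obtain ⟨B', hB⟩ := hB
  obtain ⟨C', hC⟩ := hC
  have := HasCx.ker hf (i := LinearMap.prodMap (LinearMap.prodMap i LinearMap.id)
      (LinearMap.inl R C C')) (A := (A × B') × C) (B := (B × B') × (C × C')) (C := C × C')
    (q := LinearMap.prodMap (q ∘ₗ LinearMap.fst R B B') (LinearMap.snd R C C'))
    ⟨(h.inj.prodMap injective_id).prodMap LinearMap.inl_injective,
      (h.surj.comp Prod.fst_surjective).prodMap Prod.snd_surjective, by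
      rintro ⟨⟨b, b'⟩, c, c'⟩
      simp only [LinearMap.prodMap_apply, LinearMap.comp_apply, LinearMap.fst_apply,
        LinearMap.snd_apply, Prod.mk_eq_zero, Set.mem_range, LinearMap.id_apply, Prod.exists,
        LinearMap.inl_apply, Prod.mk.injEq]
      constructor
      · rintro ⟨hb, rfl⟩
        obtain ⟨a, rfl⟩ := h.mem hb
        exact ⟨a, b', c, ⟨rfl, rfl⟩, rfl, rfl⟩
      · rintro ⟨a, b'', c'', ⟨rfl, rfl⟩, rfl, rfl⟩
        exact ⟨h.apply_apply a, rfl⟩⟩ (hB.prod hC) hC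
  exact this.of_retract (LinearMap.inl R _ _ ∘ₗ LinearMap.inl R _ _)
    (LinearMap.fst R _ _ ∘ₗ LinearMap.fst R _ _) (fun _ => rfl)

lemma HasCx.coker (hf : IsProperComplexityFunction f) {i : A →ₗ[R] B} {q : B →ₗ[R] C}
    (h : IsSES i q) (hA : HasCx R f A) (hB : HasCx R f B) : HasCx R f C := by
  obtain ⟨K, P, j, r, hP, hfin, hjr, hK⟩ := hB.tail hf
  have hs : Surjective (q ∘ₗ r) := h.surj.comp hjr.surj
  refine HasCx.cons hf (isSES_ker hs) ?_
  obtain ⟨t, ht⟩ := exists_lift_of_injective h.inj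
    (r ∘ₗ (LinearMap.ker (q ∘ₗ r)).subtype) (fun x => h.mem x.2)
  replace ht : ∀ x, i (t x) = r x.1 := ht
  refine HasCx.ext (i := LinearMap.codRestrict (LinearMap.ker (q ∘ₗ r)) j
    (fun x => by simp [hjr.apply_apply])) (q := t) ⟨?_, ?_, ?_⟩ hK hA
  · exact fun x y hxy => hjr.inj (congrArg Subtype.val hxy)
  · intro a
    obtain ⟨x, hx⟩ := hjr.surj (i a)
    refine ⟨⟨x, by simp [hx, h.apply_apply]⟩, h.inj ?_⟩
    rw [ht, hx]
  · intro x
    constructor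
    · intro hx
      have := ht x
      rw [hx, map_zero] at this
      obtain ⟨y, hy⟩ := hjr.mem this.symm
      exact ⟨y, Subtype.ext hy⟩
    · rintro ⟨y, rfl⟩
      exact h.inj ((ht _).trans ((hjr.apply_apply y).trans (map_zero i).symm))

lemma HasCds.coker (hf : IsProperComplexityFunction f) {i : A →ₗ[R] B} {q : B →ₗ[R] C}
    (h : IsSES i q) (hA : HasCds R f A) (hB : HasCds R f B) : HasCds R f C := by
  obtain ⟨A', hA⟩ := hA
  obtain ⟨B', hB⟩ := hB
  have := HasCx.coker hf (A := A × A') (B := (B × B') × (A × A')) (C := (C × B') × A)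
    (i := LinearMap.prod (LinearMap.inl R B B' ∘ₗ i ∘ₗ LinearMap.fst R A A')
      (LinearMap.inr R A A' ∘ₗ LinearMap.snd R A A'))
    (q := LinearMap.prodMap (LinearMap.prodMap q LinearMap.id) (LinearMap.fst R A A'))
    ⟨fun x y hxy => Prod.ext (h.inj (congrArg (fun z => z.1.1) hxy))
        (congrArg (fun z => z.2.2) hxy),
      (h.surj.prodMap surjective_id).prodMap Prod.fst_surjective, by
      rintro ⟨⟨b, b'⟩, a, a'⟩
      constructor
      · intro h0
        have hb : q b = 0 := congrArg (fun z => z.1.1) h0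
        have hb' : b' = 0 := congrArg (fun z => z.1.2) h0
        have ha : a = 0 := congrArg (fun z => z.2) h0
        obtain ⟨a0, rfl⟩ := h.mem hb
        exact ⟨(a0, a'), by simp [hb', ha]⟩
      · rintro ⟨⟨a0, a1⟩, h1⟩
        simp only [LinearMap.prod_apply, Function.prod_apply, LinearMap.comp_apply,
          LinearMap.fst_apply, LinearMap.snd_apply, LinearMap.inl_apply, LinearMap.inr_apply,
          Prod.mk.injEq] at h1
        obtain ⟨⟨rfl, rfl⟩, rfl, rfl⟩ := h1
        simp [h.apply_apply]⟩ hA (hB.prod hA)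
  exact this.hasCds.of_retract (LinearMap.inl R _ _ ∘ₗ LinearMap.inl R _ _)
    (LinearMap.fst R _ _ ∘ₗ LinearMap.fst R _ _) (fun _ => rfl)

lemma HasCds.exists_cover (hf : IsProperComplexityFunction f) (hA : HasCds R f A) :
    ∃ (P : ModuleCat.{0} R) (q : P →ₗ[R] A), Module.Projective R P ∧ Module.Finite R P ∧
      Surjective q := by
  obtain ⟨N, hN⟩ := hA
  obtain ⟨K, P, i, q, hP, hfin, h, -⟩ := hN.tail hf
  exact ⟨P, LinearMap.fst R A N ∘ₗ q, hP, hfin, Prod.fst_surjective.comp h.surj⟩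

end Complexity

section Factor

variable {R : Type} [Ring R] {f : ℕ → NNReal} {A B C D : Type} [AddCommGroup A] [Module R A]
  [AddCommGroup B] [Module R B] [AddCommGroup C] [Module R C] [AddCommGroup D] [Module R D]

/-- The linear map `φ` factors through a module satisfying `HasCds`. -/
def FactorsCds (f : ℕ → NNReal) (φ : A →ₗ[R] B) : Prop :=
  ∃ (X : ModuleCat.{0} R) (a : A →ₗ[R] X) (b : X →ₗ[R] B), HasCds R f X ∧ ∀ x, b (a x) = φ x

lemma FactorsCds.of_comp (h : HasCds R f C) (a : A →ₗ[R] C) (b : C →ₗ[R] B) :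
    FactorsCds f (b ∘ₗ a) := ⟨ModuleCat.of R C, a, b, h, fun _ => rfl⟩

lemma FactorsCds.add {φ ψ : A →ₗ[R] B} (h : FactorsCds f φ) (h' : FactorsCds f ψ) :
    FactorsCds f (φ + ψ) := by
  obtain ⟨X, a, b, hX, h⟩ := h
  obtain ⟨Y, c, d, hY, h'⟩ := h'
  exact ⟨ModuleCat.of R (X × Y), a.prod c, b.coprod d, hX.prod hY, fun x => by simp [h, h']⟩

lemma FactorsCds.neg {φ : A →ₗ[R] B} (h : FactorsCds f φ) : FactorsCds f (-φ) := by
  obtain ⟨X, a, b, hX, h⟩ := h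
  exact ⟨X, a, -b, hX, fun x => by simp [h]⟩

lemma FactorsCds.sub {φ ψ : A →ₗ[R] B} (h : FactorsCds f φ) (h' : FactorsCds f ψ) :
    FactorsCds f (φ - ψ) := sub_eq_add_neg φ ψ ▸ h.add h'.neg

lemma factorsCds_zero : FactorsCds f (0 : A →ₗ[R] B) :=
  ⟨ModuleCat.of R PUnit, 0, 0, hasCds_of_subsingleton, fun _ => rfl⟩

lemma FactorsCds.sum {ι : Type*} {s : Finset ι} {φ : ι → A →ₗ[R] B}
    (h : ∀ x ∈ s, FactorsCds f (φ x)) : FactorsCds f (∑ x ∈ s, φ x) := by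
  classical
  induction s using Finset.induction_on with
  | empty => simpa using factorsCds_zero
  | insert a s ha ih =>
    rw [Finset.sum_insert ha]
    exact (h a (by simp)).add (ih fun x hx => h x (by simp [hx]))

lemma FactorsCds.comp_left {φ : A →ₗ[R] B} (h : FactorsCds f φ) (ψ : B →ₗ[R] C) :
    FactorsCds f (ψ ∘ₗ φ) := by
  obtain ⟨X, a, b, hX, h⟩ := h
  exact ⟨X, a, ψ ∘ₗ b, hX, fun x => by simp [h]⟩

lemma FactorsCds.comp_right {φ : A →ₗ[R] B} (h : FactorsCds f φ) (ψ : C →ₗ[R] A) :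
    FactorsCds f (φ ∘ₗ ψ) := by
  obtain ⟨X, a, b, hX, h⟩ := h
  exact ⟨X, a ∘ₗ ψ, b, hX, fun x => by simp [h]⟩

lemma FactorsCds.hasCds (h : FactorsCds f (LinearMap.id : A →ₗ[R] A)) : HasCds R f A := by
  obtain ⟨X, a, b, hX, h⟩ := h
  exact hX.of_retract a b h

/-- Maps factoring through `HasCds` can be cancelled along an injection with `HasCds` cokernel. -/
lemma FactorsCds.of_comp_injective (hf : IsProperComplexityFunction f) {i : B →ₗ[R] C}
    {q : C →ₗ[R] D} (h : IsSES i q) (hD : HasCds R f D) {φ : A →ₗ[R] B}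
    (hφ : FactorsCds f (i ∘ₗ φ)) : FactorsCds f φ := by
  obtain ⟨X, a, b, hX, hab⟩ := hφ
  obtain ⟨P, r, hP, hfin, hr⟩ := hD.exists_cover hf
  obtain ⟨s, hs⟩ := Module.projective_lifting_property q r h.surj
  have hs' : ∀ y, q (s y) = r y := fun y => LinearMap.congr_fun hs y
  let m : X × P →ₗ[R] C := LinearMap.coprod b s
  have hm : Surjective (q ∘ₗ m) := fun d => by
    obtain ⟨y, rfl⟩ := hr d
    exact ⟨(0, y), by simp [m, hs']⟩
  have hker : HasCds R f (LinearMap.ker (q ∘ₗ m)) :=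
    HasCds.ker hf (isSES_ker hm) (hX.prod (hasCds_of_projective hf)) hD
  obtain ⟨t, ht⟩ := exists_lift_of_injective h.inj
    (m ∘ₗ (LinearMap.ker (q ∘ₗ m)).subtype) (fun x => h.mem x.2)
  replace ht : ∀ x, i (t x) = m x.1 := ht
  have hma : ∀ x, m (a x, 0) = i (φ x) := fun x => by simp [m, hab]
  refine ⟨ModuleCat.of R (LinearMap.ker (q ∘ₗ m)), LinearMap.codRestrict _
    (LinearMap.inl R X P ∘ₗ a) (fun x => ?_), t, hker, fun x => h.inj ?_⟩
  · simp [hma, h.apply_apply]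
  · rw [ht]
    exact hma x

/-- A map vanishing on the kernel of a surjection onto a `HasCds` module factors. -/
lemma FactorsCds.of_ker_le {q : A →ₗ[R] C} (hq : Surjective q) (hC : HasCds R f C)
    (φ : A →ₗ[R] B) (h : ∀ x, q x = 0 → φ x = 0) : FactorsCds f φ := by
  obtain ⟨g, hg⟩ := exists_desc_of_surjective hq φ h
  exact ⟨ModuleCat.of R C, q, g, hC, hg⟩

end Factor

section MatrixFunctor

/-- A ring homomorphism from `S` to the ring of `B × B` matrices over `R`. -/
structure RingMat (S R B : Type) [Ring S] [Ring R] [Fintype B] where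
  val : S → B → B → R
  map_one_self : ∀ t, val 1 t t = 1
  map_one_ne : ∀ t u, t ≠ u → val 1 t u = 0
  map_mul : ∀ x y t u, val (x * y) t u = ∑ v, val x t v * val y v u
  map_zero : ∀ t u, val 0 t u = 0
  map_add : ∀ x y t u, val (x + y) t u = val x t u + val y t u

variable {S R B : Type} [Ring S] [Ring R] [Fintype B]

/-- The module `M ^ B` over `S` obtained from an `R`-module `M` through a matrix homomorphism. -/
def MatTw (_ : RingMat S R B) (M : Type) : Type := B → M

variable (c : RingMat S R B) {M N L : Type} [AddCommGroup M] [Module R M] [AddCommGroup N]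
  [Module R N] [AddCommGroup L] [Module R L]

instance : AddCommGroup (MatTw c M) := inferInstanceAs (AddCommGroup (B → M))

instance : Module S (MatTw c M) where
  smul x F := fun t => ∑ u, c.val x t u • F u
  one_smul F := funext fun t => by
    change ∑ u, c.val 1 t u • F u = F t
    rw [Finset.sum_eq_single t, c.map_one_self, one_smul]
    · intro u _ hu
      rw [c.map_one_ne t u hu.symm, zero_smul]
    · simp
  mul_smul x y F := funext fun t => by
    change ∑ u, c.val (x * y) t u • F u = ∑ v, c.val x t v • ∑ u, c.val y v u • F u
    simp_rw [c.map_mul, Finset.sum_smul, Finset.smul_sum, mul_smul]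
    exact Finset.sum_comm
  smul_zero x := funext fun t => Finset.sum_eq_zero fun u _ => smul_zero _
  smul_add x F F' := funext fun t => by
    change ∑ u, c.val x t u • (F u + F' u) = ∑ u, c.val x t u • F u + ∑ u, c.val x t u • F' u
    simp_rw [smul_add, Finset.sum_add_distrib]
  add_smul x y F := funext fun t => by
    change ∑ u, c.val (x + y) t u • F u = ∑ u, c.val x t u • F u + ∑ u, c.val y t u • F u
    simp_rw [c.map_add, add_smul, Finset.sum_add_distrib]
  zero_smul F := funext fun t => Finset.sum_eq_zero fun u _ => by rw [c.map_zero, zero_smul]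

lemma MatTw.smul_apply (x : S) (F : MatTw c M) (t : B) :
    (x • F) t = ∑ u, c.val x t u • F u := rfl

lemma MatTw.add_apply (F F' : MatTw c M) (t : B) : (F + F') t = F t + F' t := rfl

/-- Functoriality of `MatTw`. -/
def MatTw.map (φ : M →ₗ[R] N) : MatTw c M →ₗ[S] MatTw c N where
  toFun F := fun t => φ (F t)
  map_add' F F' := funext fun t => map_add φ _ _
  map_smul' x F := funext fun t => by
    simp only [MatTw.smul_apply, map_sum, map_smul, RingHom.id_apply]
    rfl

@[simp]
lemma MatTw.map_apply (φ : M →ₗ[R] N) (F : MatTw c M) (t : B) : MatTw.map c φ F t = φ (F t) :=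
  rfl

lemma MatTw.map_isSES {i : M →ₗ[R] N} {q : N →ₗ[R] L} (h : IsSES i q) :
    IsSES (MatTw.map c i) (MatTw.map c q) := by
  refine ⟨fun F F' hF => funext fun t => h.inj (congrFun hF t), fun F => ?_, fun F => ?_⟩
  · choose s hs using h.surj
    exact ⟨fun t => s (F t), funext fun t => hs _⟩
  · constructor
    · intro hF
      have : ∀ t, ∃ a, i a = F t := fun t => h.mem (congrFun hF t)
      choose s hs using this
      exact ⟨s, funext hs⟩
    · rintro ⟨F, rfl⟩
      exact funext fun t => h.apply_apply _

/-- `MatTw` commutes with binary products. -/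
def MatTw.prodEquiv : MatTw c (M × N) ≃ₗ[S] MatTw c M × MatTw c N where
  toFun F := (fun t => (F t).1, fun t => (F t).2)
  invFun F := fun t => (F.1 t, F.2 t)
  map_add' _ _ := rfl
  map_smul' x F := Prod.ext
    (funext fun t => by
      simp only [MatTw.smul_apply, Prod.fst_sum, Prod.smul_fst, RingHom.id_apply]
      rfl)
    (funext fun t => by
      simp only [MatTw.smul_apply, Prod.snd_sum, Prod.smul_snd, RingHom.id_apply]
      rfl)
  left_inv _ := rfl
  right_inv _ := rfl

/-- `MatTw` commutes with finite powers. -/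
def MatTw.piEquiv (ι : Type) : MatTw c (ι → M) ≃ₗ[S] (ι → MatTw c M) where
  toFun F := fun j t => F t j
  invFun F := fun t j => F j t
  map_add' _ _ := rfl
  map_smul' x F := funext fun j => funext fun t => by
    simp only [MatTw.smul_apply, Finset.sum_apply, Pi.smul_apply, RingHom.id_apply]
    rfl
  left_inv _ := rfl
  right_inv _ := rfl

lemma projective_pi_const (n : ℕ) (X : Type) [AddCommGroup X] [Module S X]
    [Module.Projective S X] : Module.Projective S (Fin n → X) :=
  Module.Projective.of_equiv (DFinsupp.linearEquivFunOnFintype (R := S) (M := fun _ : Fin n => X))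

lemma RankLE.pi_const {X : Type} [AddCommGroup X] [Module S X] {a : NNReal} (h : RankLE S X a)
    (n : ℕ) : RankLE S (Fin n → X) (n * a) := by
  induction n with
  | zero => exact rankLE_of_subsingleton _
  | succ n ih =>
    refine ((h.prod ih).of_surjective (Fin.consLinearEquiv S (fun _ : Fin (n + 1) => X)).toLinearMap
      (Fin.consLinearEquiv S (fun _ : Fin (n + 1) => X)).surjective).mono (le_of_eq ?_)
    push_cast
    ring

lemma RankLE.exists_surjective {a : NNReal} (h : RankLE R M a) :
    ∃ (n : ℕ) (q : (Fin n → R) →ₗ[R] M), Surjective q ∧ (n : NNReal) ≤ a := by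
  obtain ⟨s, hs, hc⟩ := h
  refine ⟨s.card, Fintype.linearCombination R (fun j => (s.equivFin.symm j : M)), ?_, hc⟩
  rw [← LinearMap.range_eq_top, Fintype.range_linearCombination, ← hs]
  congr 1
  ext x
  simp only [Set.mem_range, SetLike.mem_coe]
  constructor
  · rintro ⟨j, rfl⟩
    exact (s.equivFin.symm j).2
  · exact fun hx => ⟨s.equivFin ⟨x, hx⟩, by simp⟩

lemma HasSyz.matTw {r : NNReal} [Module.Projective S (MatTw c R)] (hr : RankLE S (MatTw c R) r)
    {β : ℕ → NNReal} (h : HasSyz R M β) : HasSyz S (MatTw c M) fun n => β n * r := by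
  obtain ⟨K, P, i, q, ⟨e⟩, h⟩ := h
  refine ⟨fun n => ModuleCat.of S (MatTw c (K n)), fun n => ModuleCat.of S (MatTw c (P n)),
    fun n => MatTw.map c (i n), fun n => MatTw.map c (q n), ⟨?_⟩, fun n => ?_⟩
  · exact LinearEquiv.ofLinear (MatTw.map c e.toLinearMap) (MatTw.map c e.symm.toLinearMap)
      (LinearMap.ext fun x => funext fun t => by simp)
      (LinearMap.ext fun x => funext fun t => by simp)
  · have := (h n).1
    obtain ⟨m, p, hp, hm⟩ := (h n).2.1.exists_surjective
    obtain ⟨s, hs⟩ := Module.projective_lifting_property p LinearMap.id hp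
    have := projective_pi_const (S := S) m (MatTw c R)
    let g : (Fin m → MatTw c R) →ₗ[S] MatTw c (P n) :=
      MatTw.map c p ∘ₗ (MatTw.piEquiv c (Fin m)).symm.toLinearMap
    let g' : MatTw c (P n) →ₗ[S] (Fin m → MatTw c R) :=
      (MatTw.piEquiv c (Fin m)).toLinearMap ∘ₗ MatTw.map c s
    have hgg : g ∘ₗ g' = LinearMap.id := LinearMap.ext fun x => funext fun t =>
      LinearMap.congr_fun hs (x t)
    refine ⟨Module.Projective.of_split g' g hgg, ?_, MatTw.map_isSES c (h n).2.2⟩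
    exact ((hr.pi_const m).of_surjective g fun x => ⟨g' x, LinearMap.congr_fun hgg x⟩).mono
      (mul_le_mul_left hm r)

lemma HasCds.matTw {f : ℕ → NNReal} [Module.Projective S (MatTw c R)]
    [Module.Finite S (MatTw c R)] (h : HasCds R f M) : HasCds S f (MatTw c M) := by
  obtain ⟨N, d, h⟩ := h
  obtain ⟨r, hr⟩ := exists_rankLE_of_finite S (MatTw c R)
  refine ⟨ModuleCat.of S (MatTw c N), d * r, ?_⟩
  refine ((h.matTw c hr).of_equiv (MatTw.prodEquiv c)).mono fun n => le_of_eq ?_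
  ring

end MatrixFunctor

section GroupMatrix

variable {k : Type} [Ring k] {G : Type} [Group G] {R B : Type} [Ring R] [Fintype B]

/-- A matrix homomorphism out of a group algebra, from its values on coefficients and on group
elements. -/
def RingMat.ofGroup (ι : k →+* R) (γ : G → B → B → R)
    (comm : ∀ a g t u, ι a * γ g t u = γ g t u * ι a) (one_self : ∀ t, γ 1 t t = 1)
    (one_ne : ∀ t u, t ≠ u → γ 1 t u = 0)
    (mul : ∀ g h t u, γ (g * h) t u = ∑ v, γ g t v * γ h v u) :
    RingMat (MonoidAlgebra k G) R B where
  val x t u := MonoidAlgebra.liftNC (ι : k →+ R) (fun g => γ g t u) x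
  map_one_self t := by simp [MonoidAlgebra.one_def, one_self]
  map_one_ne t u h := by simp [MonoidAlgebra.one_def, one_ne t u h]
  map_zero t u := _root_.map_zero _
  map_add x y t u := _root_.map_add _ x y
  map_mul x y t u := by
    induction x using MonoidAlgebra.induction_linear with
    | zero => simp
    | add x x' hx hx' => simp only [add_mul, _root_.map_add, hx, hx', Finset.sum_add_distrib]
    | single g a =>
      induction y using MonoidAlgebra.induction_linear with
      | zero => simp
      | add y y' hy hy' => simp only [mul_add, _root_.map_add, hy, hy', Finset.sum_add_distrib]
      | single h b =>
        simp only [MonoidAlgebra.single_mul_single, MonoidAlgebra.liftNC_single,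
          AddMonoidHom.coe_coe, _root_.map_mul, mul, Finset.mul_sum]
        refine Finset.sum_congr rfl fun v _ => ?_
        rw [mul_assoc, mul_assoc, ← mul_assoc (ι b), comm b, mul_assoc]

lemma RingMat.ofGroup_single (ι : k →+* R) (γ : G → B → B → R) (comm one_self one_ne mul)
    (g : G) (a : k) (t u : B) :
    (RingMat.ofGroup ι γ comm one_self one_ne mul).val (MonoidAlgebra.single g a) t u =
      ι a * γ g t u :=
  MonoidAlgebra.liftNC_single _ _ _ _

variable {X Y : Type} [AddCommGroup X] [Module (MonoidAlgebra k G) X] [AddCommGroup Y]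
  [Module (MonoidAlgebra k G) Y]

/-- An additive map commuting with the monomials of a group algebra is linear. -/
def linearOfSingle (φ : X →+ Y) (h : ∀ (g : G) (a : k) x,
    φ (MonoidAlgebra.single g a • x) = MonoidAlgebra.single g a • φ x) :
    X →ₗ[MonoidAlgebra k G] Y where
  toFun := φ
  map_add' := map_add φ
  map_smul' r x := by
    induction r using MonoidAlgebra.induction_linear with
    | zero => simp
    | add r r' hr hr' =>
      simp only [RingHom.id_apply] at hr hr' ⊢
      rw [add_smul, map_add, hr, hr', add_smul]
    | single g a => exact h g a x

@[simp]
lemma linearOfSingle_apply (φ : X →+ Y) (h : ∀ (g : G) (a : k) x,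
    φ (MonoidAlgebra.single g a • x) = MonoidAlgebra.single g a • φ x) (x : X) :
    linearOfSingle φ h x = φ x := rfl

/-- A bijective additive map commuting with the monomials of a group algebra is a linear
equivalence. -/
def linearEquivOfSingle (φ : X ≃+ Y) (h : ∀ (g : G) (a : k) x,
    φ (MonoidAlgebra.single g a • x) = MonoidAlgebra.single g a • φ x) :
    X ≃ₗ[MonoidAlgebra k G] Y :=
  { linearOfSingle φ.toAddMonoidHom h with
    invFun := φ.symm
    left_inv := φ.left_inv
    right_inv := φ.right_inv }

end GroupMatrix

section Twist

/-- An integral matrix representation of a group, with rows and columns indexed by `B`. -/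
structure MatRep (Q B : Type) [Group Q] [Fintype B] where
  val : Q → B → B → ℤ
  one_self : ∀ t, val 1 t t = 1
  one_ne : ∀ t u, t ≠ u → val 1 t u = 0
  mul : ∀ g h t u, val (g * h) t u = ∑ v, val g t v * val h v u

/-- Restriction of a matrix representation along a group homomorphism. -/
def MatRep.comp {Q G B : Type} [Group Q] [Group G] [Fintype B] (ρ : MatRep Q B) (π : G →* Q) :
    MatRep G B where
  val g := ρ.val (π g)
  one_self := by simpa using ρ.one_self
  one_ne := by simpa using ρ.one_ne
  mul := by simpa using fun g h => ρ.mul (π g) (π h)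

variable {k : Type} [Ring k] {G : Type} [Group G] {B : Type} [Fintype B]

variable (k) in
/-- The matrix homomorphism defining diagonal twists. -/
def MatRep.ringMat (ρ : MatRep G B) : RingMat (MonoidAlgebra k G) (MonoidAlgebra k G) B :=
  RingMat.ofGroup MonoidAlgebra.singleOneRingHom
    (fun g t u => ρ.val g t u • MonoidAlgebra.single g 1)
    (fun a g t u => by
      rw [mul_smul_comm, smul_mul_assoc]
      simp)
    (fun t => by simp [ρ.one_self, MonoidAlgebra.one_def])
    (fun t u h => by simp [ρ.one_ne t u h])
    (fun g h t u => by
      simp only [ρ.mul, Finset.sum_smul, smul_mul_smul_comm, MonoidAlgebra.single_mul_single,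
        mul_one])

/-- The twist `M ⊗ ℤ^B` of a `k[G]`-module by an integral matrix representation. -/
abbrev Tw (k : Type) [Ring k] {G : Type} [Group G] {B : Type} [Fintype B] (ρ : MatRep G B)
    (M : Type) : Type := MatTw (ρ.ringMat k) M

variable (ρ : MatRep G B) {M : Type} [AddCommGroup M] [Module (MonoidAlgebra k G) M]

lemma Tw.single_smul_apply (g : G) (a : k) (F : Tw k ρ M) (t : B) :
    (MonoidAlgebra.single g a • F) t =
      ∑ u, ρ.val g t u • (MonoidAlgebra.single g a • F u : M) := by
  rw [MatTw.smul_apply]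
  refine Finset.sum_congr rfl fun u _ => ?_
  rw [MatRep.ringMat, RingMat.ofGroup_single, mul_smul_comm, smul_assoc]
  simp

/-- Scaling the coefficients of an element of a group algebra. -/
def coeffScale (w : G → ℤ) : MonoidAlgebra k G →+ MonoidAlgebra k G where
  toFun x := MonoidAlgebra.ofCoeff (Finsupp.onFinset x.coeff.support (fun g => w g • x.coeff g)
    (fun g hg => by
      rw [Finsupp.mem_support_iff]
      rintro h
      simp [h] at hg))
  map_zero' := by ext; simp
  map_add' x y := by ext; simp

@[simp]
lemma coeffScale_coeff (w : G → ℤ) (x : MonoidAlgebra k G) (g : G) :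
    (coeffScale w x).coeff g = w g • x.coeff g := rfl

lemma MatRep.sum_inv_mul (g : G) (t : B) (F : B → M) :
    ∑ v, ρ.val g⁻¹ t v • ∑ u, ρ.val g v u • F u = F t := by
  simp_rw [Finset.smul_sum, smul_smul]
  rw [Finset.sum_comm]
  simp_rw [← Finset.sum_smul, ← ρ.mul, inv_mul_cancel]
  rw [Finset.sum_eq_single t, ρ.one_self, one_smul]
  · intro u _ hu
    rw [ρ.one_ne t u hu.symm, zero_smul]
  · simp

lemma MatRep.sum_mul_inv (g : G) (t : B) (F : B → M) :
    ∑ v, ρ.val g t v • ∑ u, ρ.val g⁻¹ v u • F u = F t := by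
  simpa using ρ.sum_inv_mul g⁻¹ t F

/-- The twist of the regular module is free. -/
def Tw.regularEquiv : (B → MonoidAlgebra k G) ≃ₗ[MonoidAlgebra k G] Tw k ρ (MonoidAlgebra k G) :=
  linearEquivOfSingle
    { toFun := fun F t => ∑ u, coeffScale (fun g => ρ.val g t u) (F u)
      invFun := fun F t => ∑ u, coeffScale (fun g => ρ.val g⁻¹ t u) (F u)
      left_inv := fun F => funext fun t => by
        ext g
        simpa [Finset.mul_sum] using ρ.sum_inv_mul g t (fun u => (F u).coeff g)
      right_inv := fun F => funext fun t => by
        ext g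
        simpa [Finset.mul_sum] using ρ.sum_mul_inv g t (fun u => (F u).coeff g)
      map_add' := fun F F' => funext fun t => by
        simp only [Pi.add_apply, map_add, Finset.sum_add_distrib]
        rfl }
    (fun g a F => funext fun t => by
      rw [Tw.single_smul_apply]
      ext h
      have key : ∀ u, ρ.val h t u = ∑ v, ρ.val g t v * ρ.val (g⁻¹ * h) v u := fun u => by
        rw [← ρ.mul, mul_inv_cancel_left]
      have hc : ∀ x : MonoidAlgebra k G, (MonoidAlgebra.single g a * x).coeff h =
          a * x.coeff (g⁻¹ * h) := fun x => x.coeff_single_mul_eq_mul_coeff _ (by simp [eq_inv_mul_iff_mul_eq])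
      change (∑ u, coeffScale (fun g => ρ.val g t u) (MonoidAlgebra.single g a * F u)).coeff h =
        (∑ v, ρ.val g t v • (MonoidAlgebra.single g a *
          ∑ u, coeffScale (fun g => ρ.val g v u) (F u))).coeff h
      simp only [MonoidAlgebra.coeff_sum,
        Finsupp.finsetSum_apply, coeffScale_coeff, MonoidAlgebra.coeff_smul, Finsupp.smul_apply, hc,
        key, Finset.sum_smul, Finset.mul_sum, Finset.smul_sum]
      rw [Finset.sum_comm]
      simp_rw [mul_smul, mul_smul_comm])

instance : Module.Projective (MonoidAlgebra k G) (Tw k ρ (MonoidAlgebra k G)) :=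
  Module.Projective.of_equiv (Tw.regularEquiv ρ)

instance : Module.Finite (MonoidAlgebra k G) (Tw k ρ (MonoidAlgebra k G)) :=
  Module.Finite.equiv (Tw.regularEquiv ρ)

lemma HasCds.tw {f : ℕ → NNReal} (h : HasCds (MonoidAlgebra k G) f M) :
    HasCds (MonoidAlgebra k G) f (Tw k ρ M) := h.matTw _

end Twist

section Induction

open Classical in
/-- The permutation representation of a group on a finite set. -/
def MatRep.perm (Q X : Type) [Group Q] [Fintype X] [MulAction Q X] : MatRep Q X where
  val g x y := if g • y = x then 1 else 0
  one_self := by simp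
  one_ne t u h := by simp [h.symm]
  mul g h t u := by
    rw [Finset.sum_eq_single (h • u)]
    · simp [mul_smul]
    · intro v _ hv
      simp [hv.symm]
    · simp

open Classical in
lemma MatRep.perm_val {Q X : Type} [Group Q] [Fintype X] [MulAction Q X] (g : Q) (x y : X) :
    (MatRep.perm Q X).val g x y = if g • y = x then 1 else 0 := rfl

variable {k : Type} [Ring k] {G : Type} [Group G]

section

variable {X : Type} [Fintype X] [MulAction G X] {M : Type} [AddCommGroup M]
  [Module (MonoidAlgebra k G) M]

lemma Tw.single_smul_perm (g : G) (a : k) (F : Tw k (MatRep.perm G X) M) (x : X) :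
    (MonoidAlgebra.single g a • F) x = MonoidAlgebra.single g a • F (g⁻¹ • x) := by
  classical
  rw [Tw.single_smul_apply, Finset.sum_eq_single (g⁻¹ • x)]
  · simp [MatRep.perm_val]
  · intro y _ hy
    rw [MatRep.perm_val, if_neg fun h => hy (by rw [← h, inv_smul_smul]), zero_smul]
  · simp

end

/-- Data presenting a transitive `G`-set as induced from a group `N` embedded as the stabilizer of
a point. -/
structure InductionData (N G X : Type) [Group N] [Group G] [MulAction G X] where
  hom : N →* G
  inj : Injective hom
  base : X
  sec : X → G
  sec_smul : ∀ x, sec x • base = x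
  stab : ∀ g, g • base = base ↔ g ∈ hom.range

namespace InductionData

variable {N X : Type} [Group N] [MulAction G X] (D : InductionData N G X)

/-- The partial inverse of the embedding of the stabilizer. -/
def inv (g : G) : N := invFun D.hom g

lemma hom_inv {g : G} (h : g • D.base = D.base) : D.hom (D.inv g) = g :=
  invFun_eq ((D.stab g).1 h)

lemma hom_smul (n : N) : D.hom n • D.base = D.base := (D.stab _).2 ⟨n, rfl⟩

/-- The element of the stabilizer measuring how `g` moves the point `y`. -/
def cocycle (g : G) (y : X) : N := D.inv ((D.sec (g • y))⁻¹ * g * D.sec y)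

lemma hom_cocycle (g : G) (y : X) :
    D.hom (D.cocycle g y) = (D.sec (g • y))⁻¹ * g * D.sec y := by
  refine D.hom_inv ?_
  rw [mul_smul, mul_smul, D.sec_smul, inv_smul_eq_iff, D.sec_smul]

lemma cocycle_one (y : X) : D.cocycle 1 y = 1 := by
  apply D.inj
  rw [hom_cocycle]
  simp

lemma cocycle_mul (g h : G) (y : X) :
    D.cocycle (g * h) y = D.cocycle g (h • y) * D.cocycle h y := by
  apply D.inj
  rw [map_mul, hom_cocycle, hom_cocycle, hom_cocycle, mul_smul]
  group

variable [Fintype X]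

open Classical in
variable (k) in
/-- The matrix homomorphism defining induction of modules. -/
def ringMat : RingMat (MonoidAlgebra k G) (MonoidAlgebra k N) X :=
  RingMat.ofGroup MonoidAlgebra.singleOneRingHom
    (fun g x y => if g • y = x then MonoidAlgebra.single (D.cocycle g y) 1 else 0)
    (fun a g x y => by split_ifs <;> simp)
    (fun x => by simp [cocycle_one, MonoidAlgebra.one_def])
    (fun x y h => by simp [h.symm])
    (fun g h x y => by
      rw [Finset.sum_eq_single (h • y)]
      · simp [cocycle_mul, mul_smul]
      · intro v _ hv
        simp [hv.symm]
      · simp)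

section

variable {M : Type} [AddCommGroup M] [Module (MonoidAlgebra k N) M]

lemma single_smul_apply (g : G) (a : k) (F : MatTw (D.ringMat k) M) (y : X) :
    (MonoidAlgebra.single g a • F) (g • y) =
      MonoidAlgebra.single (D.cocycle g y) a • F y := by
  classical
  rw [MatTw.smul_apply, Finset.sum_eq_single y]
  · rw [ringMat, RingMat.ofGroup_single]
    simp
  · intro z _ hz
    rw [ringMat, RingMat.ofGroup_single, if_neg (by simpa using hz)]
    simp
  · simp

end

open Classical in
variable (k) in
/-- The generator of the induced regular module. -/
def gen : MatTw (D.ringMat k) (MonoidAlgebra k N) :=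
  fun x => if x = D.base then MonoidAlgebra.single (1 : N) (1 : k) else 0

open Classical in
lemma single_smul_gen (g : G) (a : k) (x : X) :
    (MonoidAlgebra.single g a • D.gen k) (g • x) =
      if x = D.base then MonoidAlgebra.single (D.cocycle g D.base) a else 0 := by
  rw [single_smul_apply]
  by_cases h : x = D.base
  · simp [gen, h]
  · simp [gen, h]

/-- The inverse of the action on the generator. -/
def genInv : MatTw (D.ringMat k) (MonoidAlgebra k N) →+ MonoidAlgebra k G where
  toFun F := ∑ x, MonoidAlgebra.single (D.sec x) 1 *
    MonoidAlgebra.mapDomainRingHom k D.hom (F x) * MonoidAlgebra.single (D.sec D.base)⁻¹ 1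
  map_zero' := Finset.sum_eq_zero fun x _ => by
    rw [show (0 : MatTw (D.ringMat k) (MonoidAlgebra k N)) x = 0 from rfl]
    simp
  map_add' F F' := by
    rw [← Finset.sum_add_distrib]
    refine Finset.sum_congr rfl fun x _ => ?_
    rw [MatTw.add_apply, map_add, mul_add, add_mul]

lemma genInv_smul_gen (r : MonoidAlgebra k G) : D.genInv (r • D.gen k) = r := by
  classical
  induction r using MonoidAlgebra.induction_linear with
  | zero => simp
  | add r r' hr hr' => rw [add_smul, map_add, hr, hr']
  | single g a =>
    change ∑ x, _ = _
    rw [Finset.sum_eq_single (g • D.base)]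
    · rw [single_smul_gen]
      simp [hom_cocycle, mul_assoc]
    · intro x _ hx
      rw [← smul_inv_smul g x, single_smul_gen, if_neg]
      · simp
      · rintro h
        exact hx (by rw [← h, smul_inv_smul])
    · simp

lemma smul_gen_surjective (F : MatTw (D.ringMat k) (MonoidAlgebra k N)) :
    ∃ r : MonoidAlgebra k G, r • D.gen k = F := by
  classical
  have key : ∀ (x : X) (y : MonoidAlgebra k N),
      ∃ r : MonoidAlgebra k G, r • D.gen k = (Pi.single x y : X → MonoidAlgebra k N) := by
    intro x y
    induction y using MonoidAlgebra.induction_linear with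
    | zero => exact ⟨0, by rw [zero_smul, Pi.single_zero]; rfl⟩
    | add y y' hy hy' =>
      obtain ⟨r, hr⟩ := hy
      obtain ⟨r', hr'⟩ := hy'
      exact ⟨r + r', by rw [add_smul, hr, hr', Pi.single_add]; rfl⟩
    | single n a =>
      set g := D.sec x * D.hom n * (D.sec D.base)⁻¹ with hg
      have hg' : g • D.base = x := by
        have : (D.sec D.base)⁻¹ • D.base = D.base := by
          rw [inv_smul_eq_iff, D.sec_smul]
        rw [hg, mul_smul, mul_smul, this, D.hom_smul, D.sec_smul]
      refine ⟨MonoidAlgebra.single g a, funext fun z => ?_⟩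
      rw [← smul_inv_smul g z, single_smul_gen]
      by_cases h : g⁻¹ • z = D.base
      · have hz : z = x := by rw [← hg', ← h, smul_inv_smul]
        subst hz
        have hc : D.cocycle g D.base = n := by
          apply D.inj
          rw [hom_cocycle, hg']
          simp [hg, mul_assoc]
        rw [if_pos h, hc, smul_inv_smul, Pi.single_eq_same]
      · rw [if_neg h, smul_inv_smul, Pi.single_eq_of_ne]
        rintro rfl
        exact h (by rw [inv_smul_eq_iff, hg'])
  choose r hr using key
  refine ⟨∑ x, r x (F x), ?_⟩
  rw [Finset.sum_smul]
  simp_rw [hr]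
  exact Finset.univ_sum_single (F : X → MonoidAlgebra k N)

variable (k) in
/-- The induced regular module is regular. -/
def regularEquiv : MonoidAlgebra k G ≃ₗ[MonoidAlgebra k G]
    MatTw (D.ringMat k) (MonoidAlgebra k N) :=
  LinearEquiv.ofBijective (LinearMap.toSpanSingleton _ _ (D.gen k))
    ⟨LeftInverse.injective (g := D.genInv) D.genInv_smul_gen, D.smul_gen_surjective⟩

lemma hasCds_tw_perm {M M' : Type} [AddCommGroup M] [Module (MonoidAlgebra k G) M]
    [AddCommGroup M'] [Module (MonoidAlgebra k N) M'] (e : M' ≃+ M)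
    (he : ∀ n (a : k) m, e (MonoidAlgebra.single n a • m) =
      MonoidAlgebra.single (D.hom n) a • e m) {f : ℕ → NNReal}
    (h : HasCds (MonoidAlgebra k N) f M') :
    HasCds (MonoidAlgebra k G) f (Tw k (MatRep.perm G X) M) := by
  have := Module.Projective.of_equiv (D.regularEquiv k)
  have := Module.Finite.equiv (D.regularEquiv k)
  let φ : MatTw (D.ringMat k) M' ≃+ Tw k (MatRep.perm G X) M :=
    { toFun := fun F x => (MonoidAlgebra.single (D.sec x) (1 : k) • e (F x) : M)
      invFun := fun F x => e.symm (MonoidAlgebra.single (D.sec x)⁻¹ (1 : k) • F x)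
      left_inv := fun F => funext fun x => by
        simp [← mul_smul, MonoidAlgebra.single_mul_single, ← MonoidAlgebra.one_def]
      right_inv := fun F => funext fun x => by
        simp [← mul_smul, MonoidAlgebra.single_mul_single, ← MonoidAlgebra.one_def]
      map_add' := fun F F' => funext fun x => by
        rw [MatTw.add_apply, map_add, smul_add]
        rfl }
  refine (h.matTw (D.ringMat k)).of_equiv (linearEquivOfSingle φ fun g a F => funext fun x => ?_)
  rw [Tw.single_smul_perm]
  obtain ⟨y, rfl⟩ : ∃ y, x = g • y := ⟨g⁻¹ • x, by simp⟩
  rw [inv_smul_smul]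
  change MonoidAlgebra.single (D.sec (g • y)) (1 : k) • e ((MonoidAlgebra.single g a • F) (g • y)) =
    MonoidAlgebra.single g a • MonoidAlgebra.single (D.sec y) (1 : k) • e (F y)
  rw [single_smul_apply, he, hom_cocycle, ← mul_smul, ← mul_smul, MonoidAlgebra.single_mul_single,
    MonoidAlgebra.single_mul_single]
  simp [mul_assoc]

end InductionData

end Induction

section TwCds

variable {k : Type} [Ring k] {G Q : Type} [Group G] [Group Q] {f : ℕ → NNReal} {π : G →* Q}
  {M : Type} [AddCommGroup M] [Module (MonoidAlgebra k G) M] {B C : Type} [Fintype B] [Fintype C]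

/-- The twist of `M` by the representation `ρ` of the quotient `Q` belongs to the class `HasCds`. -/
def TwCds (k : Type) [Ring k] {G Q : Type} [Group G] [Group Q] (f : ℕ → NNReal) (π : G →* Q)
    (M : Type) [AddCommGroup M] [Module (MonoidAlgebra k G) M] {B : Type} [Fintype B]
    (ρ : MatRep Q B) : Prop :=
  HasCds (MonoidAlgebra k G) f (Tw k (ρ.comp π) M)

lemma Tw.comp_single_smul_apply (ρ : MatRep Q B) (g : G) (a : k) (F : Tw k (ρ.comp π) M) (t : B) :
    (MonoidAlgebra.single g a • F) t =
      ∑ u, ρ.val (π g) t u • (MonoidAlgebra.single g a • F u : M) :=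
  Tw.single_smul_apply _ g a F t

/-- The linear map of twists attached to an intertwining matrix. -/
def Tw.mapMat {ρ : MatRep Q B} {σ : MatRep Q C} (T : C → B → ℤ)
    (h : ∀ g t s, ∑ u, T t u * ρ.val g u s = ∑ u, σ.val g t u * T u s) :
    Tw k (ρ.comp π) M →ₗ[MonoidAlgebra k G] Tw k (σ.comp π) M :=
  linearOfSingle
    { toFun := fun F t => ∑ s, T t s • F s
      map_zero' := funext fun t => Finset.sum_eq_zero fun s _ => smul_zero _
      map_add' := fun F F' => funext fun t => by
        simp_rw [MatTw.add_apply, smul_add, Finset.sum_add_distrib]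
        rfl }
    (fun g a F => funext fun t => by
      rw [Tw.comp_single_smul_apply]
      change ∑ s, T t s • (MonoidAlgebra.single g a • F) s =
        ∑ u, σ.val (π g) t u • (MonoidAlgebra.single g a • ∑ s, T u s • F s)
      simp_rw [Tw.comp_single_smul_apply, Finset.smul_sum, smul_smul]
      rw [Finset.sum_comm]
      simp_rw [smul_comm (MonoidAlgebra.single g a) (_ : ℤ), smul_smul, ← Finset.sum_smul, h]
      rw [Finset.sum_comm (γ := C)]
      simp_rw [← Finset.sum_smul])

lemma Tw.mapMat_apply {ρ : MatRep Q B} {σ : MatRep Q C} (T : C → B → ℤ)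
    (h : ∀ g t s, ∑ u, T t u * ρ.val g u s = ∑ u, σ.val g t u * T u s)
    (F : Tw k (ρ.comp π) M) (t : C) : Tw.mapMat T h F t = ∑ s, T t s • F s := rfl

/-- The map `M → M ⊗ ℤ^B` attached to an invariant vector. -/
def Tw.ofInvariant {ρ : MatRep Q B} (v : B → ℤ) (h : ∀ g t, ∑ u, ρ.val g t u * v u = v t) :
    M →ₗ[MonoidAlgebra k G] Tw k (ρ.comp π) M :=
  linearOfSingle
    { toFun := fun m t => v t • m
      map_zero' := funext fun t => smul_zero _
      map_add' := fun m m' => funext fun t => smul_add _ _ _ }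
    (fun g a m => funext fun t => by
      rw [Tw.comp_single_smul_apply]
      change v t • _ = ∑ u, ρ.val (π g) t u • (MonoidAlgebra.single g a • (v u • m))
      simp_rw [smul_comm (MonoidAlgebra.single g a) (_ : ℤ), smul_smul, ← Finset.sum_smul, h])

lemma Tw.ofInvariant_apply {ρ : MatRep Q B} (v : B → ℤ)
    (h : ∀ g t, ∑ u, ρ.val g t u * v u = v t) (m : M) (t : B) :
    (Tw.ofInvariant v h m : Tw k (ρ.comp π) M) t = v t • m := rfl

/-- The map `M ⊗ ℤ^B → M` attached to an invariant covector. -/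
def Tw.toInvariant {ρ : MatRep Q B} (v : B → ℤ) (h : ∀ g s, ∑ u, v u * ρ.val g u s = v s) :
    Tw k (ρ.comp π) M →ₗ[MonoidAlgebra k G] M :=
  linearOfSingle
    { toFun := fun F => ∑ t, v t • F t
      map_zero' := Finset.sum_eq_zero fun s _ => smul_zero _
      map_add' := fun F F' => by
        simp_rw [MatTw.add_apply, smul_add, Finset.sum_add_distrib] }
    (fun g a F => by
      change ∑ s, v s • (MonoidAlgebra.single g a • F) s =
        (MonoidAlgebra.single g a • ∑ s, v s • F s)
      simp_rw [Tw.comp_single_smul_apply, Finset.smul_sum, smul_smul]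
      rw [Finset.sum_comm]
      simp_rw [smul_comm (MonoidAlgebra.single g a) (_ : ℤ), ← Finset.sum_smul, h])

lemma Tw.toInvariant_apply {ρ : MatRep Q B} (v : B → ℤ)
    (h : ∀ g s, ∑ u, v u * ρ.val g u s = v s) (F : Tw k (ρ.comp π) M) :
    Tw.toInvariant v h F = ∑ t, v t • F t := rfl

open Classical in
lemma TwCds.of_retract {ρ : MatRep Q B} {σ : MatRep Q C} (hσ : TwCds k f π M σ)
    (T : C → B → ℤ) (h : ∀ g t s, ∑ u, T t u * ρ.val g u s = ∑ u, σ.val g t u * T u s)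
    (T' : B → C → ℤ) (h' : ∀ g t s, ∑ u, T' t u * σ.val g u s = ∑ u, ρ.val g t u * T' u s)
    (hT : ∀ t s, ∑ u, T' t u * T u s = if t = s then 1 else 0) : TwCds k f π M ρ := by
  refine HasCds.of_retract hσ (Tw.mapMat T h) (Tw.mapMat T' h') fun F => funext fun t => ?_
  simp_rw [Tw.mapMat_apply, Finset.smul_sum, smul_smul]
  rw [Finset.sum_comm]
  simp_rw [← Finset.sum_smul, hT, ite_smul, one_smul, zero_smul]
  exact (Finset.sum_ite_eq _ t _).trans (if_pos (Finset.mem_univ t))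

lemma TwCds.of_reindex {ρ : MatRep Q B} {σ : MatRep Q C} (hσ : TwCds k f π M σ) (e : B ≃ C)
    (h : ∀ g t s, σ.val g (e t) (e s) = ρ.val g t s) : TwCds k f π M ρ := by
  let φ : Tw k (ρ.comp π) M ≃+ Tw k (σ.comp π) M :=
    { toFun := fun F t => F (e.symm t)
      invFun := fun F t => F (e t)
      left_inv := fun F => funext fun t => by simp
      right_inv := fun F => funext fun t => by simp
      map_add' := fun F F' => rfl }
  refine HasCds.of_equiv hσ (linearEquivOfSingle φ fun g a F => funext fun t => ?_).symm
  rw [Tw.comp_single_smul_apply]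
  change (MonoidAlgebra.single g a • F) (e.symm t) =
    ∑ u, σ.val (π g) t u • (MonoidAlgebra.single g a • F (e.symm u))
  rw [Tw.comp_single_smul_apply, ← e.sum_comp]
  refine Finset.sum_congr rfl fun u _ => ?_
  rw [← h]
  simp

section Block

variable (ρ : MatRep Q B) (p : B → Prop) [Fintype {t // p t}] [Fintype {t // ¬ p t}]
  (hp : ∀ g t s, p s → ¬ p t → ρ.val g t s = 0)

lemma sum_subtype_add_sum_subtype {A : Type} [AddCommMonoid A] (F : B → A) :
    ∑ u, F u = ∑ u : {t // p t}, F u + ∑ u : {t // ¬ p t}, F u := by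
  classical
  rw [← Fintype.sum_subtype_add_sum_subtype p F]
  congr!

lemma MatRep.sum_of_mem (hp : ∀ g t s, p s → ¬ p t → ρ.val g t s = 0) {A : Type}
    [AddCommGroup A] (g : Q) (F : B → A) {t : B} (ht : ¬ p t) :
    ∑ u, ρ.val g t u • F u = ∑ u : {t // ¬ p t}, ρ.val g t u • F u := by
  rw [sum_subtype_add_sum_subtype p, Finset.sum_eq_zero, zero_add]
  intro u _
  rw [hp g t u u.2 ht, zero_smul]

/-- The subrepresentation spanned by a set of basis vectors. -/
def MatRep.sub : MatRep Q {t // p t} where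
  val g t s := ρ.val g t s
  one_self t := ρ.one_self t
  one_ne t u h := ρ.one_ne t u fun h' => h (Subtype.ext h')
  mul g h t u := by
    rw [ρ.mul]
    rw [sum_subtype_add_sum_subtype p, add_eq_left]
    refine Finset.sum_eq_zero fun v _ => ?_
    rw [hp h v u u.2 v.2, mul_zero]

/-- The quotient representation by the span of a set of basis vectors. -/
def MatRep.quot : MatRep Q {t // ¬ p t} where
  val g t s := ρ.val g t s
  one_self t := ρ.one_self t
  one_ne t u h := ρ.one_ne t u fun h' => h (Subtype.ext h')
  mul g h t u := by
    rw [ρ.mul]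
    rw [sum_subtype_add_sum_subtype p, add_eq_right]
    refine Finset.sum_eq_zero fun v _ => ?_
    rw [hp g t v v.2 t.2, zero_mul]

open Classical in
variable (k π M) in
/-- The inclusion of the twist by a subrepresentation. -/
def Tw.subIncl : Tw k ((ρ.sub p hp).comp π) M →ₗ[MonoidAlgebra k G] Tw k (ρ.comp π) M :=
  linearOfSingle
    { toFun := fun F t => if h : p t then F ⟨t, h⟩ else 0
      map_zero' := funext fun t => by
        change (if h : p t then (0 : M) else 0) = 0
        simp
      map_add' := fun F F' => funext fun t => by
        change (if h : p t then F ⟨t, h⟩ + F' ⟨t, h⟩ else 0) =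
          (if h : p t then F ⟨t, h⟩ else 0) + (if h : p t then F' ⟨t, h⟩ else 0)
        split_ifs
        · rfl
        · simp }
    (fun g a F => funext fun t => by
      rw [Tw.comp_single_smul_apply]
      change (if h : p t then (MonoidAlgebra.single g a • F) ⟨t, h⟩ else 0) =
        ∑ u, ρ.val (π g) t u • (MonoidAlgebra.single g a • (if h : p u then F ⟨u, h⟩ else 0 : M))
      rw [sum_subtype_add_sum_subtype p]
      rw [Finset.sum_eq_zero (s := (Finset.univ : Finset {t // ¬ p t}))]
      · rw [add_zero]
        split_ifs with h
        · rw [Tw.comp_single_smul_apply]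
          refine Finset.sum_congr rfl fun u _ => ?_
          rw [dif_pos u.2]
          rfl
        · refine (Finset.sum_eq_zero fun u _ => ?_).symm
          rw [hp _ t u u.2 h, zero_smul]
      · intro u _
        rw [dif_neg u.2, smul_zero, smul_zero])

variable (k π M) in
/-- The projection onto the twist by a quotient representation. -/
def Tw.quotProj : Tw k (ρ.comp π) M →ₗ[MonoidAlgebra k G] Tw k ((ρ.quot p hp).comp π) M :=
  linearOfSingle
    { toFun := fun F t => F t
      map_zero' := rfl
      map_add' := fun F F' => rfl }
    (fun g a F => funext fun t => by
      rw [Tw.comp_single_smul_apply]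
      change (MonoidAlgebra.single g a • F) t = _
      rw [Tw.comp_single_smul_apply, ρ.sum_of_mem p hp _ _ t.2]
      rfl)

lemma Tw.isSES_sub_quot : IsSES (Tw.subIncl k π M ρ p hp) (Tw.quotProj k π M ρ p hp) := by
  classical
  refine ⟨fun F F' h => funext fun t => ?_, fun F => ?_, fun F => ⟨fun h => ?_, ?_⟩⟩
  · have := congrFun h t
    change (if h : p t then F ⟨t, h⟩ else 0) = (if h : p t then F' ⟨t, h⟩ else 0) at this
    rwa [dif_pos t.2, dif_pos t.2] at this
  · refine ⟨fun t => if h : p t then 0 else F ⟨t, h⟩, funext fun t => ?_⟩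
    exact dif_neg t.2
  · refine ⟨fun t => F t, funext fun t => ?_⟩
    change (if h : p t then F t else 0) = F t
    split_ifs with ht
    · rfl
    · exact (congrFun h ⟨t, ht⟩).symm
  · rintro ⟨F, rfl⟩
    exact funext fun t => dif_neg t.2

lemma TwCds.of_sub_quot (h : TwCds k f π M (ρ.sub p hp)) (h' : TwCds k f π M (ρ.quot p hp)) :
    TwCds k f π M ρ := HasCds.ext (Tw.isSES_sub_quot ρ p hp) h h'

variable {ρ p hp}

lemma TwCds.quot (hf : IsProperComplexityFunction f) (h : TwCds k f π M (ρ.sub p hp))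
    (h' : TwCds k f π M ρ) : TwCds k f π M (ρ.quot p hp) :=
  HasCds.coker hf (Tw.isSES_sub_quot ρ p hp) h h'

end Block

end TwCds

section Permutation

variable {k : Type} [Ring k] {G Q : Type} [Group G] [Group Q] {f : ℕ → NNReal} {π : G →* Q}
  {M : Type} [AddCommGroup M] [Module (MonoidAlgebra k G) M]

/-- The restrictions of `M` to the preimages of all proper subgroups of `Q` belong to the class
`HasCds`. -/
def ProperCds (k : Type) [Ring k] {G Q : Type} [Group G] [Group Q] (f : ℕ → NNReal) (π : G →* Q)
    (M : Type) [AddCommGroup M] [Module (MonoidAlgebra k G) M] : Prop :=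
  ∀ U : Subgroup Q, U ≠ ⊤ → HasCds (MonoidAlgebra k (U.comap π)) f
    (resMod k (U.comap π) (ModuleCat.of (MonoidAlgebra k G) M))

variable (k M) in
/-- Restriction does not change the underlying group. -/
def resModEquiv (U : Subgroup G) : resMod k U (ModuleCat.of (MonoidAlgebra k G) M) ≃+ M where
  toFun m := m
  invFun m := m
  left_inv _ := rfl
  right_inv _ := rfl
  map_add' _ _ := rfl

lemma resModEquiv_single_smul (U : Subgroup G) (u : U) (a : k)
    (m : resMod k U (ModuleCat.of (MonoidAlgebra k G) M)) :
    resModEquiv k M U (MonoidAlgebra.single u a • m) =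
      MonoidAlgebra.single (u : G) a • resModEquiv k M U m := by
  rw [show resModEquiv k M U (MonoidAlgebra.single u a • m) =
    subgroupRingHom k U (MonoidAlgebra.single u a) • resModEquiv k M U m from rfl]
  simp [subgroupRingHom]

lemma MatRep.perm_intertwines {X Y : Type} [Fintype X] [Fintype Y] [MulAction Q X] [MulAction Q Y]
    (T : Y → X → ℤ) (h : ∀ (g : Q) y x, T (g • y) (g • x) = T y x) (g : Q) (t : Y) (s : X) :
    ∑ u, T t u * (MatRep.perm Q X).val g u s = ∑ u, (MatRep.perm Q Y).val g t u * T u s := by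
  classical
  simp_rw [MatRep.perm_val]
  rw [Finset.sum_eq_single (g • s), Finset.sum_eq_single (g⁻¹ • t)]
  · rw [if_pos rfl, if_pos (by simp), ← h g⁻¹]
    simp
  · intro u _ hu
    rw [if_neg fun h => hu (by rw [← h, inv_smul_smul]), zero_mul]
  · simp
  · intro u _ hu
    rw [if_neg fun h => hu h.symm, mul_zero]
  · simp

lemma TwCds.perm_of_isPretransitive (hM : ProperCds k f π M) (hπ : Surjective π) {X : Type}
    [Fintype X] [MulAction Q X] [MulAction.IsPretransitive Q X] (x₀ : X) (g₀ : Q)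
    (h₀ : g₀ • x₀ ≠ x₀) : TwCds k f π M (MatRep.perm Q X) := by
  let U := MulAction.stabilizer Q x₀
  let _ : MulAction G X := MulAction.compHom X π
  have hU : U ≠ ⊤ := fun h => h₀ (by
    have : g₀ ∈ U := h ▸ Subgroup.mem_top g₀
    exact this)
  have hsec : ∀ x : X, ∃ g : G, g • x₀ = x := fun x => by
    obtain ⟨q, hq⟩ := MulAction.exists_smul_eq Q x₀ x
    obtain ⟨g, rfl⟩ := hπ q
    exact ⟨g, hq⟩
  choose sec hsec using hsec
  let D : InductionData (U.comap π) G X :=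
    { hom := (U.comap π).subtype
      inj := Subtype.val_injective
      base := x₀
      sec := sec
      sec_smul := hsec
      stab := fun g => by
        rw [Subgroup.range_subtype]
        rfl }
  exact D.hasCds_tw_perm (resModEquiv k M _) (resModEquiv_single_smul _) (hM U hU)

lemma TwCds.perm (hM : ProperCds k f π M) (hπ : Surjective π) {X : Type}
    [Fintype X] [MulAction Q X] (h₀ : ∀ x : X, ∃ g : Q, g • x ≠ x) :
    TwCds k f π M (MatRep.perm Q X) := by
  classical
  have hX : ∀ ω : MulAction.orbitRel.Quotient Q X,
      TwCds k f π M (MatRep.perm Q ω.orbit) := fun ω => by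
    obtain ⟨x, hx⟩ := MulAction.orbitRel.Quotient.nonempty_orbit ω
    obtain ⟨g, hg⟩ := h₀ x
    exact TwCds.perm_of_isPretransitive hM hπ ⟨x, hx⟩ g fun h => hg (congrArg Subtype.val h)
  let a : ∀ ω : MulAction.orbitRel.Quotient Q X, Tw k ((MatRep.perm Q X).comp π) M
      →ₗ[MonoidAlgebra k G] Tw k ((MatRep.perm Q ω.orbit).comp π) M := fun ω =>
    Tw.mapMat (fun t s => if (t : X) = s then 1 else 0)
      (MatRep.perm_intertwines _ fun g y x => by simp)
  let b : ∀ ω : MulAction.orbitRel.Quotient Q X, Tw k ((MatRep.perm Q ω.orbit).comp π) M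
      →ₗ[MonoidAlgebra k G] Tw k ((MatRep.perm Q X).comp π) M := fun ω =>
    Tw.mapMat (fun s t => if (t : X) = s then 1 else 0)
      (MatRep.perm_intertwines _ fun g y x => by simp)
  have ha : ∀ ω F t, a ω F t = F t := fun ω F t => by
    rw [Tw.mapMat_apply, Finset.sum_eq_single (t : X)]
    · simp
    · intro u _ hu
      rw [if_neg hu.symm, zero_smul]
    · simp
  have hb : ∀ ω F x, b ω F x = if h : x ∈ ω.orbit then F ⟨x, h⟩ else 0 := fun ω F x => by
    rw [Tw.mapMat_apply]
    split_ifs with h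
    · rw [Finset.sum_eq_single ⟨x, h⟩]
      · simp
      · intro u _ hu
        rw [if_neg fun h' => hu (Subtype.ext h'), zero_smul]
      · simp
    · refine Finset.sum_eq_zero fun u _ => ?_
      rw [if_neg, zero_smul]
      rintro rfl
      exact h u.2
  have hid : (LinearMap.id : _ →ₗ[MonoidAlgebra k G] Tw k ((MatRep.perm Q X).comp π) M) =
      ∑ ω, b ω ∘ₗ a ω := LinearMap.ext fun F => funext fun x => by
    rw [LinearMap.sum_apply]
    rw [show (∑ ω, (b ω ∘ₗ a ω) F) x = ∑ ω, b ω (a ω F) x from Finset.sum_apply x _ _]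
    simp_rw [hb, ha]
    rw [Finset.sum_eq_single (Quotient.mk _ x)]
    · rw [dif_pos (MulAction.orbitRel.Quotient.mem_orbit.2 rfl)]
      rfl
    · intro ω _ hω
      rw [dif_neg fun h => hω (MulAction.orbitRel.Quotient.mem_orbit.1 h).symm]
    · simp
  refine FactorsCds.hasCds ?_
  rw [hid]
  exact FactorsCds.sum fun ω _ => FactorsCds.of_comp (hX ω) _ _

variable {B : Type} [Fintype B]

/-- A representation whose basis vectors are permuted up to a system of imprimitivity without
fixed blocks. -/
lemma TwCds.of_imprimitive (hM : ProperCds k f π M) (hπ : Surjective π) {X : Type}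
    [Finite X] [MulAction Q X] (ρ : MatRep Q B) (S : B → X)
    (hS : ∀ g t s, ρ.val g t s ≠ 0 → S t = g • S s) (h₀ : ∀ t, ∃ g : Q, g • S t ≠ S t) :
    TwCds k f π M ρ := by
  classical
  let Y : SubMulAction Q X :=
    { carrier := {x | ∃ g : Q, g • x ≠ x}
      smul_mem' := by
        rintro h x ⟨g, hg⟩
        refine ⟨h * g * h⁻¹, fun h' => hg ?_⟩
        simpa [mul_smul] using h' }
  let _ : Fintype Y := Fintype.ofFinite Y
  have hY : TwCds k f π M (MatRep.perm Q Y) := by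
    refine TwCds.perm hM hπ ?_
    rintro ⟨x, g, hg⟩
    exact ⟨g, fun h => hg (congrArg Subtype.val h)⟩
  let S' : B → Y := fun t => ⟨S t, h₀ t⟩
  have hS' : ∀ g t s, ρ.val g t s ≠ 0 → S' t = g • S' s := fun g t s h => Subtype.ext (hS g t s h)
  have hperm : ∀ (g : G) (a : k) (F : Tw k ((MatRep.perm Q Y).comp π) M) (y : Y),
      (MonoidAlgebra.single g a • F) y = MonoidAlgebra.single g a • F ((π g)⁻¹ • y) := by
    intro g a F y
    let _ : MulAction G Y := MulAction.compHom Y π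
    rw [← map_inv]
    exact Tw.single_smul_perm (X := Y) g a F y
  have hsum : ∀ (w : B → ℤ) (F : B → Tw k ((MatRep.perm Q Y).comp π) M) (y : Y),
      (∑ u, w u • F u) y = ∑ u, w u • (F u y : M) := fun w F y => Finset.sum_apply y _ _
  let i : Tw k (ρ.comp π) M →ₗ[MonoidAlgebra k G]
      Tw k (ρ.comp π) (Tw k ((MatRep.perm Q Y).comp π) M) :=
    linearOfSingle
      { toFun := fun F t x => if S' t = x then F t else 0
        map_zero' := funext fun t => funext fun x => by
          change (if S' t = x then (0 : M) else 0) = 0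
          simp
        map_add' := fun F F' => funext fun t => funext fun x => by
          change (if S' t = x then F t + F' t else 0) =
            (if S' t = x then F t else 0) + (if S' t = x then F' t else 0)
          split_ifs <;> simp }
      (fun g a F => funext fun t => funext fun x => by
        rw [Tw.comp_single_smul_apply, hsum]
        simp_rw [hperm]
        change (if S' t = x then (MonoidAlgebra.single g a • F) t else 0) =
          ∑ u, ρ.val (π g) t u • (MonoidAlgebra.single g a •
            (if S' u = (π g)⁻¹ • x then F u else 0) : M)
        rw [Tw.comp_single_smul_apply]
        split_ifs with h
        · refine Finset.sum_congr rfl fun u _ => ?_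
          by_cases hu : ρ.val (π g) t u = 0
          · simp [hu]
          · rw [if_pos]
            rw [← h, hS' _ _ _ hu, inv_smul_smul]
        · refine (Finset.sum_eq_zero fun u _ => ?_).symm
          by_cases hu : ρ.val (π g) t u = 0
          · simp [hu]
          · rw [if_neg, smul_zero, smul_zero]
            rintro h'
            exact h (by rw [hS' _ _ _ hu, h', smul_inv_smul]))
  let r : Tw k (ρ.comp π) (Tw k ((MatRep.perm Q Y).comp π) M) →ₗ[MonoidAlgebra k G]
      Tw k (ρ.comp π) M :=
    linearOfSingle
      { toFun := fun F t => F t (S' t)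
        map_zero' := rfl
        map_add' := fun F F' => rfl }
      (fun g a F => funext fun t => by
        rw [Tw.comp_single_smul_apply]
        change (MonoidAlgebra.single g a • F) t (S' t) = _
        rw [Tw.comp_single_smul_apply, hsum]
        refine Finset.sum_congr rfl fun u _ => ?_
        rw [hperm]
        by_cases hu : ρ.val (π g) t u = 0
        · simp [hu]
        · rw [hS' _ _ _ hu, inv_smul_smul]
          rfl)
  exact HasCds.of_retract (HasCds.tw (ρ.comp π) hY) i r fun F => funext fun t => if_pos rfl

end Permutation

section TensorPower

variable {k : Type} [Ring k] {G Q : Type} [Group G] [Group Q] {f : ℕ → NNReal} {π : G →* Q}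
  {M : Type} [AddCommGroup M] [Module (MonoidAlgebra k G) M]

/-- A filtered version of `TwCds.of_imprimitive`. -/
lemma TwCds.of_filtered (hM : ProperCds k f π M) (hπ : Surjective π) {X : Type}
    [Finite X] [MulAction Q X] {B : Type} [Fintype B] (ρ : MatRep Q B) (S : B → X) (ht : B → ℕ)
    (hS : ∀ g t s, ρ.val g t s ≠ 0 → ht s < ht t ∨ ht s = ht t ∧ S t = g • S s)
    (h₀ : ∀ t, ∃ g : Q, g • S t ≠ S t) : TwCds k f π M ρ := by
  classical
  induction hn : Fintype.card B using Nat.strong_induction_on generalizing B with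
  | _ n ih =>
  rcases isEmpty_or_nonempty B with hB | hB
  · have : Subsingleton (Tw k (ρ.comp π) M) := inferInstanceAs (Subsingleton (B → M))
    exact hasCds_of_subsingleton
  obtain ⟨b, hb⟩ := Finite.exists_max ht
  have hp : ∀ g t s, ht s = ht b → ¬ ht t = ht b → ρ.val g t s = 0 := fun g t s hs ht' => by
    by_contra h
    have := hS g t s h
    have := hb t
    omega
  refine TwCds.of_sub_quot ρ (fun t => ht t = ht b) hp ?_ ?_
  · refine TwCds.of_imprimitive hM hπ _ (fun t => S t) (fun g t s h => ?_) fun t => h₀ t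
    have := t.2
    have := s.2
    rcases hS g t s h with h | h
    · omega
    · exact h.2
  · refine ih _ ?_ _ (fun t => S t) (fun t => ht t) (fun g t s h => hS g t s h) (fun t => h₀ t) rfl
    rw [← hn]
    exact Fintype.card_subtype_lt (x := b) (by simp)

variable {B C I : Type} [Fintype B] [Fintype C] [Fintype I] [DecidableEq I] [MulAction Q I]

lemma prod_sum_eq_sum_prod {A : Type} [CommRing A] (F : I → B → A) :
    ∏ x, ∑ b, F x b = ∑ t : I → B, ∏ x, F x (t x) := by
  rw [Finset.prod_univ_sum, Fintype.piFinset_univ]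

lemma prod_comp_smul {A : Type} [CommMonoid A] (g : Q) (F : I → A) :
    ∏ x, F (g • x) = ∏ x, F x :=
  Equiv.prod_comp (MulAction.toPerm g) F

lemma sum_comp_smul {A : Type} [AddCommMonoid A] (g : Q) (F : (I → B) → A) :
    ∑ t : I → B, F (fun x => t (g • x)) = ∑ t : I → B, F t :=
  Equiv.sum_comp (Equiv.arrowCongr (MulAction.toPerm g) (Equiv.refl B)).symm F

/-- The tensor power of a representation with factors indexed by, and permuted along, `I`. -/
def MatRep.tpow (ρ : MatRep Q B) (I : Type) [Fintype I] [DecidableEq I] [MulAction Q I] :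
    MatRep Q (I → B) where
  val g t s := ∏ x, ρ.val g (t (g • x)) (s x)
  one_self t := by simp [ρ.one_self]
  one_ne t u h := by
    obtain ⟨x, hx⟩ := Function.ne_iff.1 h
    exact Finset.prod_eq_zero (Finset.mem_univ x) (by simpa using ρ.one_ne _ _ hx)
  mul g h t u := by
    simp_rw [ρ.mul, prod_sum_eq_sum_prod, Finset.prod_mul_distrib]
    rw [← sum_comp_smul h]
    refine Finset.sum_congr rfl fun v _ => ?_
    rw [← prod_comp_smul h fun x => ρ.val g (t (g • x)) (v x)]
    simp_rw [mul_smul]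

lemma MatRep.tpow_val (ρ : MatRep Q B) (g : Q) (t s : I → B) :
    (ρ.tpow I).val g t s = ∏ x, ρ.val g (t (g • x)) (s x) := rfl

lemma MatRep.tpow_ne_zero {ρ : MatRep Q B} {g : Q} {t s : I → B}
    (h : (ρ.tpow I).val g t s ≠ 0) (x : I) : ρ.val g (t (g • x)) (s x) ≠ 0 :=
  Finset.prod_ne_zero_iff.1 h x (Finset.mem_univ x)

lemma MatRep.tpow_intertwines {ρ : MatRep Q B} {σ : MatRep Q C} {T : C → B → ℤ}
    (h : ∀ g t s, ∑ u, T t u * ρ.val g u s = ∑ u, σ.val g t u * T u s) (g : Q) (t : I → C)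
    (s : I → B) : ∑ u : I → B, (∏ x, T (t x) (u x)) * (ρ.tpow I).val g u s =
      ∑ u : I → C, (σ.tpow I).val g t u * ∏ x, T (u x) (s x) := by
  have key : ∏ x, ∑ u, T (t (g • x)) u * ρ.val g u (s x) =
      ∏ x, ∑ u, σ.val g (t (g • x)) u * T u (s x) :=
    Finset.prod_congr rfl fun x _ => h g _ _
  simp_rw [prod_sum_eq_sum_prod, Finset.prod_mul_distrib] at key
  refine Eq.trans (Eq.symm ?_) key
  rw [← sum_comp_smul g]
  refine Finset.sum_congr rfl fun u _ => ?_
  rw [MatRep.tpow_val, ← prod_comp_smul g fun x => T (t x) (u x)]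

/-- Equivariant families of vectors have invariant tensor products. -/
lemma MatRep.tpow_invariant {ρ : MatRep Q B} {v : I → B → ℤ}
    (h : ∀ g x t, ∑ u, ρ.val g t u * v x u = v (g • x) t) (g : Q) (t : I → B) :
    ∑ u : I → B, (ρ.tpow I).val g t u * ∏ x, v x (u x) = ∏ x, v x (t x) := by
  rw [← prod_comp_smul g fun x => v x (t x)]
  simp_rw [← h, prod_sum_eq_sum_prod, Finset.prod_mul_distrib]
  rfl

lemma TwCds.tpow_perm (hM : ProperCds k f π M) (hπ : Surjective π) {Ω : Type} [Fintype Ω]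
    [MulAction Q Ω] (x₀ : I) (hΩ : ∀ ω : Ω, ∃ g : Q, g • x₀ = x₀ ∧ g • ω ≠ ω) :
    TwCds k f π M ((MatRep.perm Q Ω).tpow I) := by
  classical
  let _ : MulAction Q (Set (I × Ω)) := Set.mulActionSet
  refine TwCds.of_imprimitive hM hπ _ (fun t : I → Ω => {y : I × Ω | y.2 = t y.1})
    (fun g t s h => ?_) fun t => ?_
  · have h' : ∀ x, g • s x = t (g • x) := fun x => by
      simpa [MatRep.perm_val] using MatRep.tpow_ne_zero h x
    ext ⟨x, ω⟩
    rw [Set.mem_smul_set_iff_inv_smul_mem]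
    change ω = t x ↔ g⁻¹ • ω = s (g⁻¹ • x)
    rw [inv_smul_eq_iff, h', smul_inv_smul]
  · obtain ⟨g, hg, hω⟩ := hΩ (t x₀)
    refine ⟨g, fun h => hω ?_⟩
    have : (x₀, t x₀) ∈ {y : I × Ω | y.2 = t y.1} := rfl
    have := Set.smul_mem_smul_set (a := g) this
    rw [h] at this
    change g • t x₀ = t (g • x₀) at this
    rw [this, hg]

end TensorPower

section TensorPowerBlock

variable {k : Type} [Ring k] {G Q : Type} [Group G] [Group Q] {f : ℕ → NNReal} {π : G →* Q}
  {M : Type} [AddCommGroup M] [Module (MonoidAlgebra k G) M]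
  {B I : Type} [Fintype B] [Fintype I] [DecidableEq I] [MulAction Q I]
  {ρ : MatRep Q B} {p : B → Prop} [Fintype {t // p t}] [Fintype {t // ¬ p t}]
  [Fintype {t : I → B // ∀ x, p (t x)}] [Fintype {t : I → B // ¬ ∀ x, p (t x)}]

lemma MatRep.tpow_block (hp : ∀ g t s, p s → ¬ p t → ρ.val g t s = 0) (g : Q) (t s : I → B)
    (hs : ∀ x, p (s x)) (ht : ¬ ∀ x, p (t x)) : (ρ.tpow I).val g t s = 0 := by
  push Not at ht
  obtain ⟨x, hx⟩ := ht
  refine Finset.prod_eq_zero (Finset.mem_univ (g⁻¹ • x)) ?_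
  rw [smul_inv_smul]
  exact hp g _ _ (hs _) hx

variable {hp : ∀ g t s, p s → ¬ p t → ρ.val g t s = 0}

lemma TwCds.tpow_sub (h : TwCds k f π M ((ρ.sub p hp).tpow I)) :
    TwCds k f π M ((ρ.tpow I).sub (fun t => ∀ x, p (t x)) (MatRep.tpow_block hp)) :=
  h.of_reindex (Equiv.subtypePiEquivPi (β := fun _ => B) (p := fun _ => p)) fun _ _ _ => rfl

/-- The quotient of a tensor power by the tensor power of a subrepresentation is controlled by the
tensor power of the quotient. -/
lemma TwCds.tpow_quot_iff (hf : IsProperComplexityFunction f) (hM : ProperCds k f π M)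
    (hπ : Surjective π) [MulAction.IsPretransitive Q I] [Nonempty I] :
    TwCds k f π M ((ρ.tpow I).quot (fun t => ∀ x, p (t x)) (MatRep.tpow_block hp)) ↔
      TwCds k f π M ((ρ.quot p hp).tpow I) := by
  classical
  set Z := (ρ.tpow I).quot (fun t => ∀ x, p (t x)) (MatRep.tpow_block hp) with hZ
  have hZp : ∀ g (t s : {t : I → B // ¬ ∀ x, p (t x)}), (∃ x, p (s.1 x)) →
      (¬ ∃ x, p (t.1 x)) → Z.val g t s = 0 := fun g t s ⟨x, hx⟩ ht =>
    Finset.prod_eq_zero (Finset.mem_univ x) (hp g _ _ hx fun h => ht ⟨_, h⟩)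
  have hsub : TwCds k f π M (Z.sub (fun t => ∃ x, p (t.1 x)) hZp) := by
    let _ : MulAction Q (Set I) := Set.mulActionSet
    let S : {t : {t : I → B // ¬ ∀ x, p (t x)} // ∃ x, p (t.1 x)} → Set I :=
      fun t => {x | p (t.1.1 x)}
    refine TwCds.of_filtered hM hπ _ S (fun t => (S t).ncard) (fun g t s h => ?_) fun t => ?_
    · have h' : g • S s ⊆ S t := by
        rintro _ ⟨x, hx, rfl⟩
        by_contra hx'
        exact MatRep.tpow_ne_zero (t := t.1.1) (s := s.1.1) h x (hp g _ _ hx hx')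
      have hc : (g • S s).ncard = (S s).ncard := Set.ncard_image_of_injective _
        (MulAction.injective g)
      rcases (Set.ncard_le_ncard h' (Set.toFinite _)).lt_or_eq with hlt | heq
      · exact Or.inl (hc ▸ hlt)
      · exact Or.inr ⟨hc ▸ heq, (Set.eq_of_subset_of_ncard_le h' heq.ge (Set.toFinite _)).symm⟩
    · obtain ⟨x, hx⟩ := t.2
      obtain ⟨y, hy⟩ := not_forall.1 t.1.2
      obtain ⟨g, rfl⟩ := MulAction.exists_smul_eq Q x y
      refine ⟨g, fun h => hy ?_⟩
      have : g • x ∈ g • S t := Set.smul_mem_smul_set hx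
      rwa [h] at this
  let e : {t : {t : I → B // ¬ ∀ x, p (t x)} // ¬ ∃ x, p (t.1 x)} ≃ (I → {b // ¬ p b}) :=
    { toFun := fun t x => ⟨t.1.1 x, fun h => t.2 ⟨x, h⟩⟩
      invFun := fun t => ⟨⟨fun x => t x, fun h => (t (Classical.arbitrary I)).2 (h _)⟩,
        fun ⟨x, h⟩ => (t x).2 h⟩
      left_inv := fun t => rfl
      right_inv := fun t => rfl }
  constructor
  · intro h
    exact (TwCds.quot hf hsub h).of_reindex e.symm fun g t s => rfl
  · intro h
    exact TwCds.of_sub_quot Z _ hZp hsub (h.of_reindex e fun g t s => rfl)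

/-- Tensor powers of cokernels. -/
lemma TwCds.tpow_quot (hf : IsProperComplexityFunction f) (hM : ProperCds k f π M)
    (hπ : Surjective π) [MulAction.IsPretransitive Q I] [Nonempty I]
    (h : TwCds k f π M ((ρ.sub p hp).tpow I)) (h' : TwCds k f π M (ρ.tpow I)) :
    TwCds k f π M ((ρ.quot p hp).tpow I) := by
  classical
  exact (TwCds.tpow_quot_iff hf hM hπ).1 (TwCds.quot hf h.tpow_sub h')

end TensorPowerBlock

section Lattice

variable {k : Type} [Ring k] {G Q : Type} [Group G] [Group Q] {f : ℕ → NNReal} {π : G →* Q}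
  {M : Type} [AddCommGroup M] [Module (MonoidAlgebra k G) M]
  {I : Type} [Fintype I] [DecidableEq I] [MulAction Q I]

variable {V V₁ V₂ V₃ : Type} [AddCommGroup V] [AddCommGroup V₁] [AddCommGroup V₂] [AddCommGroup V₃]

/-- The matrix of a linear map. -/
def basisMat {B C : Type} (b : Module.Basis B ℤ V₁) (c : Module.Basis C ℤ V₂) (T : V₁ →ₗ[ℤ] V₂) :
    C → B → ℤ := fun t s => c.repr (T (b s)) t

lemma basisMat_sum {B C : Type} [Fintype B] (b : Module.Basis B ℤ V₁) (c : Module.Basis C ℤ V₂)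
    (T : V₁ →ₗ[ℤ] V₂) (t : C) (v : V₁) : ∑ u, basisMat b c T t u * b.repr v u = c.repr (T v) t := by
  conv_rhs => rw [← b.sum_repr v]
  simp only [map_sum, map_smul, Finsupp.coe_finsetSum, Finset.sum_apply, Finsupp.smul_apply,
    smul_eq_mul, basisMat, mul_comm]

/-- The matrices of a representation with respect to a basis. -/
def Representation.matRep {V : Type} [AddCommGroup V] (r : Representation ℤ Q V) {B : Type}
    [Fintype B] (b : Module.Basis B ℤ V) : MatRep Q B where
  val g t s := b.repr (r g (b s)) t
  one_self t := by simp
  one_ne t u h := by simp [Finsupp.single_eq_of_ne h]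
  mul g h t u := by
    rw [map_mul, Module.End.mul_apply]
    exact (basisMat_sum b b (r g) t (r h (b u))).symm

lemma Representation.matRep_val (r : Representation ℤ Q V) {B : Type} [Fintype B]
    (b : Module.Basis B ℤ V) (g : Q) (t s : B) : (r.matRep b).val g t s = b.repr (r g (b s)) t :=
  rfl

lemma Representation.matRep_sum (r : Representation ℤ Q V) {B : Type} [Fintype B]
    (b : Module.Basis B ℤ V) (g : Q) (t : B) (v : V) :
    ∑ u, (r.matRep b).val g t u * b.repr v u = b.repr (r g v) t :=
  basisMat_sum b b (r g) t v

lemma basisMat_intertwines {B C : Type} [Fintype B] [Fintype C] (b : Module.Basis B ℤ V₁)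
    (c : Module.Basis C ℤ V₂) (T : V₁ →ₗ[ℤ] V₂) {r₁ : Representation ℤ Q V₁}
    {r₂ : Representation ℤ Q V₂} (hT : ∀ g v, T (r₁ g v) = r₂ g (T v)) (g : Q) (t : C) (s : B) :
    ∑ u, basisMat b c T t u * (r₁.matRep b).val g u s =
      ∑ u, (r₂.matRep c).val g t u * basisMat b c T u s := by
  simp_rw [Representation.matRep_val r₁, basisMat_sum, basisMat, Representation.matRep_sum, hT]

/-- The twist of `M` by the tensor power of a lattice belongs to the class `HasCds`. -/
def TpowCds (k : Type) [Ring k] {G Q : Type} [Group G] [Group Q] (f : ℕ → NNReal) (π : G →* Q)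
    (M : Type) [AddCommGroup M] [Module (MonoidAlgebra k G) M] (I : Type) [Fintype I]
    [DecidableEq I] [MulAction Q I] {V : Type} [AddCommGroup V] (r : Representation ℤ Q V) : Prop :=
  ∀ (B : Type) [Fintype B] (b : Module.Basis B ℤ V), TwCds k f π M ((r.matRep b).tpow I)

lemma TwCds.tpowCds {r : Representation ℤ Q V} {B : Type} [Fintype B] {b : Module.Basis B ℤ V}
    (h : TwCds k f π M ((r.matRep b).tpow I)) : TpowCds k f π M I r := by
  classical
  intro C _ c
  refine h.of_retract (fun t s => ∏ x, basisMat c b LinearMap.id (t x) (s x))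
    (MatRep.tpow_intertwines (basisMat_intertwines c b _ fun _ _ => rfl))
    (fun t s => ∏ x, basisMat b c LinearMap.id (t x) (s x))
    (MatRep.tpow_intertwines (basisMat_intertwines b c _ fun _ _ => rfl)) fun t s => ?_
  have key : ∏ x, ∑ u, basisMat b c LinearMap.id (t x) u * basisMat c b LinearMap.id u (s x) =
      if t = s then 1 else 0 := by
    simp_rw [basisMat.eq_1 c b, basisMat_sum]
    simp only [LinearMap.id_apply, Module.Basis.repr_self, Finsupp.single_apply]
    rw [Finset.prod_boole]
    simp [funext_iff, eq_comm]
  rw [prod_sum_eq_sum_prod] at key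
  simp_rw [Finset.prod_mul_distrib] at key
  convert key

lemma TwCds.tpow_of_reindex {B C : Type} [Fintype B] [Fintype C] {ρ : MatRep Q B} {σ : MatRep Q C}
    (hσ : TwCds k f π M (σ.tpow I)) (e : B ≃ C)
    (h : ∀ g t s, σ.val g (e t) (e s) = ρ.val g t s) : TwCds k f π M (ρ.tpow I) :=
  hσ.of_reindex (Equiv.arrowCongr (Equiv.refl I) e) fun g t s => by
    simp [MatRep.tpow_val, h]

/-- A basis of the middle term of a short exact sequence of lattices. -/
lemma exists_basis_of_isSES {i : V₁ →ₗ[ℤ] V₂} {q : V₂ →ₗ[ℤ] V₃} (h : IsSES i q) {B C : Type}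
    (b : Module.Basis B ℤ V₁) (c : Module.Basis C ℤ V₃) :
    ∃ d : Module.Basis (B ⊕ C) ℤ V₂, (∀ t, d (Sum.inl t) = i (b t)) ∧
      (∀ v s, d.repr (i v) (Sum.inl s) = b.repr v s) ∧
      ∀ v s, d.repr v (Sum.inr s) = c.repr (q v) s := by
  have : Module.Free ℤ V₃ := Module.Free.of_basis c
  obtain ⟨s, hs⟩ := Module.projective_lifting_property q LinearMap.id h.surj
  have hs' : ∀ v, q (s v) = v := fun v => LinearMap.congr_fun hs v
  let e : (V₁ × V₃) ≃ₗ[ℤ] V₂ := LinearEquiv.ofBijective (i.coprod s) (by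
    constructor
    · rw [injective_iff_map_eq_zero]
      rintro ⟨x, y⟩ hxy
      have hxy : i x + s y = 0 := hxy
      have hy : y = 0 := by simpa [h.apply_apply, hs'] using congrArg q hxy
      subst hy
      have hx : i x = i 0 := by simpa using hxy
      rw [h.inj hx]
      rfl
    · intro v
      obtain ⟨x, hx⟩ := h.mem (b := v - s (q v)) (by simp [hs'])
      exact ⟨(x, q v), by simp [hx]⟩)
  have he : ∀ x y, e (x, y) = i x + s y := fun x y => rfl
  refine ⟨(b.prod c).map e, fun t => ?_, fun v t => ?_, fun v t => ?_⟩
  · simp [he]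
  · have : e.symm (i v) = (v, 0) := e.symm_apply_eq.2 (by simp [he])
    simp [this]
  · obtain ⟨⟨x, y⟩, rfl⟩ := e.surjective v
    have hq : q (e (x, y)) = y := by rw [he, map_add, h.apply_apply, hs', zero_add]
    rw [hq]
    simp

section Ses

variable {i : V₁ →ₗ[ℤ] V₂} {q : V₂ →ₗ[ℤ] V₃} {r₁ : Representation ℤ Q V₁}
  {r₂ : Representation ℤ Q V₂} {r₃ : Representation ℤ Q V₃} 

lemma TpowCds.coker (hf : IsProperComplexityFunction f) (hM : ProperCds k f π M)
    (hπ : Surjective π) [MulAction.IsPretransitive Q I] [Nonempty I] (h : IsSES i q)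
    (hi : ∀ g v, i (r₁ g v) = r₂ g (i v)) (hq : ∀ g v, q (r₂ g v) = r₃ g (q v))
    [Module.Free ℤ V₁] [Module.Finite ℤ V₁] (h₁ : TpowCds k f π M I r₁)
    (h₂ : TpowCds k f π M I r₂) : TpowCds k f π M I r₃ := by
  classical
  intro C _ c
  obtain ⟨d, hd, hd₁, hd₂⟩ := exists_basis_of_isSES h (Module.Free.chooseBasis ℤ V₁) c
  let p : Module.Free.ChooseBasisIndex ℤ V₁ ⊕ C → Prop := fun t => t.isLeft
  have hp : ∀ g t s, p s → ¬ p t → (r₂.matRep d).val g t s = 0 := by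
    rintro g (t | t) (s | s) hs ht
    · exact absurd rfl ht
    · exact absurd rfl ht
    · rw [Representation.matRep_val, hd₂, hd, hq, h.apply_apply]
      simp
    · simp [p] at hs
  have key : TwCds k f π M (((r₂.matRep d).quot p hp).tpow I) := by
    refine TwCds.tpow_quot hf hM hπ ?_ (h₂ _ d)
    let e : {t // p t} ≃ Module.Free.ChooseBasisIndex ℤ V₁ :=
      { toFun := fun t => t.1.getLeft t.2
        invFun := fun t => ⟨Sum.inl t, rfl⟩
        left_inv := fun t => by simp
        right_inv := fun t => rfl }
    refine (h₁ _ (Module.Free.chooseBasis ℤ V₁)).tpow_of_reindex e ?_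
    rintro g ⟨t | t, ht⟩ ⟨s | s, hs⟩
    · change _ = d.repr (r₂ g (d (Sum.inl s))) (Sum.inl t)
      rw [hd, ← hi, hd₁]
      rfl
    all_goals simp [p] at ht hs
  let e : C ≃ {t // ¬ p t} :=
    { toFun := fun t => ⟨Sum.inr t, by simp [p]⟩
      invFun := fun t => t.1.getRight (by simpa [p] using t.2)
      left_inv := fun t => rfl
      right_inv := fun t => by simp }
  refine key.tpow_of_reindex e fun g t s => ?_
  change d.repr (r₂ g (d (Sum.inr s))) (Sum.inr t) = _
  have : q (d (Sum.inr s)) = c s := by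
    apply c.repr.injective
    ext u
    rw [← hd₂]
    classical
    simp [Finsupp.single_apply]
  rw [hd₂, hq, this]
  rfl

end Ses

end Lattice

section Criterion

variable {k : Type} [Ring k] {G Q : Type} [Group G] [Group Q] {f : ℕ → NNReal} {π : G →* Q}
  {M : Type} [AddCommGroup M] [Module (MonoidAlgebra k G) M]
  {I : Type} [Fintype I] [DecidableEq I] [MulAction Q I]
  {V W D : Type} [AddCommGroup V] [AddCommGroup W] [AddCommGroup D]

variable (k π M) in
/-- The map from `M` to its twist by a tensor power given by an equivariant family of vectors. -/
def tensorMap (r : Representation ℤ Q V) {B : Type} [Fintype B] (b : Module.Basis B ℤ V) (v : I → V)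
    (hv : ∀ g x, r g (v x) = v (g • x)) :
    M →ₗ[MonoidAlgebra k G] Tw k (((r.matRep b).tpow I).comp π) M :=
  Tw.ofInvariant (fun t => ∏ x, b.repr (v x) (t x)) (MatRep.tpow_invariant (v := fun x => b.repr (v x))
    fun g x t => by rw [Representation.matRep_sum, hv])

lemma tensorMap_apply {r : Representation ℤ Q V} {B : Type} [Fintype B] {b : Module.Basis B ℤ V}
    {v : I → V} (hv : ∀ g x, r g (v x) = v (g • x)) (m : M) (t : I → B) :
    tensorMap k π M r b v hv m t = (∏ x, b.repr (v x) (t x)) • m := rfl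

/-- The short exact sequence given by tensor powers of an invariant vector. -/
lemma exists_isSES_tensorMap (hf : IsProperComplexityFunction f) (hM : ProperCds k f π M)
    (hπ : Surjective π) [MulAction.IsPretransitive Q I] [Nonempty I] {r : Representation ℤ Q V}
    {rW : Representation ℤ Q W} {ψ : V} {q : V →ₗ[ℤ] W}
    (h : IsSES (LinearMap.toSpanSingleton ℤ V ψ) q)
    (hψ : ∀ g, r g ψ = ψ) (hq : ∀ g v, q (r g v) = rW g (q v)) [Module.Free ℤ W]
    [Module.Finite ℤ W] (hW : TpowCds k f π M I rW) :
    ∃ (B : Type) (_ : Fintype B) (b : Module.Basis B ℤ V) (Z : ModuleCat (MonoidAlgebra k G))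
      (c : Tw k (((r.matRep b).tpow I).comp π) M →ₗ[MonoidAlgebra k G] Z),
      HasCds (MonoidAlgebra k G) f Z ∧ IsSES (tensorMap k π M r b (fun _ => ψ) fun g _ => hψ g) c := by
  classical
  obtain ⟨d, hd, -, hd₂⟩ := exists_basis_of_isSES h (Module.Basis.singleton Unit ℤ)
    (Module.Free.chooseBasis ℤ W)
  have hd : d (Sum.inl ()) = ψ := by simp [hd]
  let p : Unit ⊕ Module.Free.ChooseBasisIndex ℤ W → Prop := fun t => t.isLeft
  have hp : ∀ g t s, p s → ¬ p t → (r.matRep d).val g t s = 0 := by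
    rintro g (t | t) (s | s) hs ht
    · exact absurd rfl ht
    · exact absurd rfl ht
    · rw [Representation.matRep_val, hd₂, hd, hψ]
      simpa using congrArg (fun w => (Module.Free.chooseBasis ℤ W).repr w t) (h.apply_apply 1)
    · simp [p] at hs
  let e : {t // ¬ p t} ≃ Module.Free.ChooseBasisIndex ℤ W :=
    { toFun := fun t => t.1.getRight (by simpa [p] using t.2)
      invFun := fun t => ⟨Sum.inr t, by simp [p]⟩
      left_inv := fun t => by simp
      right_inv := fun t => rfl }
  have key : TwCds k f π M (((r.matRep d).quot p hp).tpow I) := by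
    refine (hW _ (Module.Free.chooseBasis ℤ W)).tpow_of_reindex e ?_
    rintro g ⟨t | t, ht⟩ ⟨s | s, hs⟩
    on_goal 4 =>
      change _ = d.repr (r g (d (Sum.inr s))) (Sum.inr t)
      have : q (d (Sum.inr s)) = Module.Free.chooseBasis ℤ W s := by
        apply (Module.Free.chooseBasis ℤ W).repr.injective
        ext u
        rw [← hd₂]
        simp [Finsupp.single_apply]
      rw [hd₂, hq, this]
      rfl
    all_goals simp [p] at ht hs
  have hs : ∀ t : I → Unit ⊕ Module.Free.ChooseBasisIndex ℤ W, (∀ x, p (t x)) →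
      t = fun _ => Sum.inl () := fun t ht => funext fun x => by
    have := ht x
    generalize t x = y at this
    rcases y with y | y
    · rfl
    · simp [p] at this
  have hv : ∀ t : I → Unit ⊕ Module.Free.ChooseBasisIndex ℤ W, ∏ x, d.repr ψ (t x) =
      if ∀ x, p (t x) then 1 else 0 := fun t => by
    rw [← hd]
    split_ifs with ht
    · rw [hs t ht]
      simp
    · push Not at ht
      obtain ⟨x, hx⟩ := ht
      refine Finset.prod_eq_zero (Finset.mem_univ x) ?_
      generalize t x = y at hx
      rcases y with y | y
      · exact absurd rfl hx
      · simp
  refine ⟨_, inferInstance, d, ModuleCat.of _ (Tw k ((((r.matRep d).tpow I).quot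
    (fun t => ∀ x, p (t x)) (MatRep.tpow_block hp)).comp π) M), Tw.quotProj k π M ((r.matRep d).tpow I) _
    (MatRep.tpow_block hp), (TwCds.tpow_quot_iff hf hM hπ).2 key, ?_, ?_, ?_⟩
  · intro m m' hm
    have := congrFun hm fun _ => Sum.inl ()
    rw [tensorMap_apply, tensorMap_apply, hv, if_pos (by simp [p])] at this
    simpa using this
  · exact (Tw.isSES_sub_quot _ _ _).surj
  · intro F
    constructor
    · intro hF
      refine ⟨F fun _ => Sum.inl (), funext fun t => ?_⟩
      rw [tensorMap_apply, hv]
      split_ifs with ht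
      · rw [hs t ht, one_smul]
      · rw [zero_smul]
        exact (congrFun hF ⟨t, ht⟩).symm
    · rintro ⟨m, rfl⟩
      refine funext fun t => ?_
      change tensorMap k π M r d (fun _ => ψ) (fun g _ => hψ g) m t.1 = 0
      rw [tensorMap_apply, hv, if_neg t.2, zero_smul]

/-- Tensor maps of families lifting to a lattice with small twist. -/
lemma factorsCds_tensorMap {r : Representation ℤ Q V} {rD : Representation ℤ Q D}
    [Module.Free ℤ D] [Module.Finite ℤ D] (hD : TpowCds k f π M I rD) {E : D →ₗ[ℤ] V}
    (hE : ∀ g v, E (rD g v) = r g (E v)) {h : I → D} (hh : ∀ g x, rD g (h x) = h (g • x))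
    {B : Type} [Fintype B] (b : Module.Basis B ℤ V) :
    FactorsCds f (tensorMap k π M r b (fun x => E (h x)) fun g x => by rw [← hE, hh]) := by
  convert FactorsCds.of_comp (hD _ _) (tensorMap k π M rD (Module.Free.chooseBasis ℤ D) h hh)
    (Tw.mapMat _ (MatRep.tpow_intertwines (basisMat_intertwines _ b E hE)))
  refine LinearMap.ext fun m => funext fun t => Eq.symm ?_
  rw [LinearMap.comp_apply]
  rw [Tw.mapMat_apply, tensorMap_apply]
  simp_rw [tensorMap_apply, smul_smul, ← Finset.sum_smul, ← Finset.prod_mul_distrib]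
  rw [← prod_sum_eq_sum_prod fun x u => basisMat (Module.Free.chooseBasis ℤ D) b E (t x) u *
    (Module.Free.chooseBasis ℤ D).repr (h x) u]
  simp_rw [basisMat_sum]

/-- The map of twists induced by a permutation of the tensor factors. -/
def tensorPerm {B : Type} [Fintype B] (ρ : MatRep Q B) (θ : Equiv.Perm I)
    (hθ : ∀ (g : Q) x, θ (g • x) = g • θ x) :
    Tw k ((ρ.tpow I).comp π) M →ₗ[MonoidAlgebra k G] Tw k ((ρ.tpow I).comp π) M :=
  linearOfSingle
    { toFun := fun F t => F (t ∘ θ.symm)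
      map_zero' := rfl
      map_add' := fun F F' => rfl }
    (fun g a F => funext fun t => by
      rw [Tw.comp_single_smul_apply]
      change (MonoidAlgebra.single g a • F) (t ∘ θ.symm) =
        ∑ u : I → B, (ρ.tpow I).val (π g) t u • (MonoidAlgebra.single g a • F (u ∘ θ.symm))
      rw [Tw.comp_single_smul_apply, ← (Equiv.arrowCongr θ (Equiv.refl B)).sum_comp]
      refine Finset.sum_congr rfl fun u _ => ?_
      change (ρ.tpow I).val (π g) (t ∘ θ.symm) (u ∘ θ.symm) •
        (MonoidAlgebra.single g a • F (u ∘ θ.symm)) = _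
      rw [show (ρ.tpow I).val (π g) (t ∘ θ.symm) (u ∘ θ.symm) = (ρ.tpow I).val (π g) t u by
        rw [MatRep.tpow_val, MatRep.tpow_val, ← Equiv.prod_comp θ]
        simp [← hθ]])

end Criterion

section Main

variable {k : Type} [Ring k] {G Q : Type} [Group G] [Group Q] {f : ℕ → NNReal} {π : G →* Q}
  {M : Type} [AddCommGroup M] [Module (MonoidAlgebra k G) M]
  {I : Type} [Fintype I] [DecidableEq I] [MulAction Q I]
  {V W D : Type} [AddCommGroup V] [AddCommGroup W] [AddCommGroup D]

/-- The action on nonconstant functions. -/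
@[reducible]
def nonconstAction (Q I J : Type) [Group Q] [MulAction Q I] :
    MulAction Q {χ : I → J // ¬ ∃ j, (fun _ => j) = χ} where
  smul g χ := ⟨fun x => χ.1 (g⁻¹ • x), fun ⟨j, hj⟩ => χ.2 ⟨j, funext fun x => by
    simpa using congrFun hj (g • x)⟩⟩
  one_smul χ := Subtype.ext (funext fun x => congrArg χ.1 (by simp))
  mul_smul g h χ := Subtype.ext (funext fun x => congrArg χ.1 (by simp [mul_smul]))

lemma MatRep.sum_perm_val {X : Type} [Fintype X] [MulAction Q X] (g : Q) (t : X) :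
    ∑ u, (MatRep.perm Q X).val g t u * 1 = 1 := by
  classical
  rw [Finset.sum_eq_single (g⁻¹ • t)]
  · rw [MatRep.perm_val, if_pos (smul_inv_smul g t), one_mul]
  · intro u _ hu
    rw [MatRep.perm_val, if_neg fun h => hu (by simp [← h]), zero_mul]
  · simp

/-- The mixed terms in the expansion of a tensor power of a sum. -/
lemma exists_factorsCds_mixed (hM : ProperCds k f π M) (hπ : Surjective π)
    [MulAction.IsPretransitive Q I] [Nonempty I] {r : Representation ℤ Q V} {B : Type} [Fintype B]
    (b : Module.Basis B ℤ V) {J : Type} [Fintype J] {v : J → I → V}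
    (hv : ∀ j g x, r g (v j x) = v j (g • x)) :
    ∃ φ : M →ₗ[MonoidAlgebra k G] Tw k (((r.matRep b).tpow I).comp π) M, FactorsCds f φ ∧
      ∀ m t, φ m t = (∏ x, b.repr (∑ j, v j x) (t x)) • m -
        ∑ j, (∏ x, b.repr (v j x) (t x)) • m := by
  classical
  let Y := {χ : I → J // ¬ ∃ j, (fun _ => j) = χ}
  let _ : MulAction Q Y := nonconstAction Q I J
  have hY : TwCds k f π M (MatRep.perm Q Y) := TwCds.perm hM hπ fun χ => by
    by_contra! h
    obtain ⟨x₀⟩ := ‹Nonempty I›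
    refine χ.2 ⟨χ.1 x₀, funext fun x => ?_⟩
    obtain ⟨g, rfl⟩ := MulAction.exists_smul_eq Q x₀ x
    rw [← congrFun (congrArg Subtype.val (h g)) (g • x₀)]
    exact congrArg χ.1 (inv_smul_smul g x₀).symm
  let T : (I → B) → Y → ℤ := fun t χ => ∏ x, b.repr (v (χ.1 x) x) (t x)
  have hT : ∀ g t s, ∑ u, T t u * (MatRep.perm Q Y).val g u s =
      ∑ u, ((r.matRep b).tpow I).val g t u * T u s := fun g t s => by
    simp_rw [MatRep.perm_val]
    rw [Finset.sum_eq_single (g • s) (fun u _ hu => by rw [if_neg hu.symm, mul_zero])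
      (by simp), if_pos rfl, mul_one]
    simp_rw [MatRep.tpow_val, T, ← Finset.prod_mul_distrib]
    rw [← prod_sum_eq_sum_prod fun x u => (r.matRep b).val g (t (g • x)) u *
      b.repr (v (s.1 x) x) u, ← prod_comp_smul g]
    simp_rw [Representation.matRep_sum, hv]
    refine Finset.prod_congr rfl fun x _ => ?_
    change b.repr (v (s.1 (g⁻¹ • g • x)) _) _ = _
    rw [inv_smul_smul]
  refine ⟨_, FactorsCds.of_comp hY (Tw.ofInvariant (fun _ => 1) fun g t => ?_) (Tw.mapMat T hT),
    fun m t => ?_⟩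
  · exact MatRep.sum_perm_val g t
  · rw [LinearMap.comp_apply, Tw.mapMat_apply]
    simp_rw [Tw.ofInvariant_apply, one_smul, ← Finset.sum_smul, ← sub_smul]
    congr 1
    simp_rw [map_sum, Finsupp.coe_finsetSum, Finset.sum_apply]
    rw [prod_sum_eq_sum_prod fun x j => b.repr (v j x) (t x), eq_sub_iff_add_eq,
      sum_subtype_add_sum_subtype (fun χ : I → J => ∃ j, (fun _ => j) = χ)
        (fun χ => ∏ x, b.repr (v (χ x) x) (t x)), add_comm]
    congr 1
    refine (Equiv.sum_comp (Equiv.ofBijective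
      (fun j : J => (⟨fun _ => j, j, rfl⟩ : {χ : I → J // ∃ j, (fun _ => j) = χ})) ⟨?_, ?_⟩)
      (fun χ => ∏ x, b.repr (v (χ.1 x) x) (t x)))
    · intro j j' h
      exact congrFun (congrArg Subtype.val h) (Classical.arbitrary I)
    · rintro ⟨_, j, rfl⟩
      exact ⟨j, rfl⟩

/-- A criterion for `HasCds` in terms of tensor powers of lattices. -/
theorem hasCds_of_perm (hf : IsProperComplexityFunction f) (hM : ProperCds k f π M)
    (hπ : Surjective π) [MulAction.IsPretransitive Q I] [Nonempty I] {r : Representation ℤ Q V}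
    {rW : Representation ℤ Q W} {rD : Representation ℤ Q D} {ψ : V} {q : V →ₗ[ℤ] W}
    (h : IsSES (LinearMap.toSpanSingleton ℤ V ψ) q)
    (hψ : ∀ g, r g ψ = ψ) (hq : ∀ g v, q (r g v) = rW g (q v)) [Module.Free ℤ W]
    [Module.Finite ℤ W] (hW : TpowCds k f π M I rW) [Module.Free ℤ D] [Module.Finite ℤ D]
    (hD : TpowCds k f π M I rD) {E : D →ₗ[ℤ] V} (hE : ∀ g v, E (rD g v) = r g (E v))
    {d : I → D} (hd : ∀ g x, rD g (d x) = d (g • x)) {φ : I → V}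
    (hφ : ∀ g x, r g (φ x) = φ (g • x)) (θ : Equiv.Perm I)
    (hθ : ∀ (g : Q) x, θ (g • x) = g • θ x) (hφθ : ∀ x, φ (θ x) = φ x + ψ + E (d x)) :
    HasCds (MonoidAlgebra k G) f M := by
  obtain ⟨B, _, b, Z, c, hZ, hc⟩ := exists_isSES_tensorMap (I := I) hf hM hπ h hψ hq hW
  refine FactorsCds.hasCds (FactorsCds.of_comp_injective hf hc hZ ?_)
  let v : Fin 3 → I → V := ![φ, fun _ => ψ, fun x => E (d x)]
  have hv : ∀ j g x, r g (v j x) = v j (g • x) := fun j g x => by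
    fin_cases j
    · exact hφ g x
    · exact hψ g
    · exact (hE g _).symm.trans (congrArg E (hd g x))
  obtain ⟨R, hR, hR'⟩ := exists_factorsCds_mixed (k := k) (M := M) hM hπ b hv
  let Θ := tensorPerm (k := k) (π := π) (M := M) (r.matRep b) θ hθ
  have hΘ : FactorsCds f (Θ - LinearMap.id) := by
    refine FactorsCds.of_ker_le hc.surj hZ _ fun F hF => ?_
    obtain ⟨m, rfl⟩ := hc.mem hF
    refine sub_eq_zero.2 (funext fun t => ?_)
    change tensorMap k π M r b (fun _ => ψ) (fun g _ => hψ g) m (t ∘ θ.symm) = _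
    rw [LinearMap.id_apply, tensorMap_apply, tensorMap_apply]
    rw [← Equiv.prod_comp θ]
    simp
  have key : tensorMap k π M r b (fun _ => ψ) (fun g _ => hψ g) ∘ₗ LinearMap.id =
      (Θ - LinearMap.id) ∘ₗ tensorMap k π M r b φ hφ -
        tensorMap k π M r b (fun x => E (d x)) (fun g x => by rw [← hE, hd]) - R :=
    LinearMap.ext fun m => funext fun t => by
      change (∏ x, b.repr ψ (t x)) • m = (∏ x, b.repr (φ x) (t (θ.symm x))) • m -
        (∏ x, b.repr (φ x) (t x)) • m - (∏ x, b.repr (E (d x)) (t x)) • m - R m t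
      rw [hR', Fin.sum_univ_three,
        ← Equiv.prod_comp θ fun x => b.repr (φ x) (t (θ.symm x))]
      simp_rw [Fin.sum_univ_three, Equiv.symm_apply_apply, hφθ]
      change _ = _ - _ - _ - ((∏ x, b.repr (φ x + ψ + E (d x)) (t x)) • m -
        ((∏ x, b.repr (φ x) (t x)) • m + (∏ x, b.repr ψ (t x)) • m +
          (∏ x, b.repr (E (d x)) (t x)) • m))
      abel
  rw [key]
  exact ((hΘ.comp_right _).sub (factorsCds_tensorMap hD hE hd b)).sub hR

end Main

section MainAbelian

variable {k : Type} [Ring k] {G Q : Type} [Group G] [Group Q] {f : ℕ → NNReal} {π : G →* Q}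
  {M : Type} [AddCommGroup M] [Module (MonoidAlgebra k G) M]
  {V W D : Type} [AddCommGroup V] [AddCommGroup W] [AddCommGroup D]

lemma MatRep.sum_perm_val_left {X : Type} [Fintype X] [MulAction Q X] (g : Q) (s : X) :
    ∑ u, 1 * (MatRep.perm Q X).val g u s = 1 := by
  classical
  rw [Finset.sum_eq_single (g • s)]
  · rw [MatRep.perm_val, if_pos rfl, one_mul]
  · intro u _ hu
    rw [MatRep.perm_val, if_neg fun h => hu h.symm, mul_zero]
  · simp

lemma factorsCds_card_smul [Finite Q] [Nontrivial Q] (hM : ProperCds k f π M) (hπ : Surjective π) :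
    FactorsCds f ((Nat.card Q : ℤ) • (LinearMap.id : M →ₗ[MonoidAlgebra k G] M)) := by
  classical
  let _ := Fintype.ofFinite Q
  have hQ : TwCds k f π M (MatRep.perm Q Q) := TwCds.perm hM hπ fun x => by
    obtain ⟨g, hg⟩ := exists_ne (1 : Q)
    exact ⟨g, fun h => hg (by simpa using h)⟩
  convert FactorsCds.of_comp hQ (Tw.ofInvariant (fun _ => 1) MatRep.sum_perm_val)
    (Tw.toInvariant (fun _ => 1) MatRep.sum_perm_val_left)
  refine LinearMap.ext fun m => ?_
  rw [LinearMap.comp_apply, Tw.toInvariant_apply]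
  simp_rw [Tw.ofInvariant_apply]
  simp

/-- A criterion for `HasCds` in terms of divisibility of an invariant vector modulo `E`. -/
theorem hasCds_of_smul_eq [Finite Q] [Nontrivial Q] {p l : ℕ} (hQ : Nat.card Q = p ^ l)
    (hf : IsProperComplexityFunction f) (hM : ProperCds k f π M)
    (hπ : Surjective π) {r : Representation ℤ Q V}
    {rW : Representation ℤ Q W} {rD : Representation ℤ Q D} {ψ : V} {q : V →ₗ[ℤ] W}
    (h : IsSES (LinearMap.toSpanSingleton ℤ V ψ) q)
    (hψ : ∀ g, r g ψ = ψ) (hq : ∀ g v, q (r g v) = rW g (q v)) [Module.Free ℤ W]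
    [Module.Finite ℤ W] (hW : TpowCds k f π M Unit rW) [Module.Free ℤ D] [Module.Finite ℤ D]
    (hD : TpowCds k f π M Unit rD) {E : D →ₗ[ℤ] V} (hE : ∀ g v, E (rD g v) = r g (E v))
    {d : D} (hd : ∀ g, rD g d = d) {φ : V} (hφ : ∀ g, r g φ = φ)
    (hpφ : (p : ℤ) • φ = ψ + E d) : HasCds (MonoidAlgebra k G) f M := by
  have : MulAction.IsPretransitive Q Unit := ⟨fun _ _ => ⟨1, rfl⟩⟩
  obtain ⟨B, _, b, Z, c, hZ, hc⟩ := exists_isSES_tensorMap (I := Unit) hf hM hπ h hψ hq hW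
  suffices H : ∀ j, FactorsCds f (((p : ℤ) ^ j) • (LinearMap.id : M →ₗ[MonoidAlgebra k G] M)) →
      HasCds (MonoidAlgebra k G) f M by
    refine H l ?_
    have := factorsCds_card_smul (k := k) (M := M) hM hπ
    rwa [hQ, Nat.cast_pow] at this
  intro j
  induction j with
  | zero =>
    intro hj
    rw [pow_zero, one_smul] at hj
    exact hj.hasCds
  | succ j ih =>
    intro hj
    refine ih (FactorsCds.of_comp_injective hf hc hZ ?_)
    have key : tensorMap k π M r b (fun _ : Unit => ψ) (fun g _ => hψ g) ∘ₗ
        (((p : ℤ) ^ j) • (LinearMap.id : M →ₗ[MonoidAlgebra k G] M)) =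
        tensorMap k π M r b (fun _ : Unit => φ) (fun g _ => hφ g) ∘ₗ
          (((p : ℤ) ^ (j + 1)) • (LinearMap.id : M →ₗ[MonoidAlgebra k G] M)) -
        tensorMap k π M r b (fun _ : Unit => E d) (fun g x => by rw [← hE, hd]) ∘ₗ
          (((p : ℤ) ^ j) • (LinearMap.id : M →ₗ[MonoidAlgebra k G] M)) :=
      LinearMap.ext fun m => funext fun t => by
        change (∏ x, b.repr ψ (t x)) • ((p : ℤ) ^ j • m) =
          (∏ x, b.repr φ (t x)) • ((p : ℤ) ^ (j + 1) • m) -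
            (∏ x, b.repr (E d) (t x)) • ((p : ℤ) ^ j • m)
        simp_rw [smul_smul, ← sub_smul]
        have := congrArg (fun v => b.repr v (t ())) hpφ
        simp only [map_smul, map_add, Finsupp.smul_apply, Finsupp.add_apply, smul_eq_mul] at this
        simp only [Finset.univ_unique, Finset.prod_singleton]
        change (b.repr ψ (t ()) * _) • m = (b.repr φ (t ()) * _ - b.repr (E d) (t ()) * _) • m
        rw [← sub_eq_iff_eq_add.2 this]
        congr 1
        ring
    rw [key]
    exact (hj.comp_left _).sub ((factorsCds_tensorMap (h := fun _ : Unit => d) hD hE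
      (fun g _ => hd g) b).comp_right _)

end MainAbelian

section PermRep

variable {k : Type} [Ring k] {G Q : Type} [Group G] [Group Q] {f : ℕ → NNReal} {π : G →* Q}
  {M : Type} [AddCommGroup M] [Module (MonoidAlgebra k G) M]

/-- The permutation lattice of integral functions on a set. -/
def permRep (Q X : Type) [Group Q] [MulAction Q X] : Representation ℤ Q (X → ℤ) where
  toFun g := LinearMap.funLeft ℤ ℤ fun x => g⁻¹ • x
  map_one' := by ext; simp [LinearMap.funLeft]
  map_mul' g h := LinearMap.ext fun F => funext fun x => by
    simp [LinearMap.funLeft_apply, mul_smul]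

lemma permRep_apply {X : Type} [MulAction Q X] (g : Q) (F : X → ℤ) (x : X) :
    permRep Q X g F x = F (g⁻¹ • x) := rfl

lemma tpowCds_permRep (hM : ProperCds k f π M) (hπ : Surjective π) {X : Type} [Finite X]
    [MulAction Q X] {I : Type} [Fintype I] [DecidableEq I] [MulAction Q I] (x₀ : I)
    (hX : ∀ x : X, ∃ g : Q, g • x₀ = x₀ ∧ g • x ≠ x) : TpowCds k f π M I (permRep Q X) := by
  classical
  let _ := Fintype.ofFinite X
  refine TwCds.tpowCds (b := Pi.basisFun ℤ X) ?_
  refine (TwCds.tpow_perm hM hπ x₀ hX).tpow_of_reindex (Equiv.refl X) fun g t s => ?_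
  rw [MatRep.perm_val, Representation.matRep_val, Pi.basisFun_repr, permRep_apply,
    Pi.basisFun_apply, Pi.single_apply]
  exact if_congr (by rw [inv_smul_eq_iff, eq_comm]; rfl) rfl rfl

end PermRep

section Carry

variable {Ω : Type} {n : ℕ} [NeZero n]

variable (Ω) in
/-- The functions on `Ω × Ω` that are sums of functions of either variable. -/
def sepFun : Submodule ℤ (Ω × Ω → ℤ) where
  carrier := {F | ∀ y y' z z', F (y, z) + F (y', z') = F (y', z) + F (y, z')}
  zero_mem' := by simp
  add_mem' {F F'} h h' y y' z z' := by
    simp only [Pi.add_apply]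
    linear_combination h y y' z z' + h' y y' z z'
  smul_mem' c F h y y' z z' := by
    simp only [Pi.smul_apply, smul_eq_mul]
    linear_combination c * h y y' z z'

lemma mem_sepFun_of_mul {F : Ω × Ω → ℤ} {N : ℤ} (hN : N ≠ 0) (a b : Ω → ℤ)
    (h : ∀ y z, N * F (y, z) = a y + b z) : F ∈ sepFun Ω := fun y y' z z' => by
  apply mul_left_cancel₀ hN
  rw [mul_add, mul_add, h, h, h, h]
  ring

lemma exists_of_mem_sepFun [Nonempty Ω] {F : Ω × Ω → ℤ} (h : F ∈ sepFun Ω) :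
    ∃ a b : Ω → ℤ, ∀ y z, F (y, z) = a y + b z := by
  obtain ⟨ω⟩ := ‹Nonempty Ω›
  exact ⟨fun y => F (y, ω) - F (ω, ω), fun z => F (ω, z), fun y z => by
    linear_combination h y ω z ω⟩

/-- The indicator of `l z < l y` for the standard representatives. -/
def carry (l : Ω → ZMod n) : Ω × Ω → ℤ := fun x => if (l x.2).val < (l x.1).val then 1 else 0

/-- The standard representative of `l z - l y`. -/
def diffVal (l : Ω → ZMod n) : Ω × Ω → ℤ := fun x => (l x.2 - l x.1).val

lemma mul_carry (l : Ω → ZMod n) (y z : Ω) :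
    (n : ℤ) * carry l (y, z) = diffVal l (y, z) - (l z).val + (l y).val := by
  simp only [carry, diffVal]
  rcases Nat.lt_or_ge (l z).val (l y).val with h | h
  · rw [if_pos h]
    have h₁ : (l y - l z).val = (l y).val - (l z).val := ZMod.val_sub h.le
    have h₂ : l y - l z ≠ 0 := fun h₀ => by
      rw [h₀, ZMod.val_zero] at h₁
      omega
    have : NeZero (l y - l z) := ⟨h₂⟩
    have h₃ : (l z - l y).val = n - (l y - l z).val := by
      rw [← neg_sub, ZMod.val_neg_of_ne_zero]
    have := (l y - l z).val_lt
    omega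
  · rw [if_neg (by omega), ZMod.val_sub h]
    omega

lemma diffVal_congr {l l' : Ω → ZMod n} {t : ZMod n} (h : ∀ ω, l' ω = l ω + t) :
    diffVal l' = diffVal l := funext fun x => by
  simp [diffVal, h]

lemma carry_sub_carry_mem {l l' : Ω → ZMod n} {t : ZMod n} (h : ∀ ω, l' ω = l ω + t) :
    carry l' - carry l ∈ sepFun Ω := by
  refine mem_sepFun_of_mul (N := n) (by exact_mod_cast NeZero.ne n)
    (fun y => (l' y).val - (l y).val) (fun z => (l z).val - (l' z).val) fun y z => ?_
  rw [Pi.sub_apply, mul_sub, mul_carry, mul_carry, diffVal_congr h]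
  ring

/-- The integral correction term for a linear relation between carries. -/
def carryDefect (c : ℤ) (l₁ l₂ l₃ : Ω → ZMod n) : Ω × Ω → ℤ := fun x =>
  (c * diffVal l₁ x - diffVal l₂ x - diffVal l₃ x -
    ((c * l₁ x.2 - l₂ x.2 - l₃ x.2 : ZMod n).val - (c * l₁ x.1 - l₂ x.1 - l₃ x.1 : ZMod n).val)) / n

lemma mul_carryDefect (c : ℤ) (l₁ l₂ l₃ : Ω → ZMod n) (x : Ω × Ω) :
    n * carryDefect c l₁ l₂ l₃ x = c * diffVal l₁ x - diffVal l₂ x - diffVal l₃ x -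
    ((c * l₁ x.2 - l₂ x.2 - l₃ x.2 : ZMod n).val -
      (c * l₁ x.1 - l₂ x.1 - l₃ x.1 : ZMod n).val) := by
  refine Int.mul_ediv_cancel' ((ZMod.intCast_zmod_eq_zero_iff_dvd _ n).1 ?_)
  simp only [diffVal]
  push_cast
  simp only [ZMod.natCast_zmod_val]
  ring

lemma carry_relation_mem (c : ℤ) (l₁ l₂ l₃ : Ω → ZMod n) :
    c • carry l₁ - carry l₂ - carry l₃ - carryDefect c l₁ l₂ l₃ ∈ sepFun Ω := by
  refine mem_sepFun_of_mul (N := n) (by exact_mod_cast NeZero.ne n)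
    (fun y => c * (l₁ y).val - (l₂ y).val - (l₃ y).val -
      (c * l₁ y - l₂ y - l₃ y : ZMod n).val)
    (fun z => - (c * (l₁ z).val - (l₂ z).val - (l₃ z).val) +
      (c * l₁ z - l₂ z - l₃ z : ZMod n).val) fun y z => ?_
  simp only [Pi.sub_apply, Pi.smul_apply, smul_eq_mul]
  linear_combination c * mul_carry l₁ y z - mul_carry l₂ y z - mul_carry l₃ y z -
    mul_carryDefect c l₁ l₂ l₃ (y, z)

lemma carryDefect_congr {c : ℤ} {l₁ l₂ l₃ l₁' l₂' l₃' : Ω → ZMod n} {t₁ t₂ t₃ : ZMod n}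
    (h₁ : ∀ ω, l₁' ω = l₁ ω + t₁) (h₂ : ∀ ω, l₂' ω = l₂ ω + t₂) (h₃ : ∀ ω, l₃' ω = l₃ ω + t₃)
    (ht : c * t₁ = t₂ + t₃) : carryDefect c l₁' l₂' l₃' = carryDefect c l₁ l₂ l₃ := by
  have : ∀ ω, (c * l₁' ω - l₂' ω - l₃' ω : ZMod n) = c * l₁ ω - l₂ ω - l₃ ω := fun ω => by
    rw [h₁, h₂, h₃]
    linear_combination ht
  unfold carryDefect
  simp_rw [this, diffVal_congr h₁, diffVal_congr h₂, diffVal_congr h₃]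

lemma carry_shift_succ (hn : 1 < n) (l : Ω → ZMod n) (c : ZMod n) (y z : Ω) :
    carry (fun ω => l ω - (c + 1)) (y, z) - carry (fun ω => l ω - c) (y, z) =
      (if l y = c then 1 else 0) - (if l z = c then 1 else 0) := by
  have : Fact (1 < n) := ⟨hn⟩
  have key : ∀ a : ZMod n, ((a - (c + 1)).val : ℤ) =
      (a - c).val - 1 + n * (if a = c then 1 else 0) := fun a => by
    split_ifs with h
    · subst h
      have := ZMod.val_neg_of_ne_zero (1 : ZMod n)
      rw [ZMod.val_one] at this
      rw [show a - (a + 1) = -1 by ring, this, sub_self, ZMod.val_zero]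
      push_cast [hn.le]
      ring
    · have h' : 1 ≤ (a - c).val := Nat.one_le_iff_ne_zero.2 fun h₀ =>
        h (sub_eq_zero.1 ((ZMod.val_eq_zero _).1 h₀))
      rw [← sub_sub, ZMod.val_sub (by rwa [ZMod.val_one]), ZMod.val_one]
      push_cast [h']
      ring
  have hn' : (n : ℤ) ≠ 0 := by exact_mod_cast NeZero.ne n
  apply mul_left_cancel₀ hn'
  rw [mul_sub, mul_carry, mul_carry, key, key, diffVal, diffVal]
  simp only [sub_sub_sub_cancel_right]
  ring

end Carry

section CarryLattice

variable {k : Type} [Ring k] {G Q : Type} [Group G] [Group Q] {f : ℕ → NNReal} {π : G →* Q}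
  {M : Type} [AddCommGroup M] [Module (MonoidAlgebra k G) M] {Ω : Type} [MulAction Q Ω] {n : ℕ}
  [NeZero n]

lemma sepFun_le_comap (g : Q) : sepFun Ω ≤ (sepFun Ω).comap (permRep Q (Ω × Ω) g) :=
  fun _ h _ _ _ _ => h _ _ _ _

variable (Q Ω) in
/-- The action on functions modulo sums of functions of either variable. -/
def carryRep : Representation ℤ Q ((Ω × Ω → ℤ) ⧸ sepFun Ω) :=
  (permRep Q (Ω × Ω)).quotient (sepFun Ω) sepFun_le_comap

lemma mkQ_permRep (g : Q) (F : Ω × Ω → ℤ) :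
    (sepFun Ω).mkQ (permRep Q (Ω × Ω) g F) = carryRep Q Ω g ((sepFun Ω).mkQ F) := rfl

lemma permRep_carry (g : Q) (l : Ω → ZMod n) :
    permRep Q (Ω × Ω) g (carry l) = carry fun ω => l (g⁻¹ • ω) := rfl

lemma permRep_carryDefect (g : Q) (c : ℤ) (l₁ l₂ l₃ : Ω → ZMod n) :
    permRep Q (Ω × Ω) g (carryDefect c l₁ l₂ l₃) = carryDefect c (fun ω => l₁ (g⁻¹ • ω))
      (fun ω => l₂ (g⁻¹ • ω)) (fun ω => l₃ (g⁻¹ • ω)) := rfl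

lemma mkQ_carry_eq {l l' : Ω → ZMod n} {t : ZMod n} (h : ∀ ω, l' ω = l ω + t) :
    (sepFun Ω).mkQ (carry l') = (sepFun Ω).mkQ (carry l) :=
  (Submodule.Quotient.eq _).2 (carry_sub_carry_mem h)

section Span

variable {ν : Ω → ZMod n}

lemma exists_unit_value (hn : 1 < n) (hν : Surjective ν) :
    ∃ y z : Ω, carry ν (y, z) = 1 ∧ carry ν (z, y) = 0 ∧ carry ν (y, y) = 0 ∧
      carry ν (z, z) = 0 := by
  have : Fact (1 < n) := ⟨hn⟩
  obtain ⟨y, hy⟩ := hν 1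
  obtain ⟨z, hz⟩ := hν 0
  refine ⟨y, z, ?_⟩
  simp [carry, hy, hz, ZMod.val_one]

lemma smul_mkQ_carry_eq_zero (hn : 1 < n) (hν : Surjective ν) {e : ℤ}
    (h : e • (sepFun Ω).mkQ (carry ν) = 0) : e = 0 := by
  obtain ⟨y, z, h₁, h₂, h₃, h₄⟩ := exists_unit_value hn hν
  rw [← map_smul] at h
  have := (Submodule.Quotient.mk_eq_zero _).1 h y z z y
  simpa [h₁, h₂, h₃, h₄] using this

lemma isTorsionFree_carry (hn : 1 < n) (hν : Surjective ν) : Module.IsTorsionFree ℤ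
    (((Ω × Ω → ℤ) ⧸ sepFun Ω) ⧸ (ℤ ∙ (sepFun Ω).mkQ (carry ν))) := by
  refine Module.IsTorsionFree.of_smul_eq_zero fun N w hw => ?_
  by_cases hN : N = 0
  · exact Or.inl hN
  refine Or.inr ?_
  obtain ⟨v, rfl⟩ := Submodule.mkQ_surjective _ w
  obtain ⟨F, rfl⟩ := Submodule.mkQ_surjective _ v
  rw [← map_smul] at hw
  obtain ⟨e, he⟩ := Submodule.mem_span_singleton.1 ((Submodule.Quotient.mk_eq_zero _).1 hw)
  rw [← map_smul, ← map_smul] at he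
  have he := (Submodule.Quotient.eq _).1 he
  obtain ⟨y, z, h₁, h₂, h₃, h₄⟩ := exists_unit_value hn hν
  have hyz := he y z z y
  simp only [Pi.sub_apply, Pi.smul_apply, smul_eq_mul, h₁, h₂, h₃, h₄] at hyz
  set e' := F (y, z) + F (z, y) - F (y, y) - F (z, z) with he'
  have hee : e = N * e' := by rw [he']; linear_combination hyz
  refine (Submodule.Quotient.mk_eq_zero _).2 (Submodule.mem_span_singleton.2 ⟨e', ?_⟩)
  rw [← map_smul]
  refine (Submodule.Quotient.eq _).2 fun y y' z z' => mul_left_cancel₀ hN ?_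
  have := he y y' z z'
  simp only [Pi.sub_apply, Pi.smul_apply, smul_eq_mul, hee] at this ⊢
  linear_combination this

end Span

section Resolution

variable (ν : Ω → ZMod n)

/-- The map parametrising the functions that are separated modulo multiples of `carry ν`. -/
def carryParam : (Ω ⊕ Ω ⊕ ZMod n → ℤ) →ₗ[ℤ] (Ω × Ω → ℤ) where
  toFun F x := F (Sum.inl x.1) + F (Sum.inr (Sum.inl x.2)) +
    ∑ c, F (Sum.inr (Sum.inr c)) * carry (fun ω => ν ω - c) x
  map_add' F F' := funext fun x => by
    simp only [Pi.add_apply, add_mul, Finset.sum_add_distrib]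
    ring
  map_smul' c F := funext fun x => by
    simp only [Pi.smul_apply, smul_eq_mul, mul_add, Finset.mul_sum, mul_assoc, RingHom.id_apply]

/-- The relations for `carryParam`. -/
def carryRel : (ZMod n → ℤ) →ₗ[ℤ] (Ω ⊕ Ω ⊕ ZMod n → ℤ) where
  toFun h := Sum.elim (fun y => - h (ν y)) (Sum.elim (fun z => h (ν z)) fun t => h (t - 1) - h t)
  map_add' h h' := funext fun x => by
    rcases x with x | x | x <;> simp <;> ring
  map_smul' c h := funext fun x => by
    rcases x with x | x | x <;> simp
    ring

lemma sum_carry_shift (hn : 1 < n) (h : ZMod n → ℤ) (y z : Ω) :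
    ∑ c, (h (c - 1) - h c) * carry (fun ω => ν ω - c) (y, z) = h (ν y) - h (ν z) := by
  have key : ∑ c, h (c - 1) * carry (fun ω => ν ω - c) (y, z) =
      ∑ c, h c * carry (fun ω => ν ω - (c + 1)) (y, z) := by
    rw [← Equiv.sum_comp (Equiv.addRight (1 : ZMod n))]
    simp
  simp_rw [sub_mul, Finset.sum_sub_distrib]
  rw [key, ← Finset.sum_sub_distrib]
  simp_rw [← mul_sub, carry_shift_succ hn, mul_sub, Finset.sum_sub_distrib]
  simp

variable {ν}

lemma carryParam_eq_zero_iff (hn : 1 < n) (hν : Surjective ν) (F : Ω ⊕ Ω ⊕ ZMod n → ℤ) :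
    carryParam ν F = 0 ↔ F ∈ Set.range (carryRel ν) := by
  have : Fact (1 < n) := ⟨hn⟩
  constructor
  · intro hF
    have hF : ∀ y z, F (Sum.inl y) + F (Sum.inr (Sum.inl z)) +
      ∑ c, F (Sum.inr (Sum.inr c)) * carry (fun ω => ν ω - c) (y, z) = 0 :=
        fun y z => congrFun hF (y, z)
    have h₀ : ∀ y z, ν y = ν z → F (Sum.inl y) + F (Sum.inr (Sum.inl z)) = 0 := fun y z h => by
      have := hF y z
      simpa [carry, h] using this
    choose ω hω using hν
    have hz : ∀ z, F (Sum.inr (Sum.inl (ω (ν z)))) = F (Sum.inr (Sum.inl z)) := fun z => by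
      linear_combination h₀ (ω (ν z)) (ω (ν z)) rfl - h₀ (ω (ν z)) z (hω _)
    have hy : ∀ y, - F (Sum.inr (Sum.inl (ω (ν y)))) = F (Sum.inl y) := fun y => by
      linear_combination - h₀ y (ω (ν y)) (hω _).symm
    refine ⟨fun t => F (Sum.inr (Sum.inl (ω t))), funext fun x => ?_⟩
    rcases x with y | z | t
    · exact hy y
    · exact hz z
    · change F (Sum.inr (Sum.inl (ω (t - 1)))) - F (Sum.inr (Sum.inl (ω t))) = _
      have h₁ := hF (ω (t - 1)) (ω t)
      have h₂ : ∀ c, carry (fun ω => ν ω - c) (ω (t - 1), ω t) = if c = t then 1 else 0 :=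
        fun c => by
          simp only [carry, hω]
          by_cases hc : c = t
          · subst hc
            have h₃ : c - 1 - c = -1 := by ring
            rw [if_pos rfl, if_pos]
            rw [sub_self, ZMod.val_zero, h₃, Nat.pos_iff_ne_zero, ZMod.val_ne_zero]
            simp
          · have h₃ : 1 ≤ (t - c).val := Nat.one_le_iff_ne_zero.2 fun h₀ =>
              hc (sub_eq_zero.1 ((ZMod.val_eq_zero _).1 h₀)).symm
            rw [if_neg hc, if_neg]
            have h₅ : (t - c - 1).val = (t - c).val - 1 := by
              rw [ZMod.val_sub (a := t - c) (by rwa [ZMod.val_one]), ZMod.val_one]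
            rw [show t - 1 - c = t - c - 1 by ring, h₅]
            omega
      simp_rw [h₂] at h₁
      have h₄ := hy (ω (t - 1))
      rw [hω] at h₄
      simp only [mul_ite, mul_one, mul_zero, Finset.sum_ite_eq', Finset.mem_univ, if_true] at h₁
      linear_combination - h₁ - h₄
  · rintro ⟨h, rfl⟩
    funext ⟨y, z⟩
    change - h (ν y) + h (ν z) + ∑ c, (h (c - 1) - h c) * carry (fun ω => ν ω - c) (y, z) = 0
    rw [sum_carry_shift _ hn]
    ring

end Resolution

end CarryLattice

section CarryCds

variable {k : Type} [Ring k] {G Q : Type} [Group G] [Group Q] {f : ℕ → NNReal} {π : G →* Q}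
  {M : Type} [AddCommGroup M] [Module (MonoidAlgebra k G) M] {Ω : Type} [MulAction Q Ω] {n : ℕ}
  [NeZero n] [MulAction Q (ZMod n)] {ν : Ω → ZMod n}

lemma sub_smul_eq (hC : ∀ (g : Q) (c c' : ZMod n), g • (c + c') = g • c + c') (g : Q)
    (c c' : ZMod n) : c' - g • c = g⁻¹ • c' - c := by
  have := hC g (g⁻¹ • c') (c - g⁻¹ • c')
  rw [smul_inv_smul, add_sub_cancel] at this
  rw [this]
  ring

lemma inv_smul_eq_add (hC : ∀ (g : Q) (c c' : ZMod n), g • (c + c') = g • c + c') (g : Q)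
    (c : ZMod n) : g⁻¹ • c = c + g⁻¹ • (0 : ZMod n) := by
  have := hC g⁻¹ 0 c
  rw [zero_add] at this
  rw [this, add_comm]

lemma carryParam_permRep (hC : ∀ (g : Q) (c c' : ZMod n), g • (c + c') = g • c + c')
    (hν : ∀ (g : Q) ω, ν (g • ω) = g • ν ω) (g : Q) (F : Ω ⊕ Ω ⊕ ZMod n → ℤ) :
    carryParam ν (permRep Q _ g F) = permRep Q _ g (carryParam ν F) := funext fun x => by
  change F (Sum.inl (g⁻¹ • x.1)) + F (Sum.inr (Sum.inl (g⁻¹ • x.2))) +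
    ∑ c, F (Sum.inr (Sum.inr (g⁻¹ • c))) * carry (fun ω => ν ω - c) x =
    F (Sum.inl (g⁻¹ • x.1)) + F (Sum.inr (Sum.inl (g⁻¹ • x.2))) +
    ∑ c, F (Sum.inr (Sum.inr c)) * carry (fun ω => ν ω - c) (g⁻¹ • x)
  rw [← Equiv.sum_comp (MulAction.toPerm g)]
  congr 1
  refine Finset.sum_congr rfl fun c _ => ?_
  rw [MulAction.toPerm_apply, inv_smul_smul]
  simp only [carry, Prod.smul_fst, Prod.smul_snd, hν, sub_smul_eq hC]

lemma carryRel_permRep (hC : ∀ (g : Q) (c c' : ZMod n), g • (c + c') = g • c + c')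
    (hν : ∀ (g : Q) ω, ν (g • ω) = g • ν ω) (g : Q) (h : ZMod n → ℤ) :
    carryRel ν (permRep Q _ g h) = permRep Q _ g (carryRel ν h) := funext fun x => by
  rcases x with y | z | t
  · change - h (g⁻¹ • ν y) = - h (ν (g⁻¹ • y))
    rw [hν]
  · change h (g⁻¹ • ν z) = h (ν (g⁻¹ • z))
    rw [hν]
  · change h (g⁻¹ • (t - 1)) - h (g⁻¹ • t) = h (g⁻¹ • t - 1) - h (g⁻¹ • t)
    rw [sub_eq_add_neg t, hC, ← sub_eq_add_neg]

lemma carryRel_injective (hν : Surjective ν) : Injective (carryRel ν) := fun h h' e =>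
  funext fun t => by
    obtain ⟨z, rfl⟩ := hν t
    exact congrFun e (Sum.inr (Sum.inl z))

lemma carryRep_mkQ_carry (hC : ∀ (g : Q) (c c' : ZMod n), g • (c + c') = g • c + c')
    (hν : ∀ (g : Q) ω, ν (g • ω) = g • ν ω) (g : Q) :
    carryRep Q Ω g ((sepFun Ω).mkQ (carry ν)) = (sepFun Ω).mkQ (carry ν) := by
  rw [← mkQ_permRep, permRep_carry]
  exact mkQ_carry_eq fun ω => by rw [hν, inv_smul_eq_add hC]

/-- The functions that are separated modulo multiples of `carry ν`. -/
def carryKer (ν : Ω → ZMod n) : Submodule ℤ (Ω × Ω → ℤ) :=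
  (ℤ ∙ (sepFun Ω).mkQ (carry ν)).comap (sepFun Ω).mkQ

lemma carryParam_mem (ν : Ω → ZMod n) (F : Ω ⊕ Ω ⊕ ZMod n → ℤ) : carryParam ν F ∈ carryKer ν := by
  refine Submodule.mem_span_singleton.2 ⟨∑ c, F (Sum.inr (Sum.inr c)), ?_⟩
  rw [← map_smul]
  refine (Submodule.Quotient.eq _).2 ?_
  have h : (∑ c, F (Sum.inr (Sum.inr c))) • carry ν - carryParam ν F =
      (fun x => - F (Sum.inl x.1) - F (Sum.inr (Sum.inl x.2))) +
      ∑ c, (- F (Sum.inr (Sum.inr c))) • (carry (fun ω => ν ω - c) - carry ν) := funext fun x => by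
    simp [carryParam, Finset.sum_apply, Finset.sum_mul, mul_sub]
    ring
  rw [h]
  refine add_mem (fun y y' z z' => by ring) (sum_mem fun c _ => Submodule.smul_mem _ _ ?_)
  exact carry_sub_carry_mem (t := -c) fun ω => sub_eq_add_neg _ _

lemma exists_carryParam [Nonempty Ω] {F : Ω × Ω → ℤ} (hF : F ∈ carryKer ν) :
    ∃ F', carryParam ν F' = F := by
  obtain ⟨e, he⟩ := Submodule.mem_span_singleton.1 hF
  rw [← map_smul] at he
  obtain ⟨a, b, h⟩ := exists_of_mem_sepFun ((Submodule.Quotient.eq _).1 he.symm)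
  refine ⟨Sum.elim a (Sum.elim b (Pi.single 0 e)), funext fun x => ?_⟩
  have := h x.1 x.2
  simp only [Pi.sub_apply, Pi.smul_apply, smul_eq_mul] at this
  change a x.1 + b x.2 + ∑ c, Pi.single (M := fun _ => ℤ) 0 e c * carry (fun ω => ν ω - c) x = F x
  rw [Finset.sum_eq_single 0 (fun c _ hc => by simp [Pi.single_eq_of_ne hc]) (by simp)]
  simp only [Pi.single_eq_same, sub_zero]
  linear_combination -this

lemma carryKer_le_comap (hC : ∀ (g : Q) (c c' : ZMod n), g • (c + c') = g • c + c')
    (hν : ∀ (g : Q) ω, ν (g • ω) = g • ν ω) (g : Q) {F : Ω × Ω → ℤ} (hF : F ∈ carryKer ν) :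
    permRep Q _ g F ∈ carryKer ν := by
  obtain ⟨e, he⟩ := Submodule.mem_span_singleton.1 hF
  refine Submodule.mem_span_singleton.2 ⟨e, ?_⟩
  rw [mkQ_permRep, ← he, map_smul, carryRep_mkQ_carry hC hν]

lemma span_carry_le_comap (hC : ∀ (g : Q) (c c' : ZMod n), g • (c + c') = g • c + c')
    (hν : ∀ (g : Q) ω, ν (g • ω) = g • ν ω) (g : Q) :
    (ℤ ∙ (sepFun Ω).mkQ (carry ν)) ≤
      (ℤ ∙ (sepFun Ω).mkQ (carry ν)).comap (carryRep Q Ω g) := fun v hv => by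
  obtain ⟨e, rfl⟩ := Submodule.mem_span_singleton.1 hv
  refine Submodule.mem_span_singleton.2 ⟨e, ?_⟩
  rw [map_smul, carryRep_mkQ_carry hC hν]

lemma isSES_carry (hn : 1 < n) (hνs : Surjective ν) :
    IsSES (LinearMap.toSpanSingleton ℤ _ ((sepFun Ω).mkQ (carry ν)))
      (ℤ ∙ (sepFun Ω).mkQ (carry ν)).mkQ := by
  refine ⟨?_, Submodule.mkQ_surjective _, fun v => ?_⟩
  · rw [← LinearMap.ker_eq_bot]
    exact LinearMap.ker_eq_bot'.2 fun e he => smul_mkQ_carry_eq_zero hn hνs he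
  · exact (Submodule.Quotient.mk_eq_zero _).trans Submodule.mem_span_singleton

variable [Finite Ω] {I : Type} [Fintype I] [DecidableEq I] [MulAction Q I]

lemma tpowCds_permRep_of_map (hM : ProperCds k f π M) (hπ : Surjective π) {X : Type} [Finite X]
    [MulAction Q X] (x₀ : I) {a : Q} (ha : a • x₀ = x₀) (hac : ∀ c : ZMod n, a • c ≠ c)
    (ξ : X → ZMod n) (hξ : ∀ (g : Q) x, ξ (g • x) = g • ξ x) :
    TpowCds k f π M I (permRep Q X) :=
  tpowCds_permRep hM hπ x₀ fun x => ⟨a, ha, fun h => hac (ξ x) (by rw [← hξ, h])⟩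

lemma tpowCds_carryQuot (hf : IsProperComplexityFunction f) (hM : ProperCds k f π M)
    (hπ : Surjective π) [MulAction.IsPretransitive Q I] (hn : 1 < n)
    (hC : ∀ (g : Q) (c c' : ZMod n), g • (c + c') = g • c + c')
    (hν : ∀ (g : Q) ω, ν (g • ω) = g • ν ω) (hνs : Surjective ν)
    (x₀ : I) {a : Q} (ha : a • x₀ = x₀) (hac : ∀ c : ZMod n, a • c ≠ c) :
    TpowCds k f π M I ((carryRep Q Ω).quotient _ (span_carry_le_comap hC hν)) := by
  have : Nonempty I := ⟨x₀⟩
  obtain ⟨ω₀, -⟩ := hνs 0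
  have : Nonempty Ω := ⟨ω₀⟩
  let rU : Representation ℤ Q (carryKer ν) :=
    (permRep Q _).subrepresentation _ fun g _ hF => carryKer_le_comap hC hν g hF
  have hU : TpowCds k f π M I rU := by
    refine TpowCds.coker hf hM hπ (r₁ := permRep Q (ZMod n)) (r₂ := permRep Q (Ω ⊕ Ω ⊕ ZMod n))
      (i := carryRel ν) (q := (carryParam ν).codRestrict _ (carryParam_mem ν)) ⟨?_, ?_, ?_⟩
      (carryRel_permRep hC hν) ?_
      (tpowCds_permRep_of_map hM hπ x₀ ha hac id fun _ _ => rfl)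
      (tpowCds_permRep_of_map hM hπ x₀ ha hac (Sum.elim ν (Sum.elim ν id)) ?_)
    · exact carryRel_injective hνs
    · rintro ⟨F, hF⟩
      obtain ⟨F', rfl⟩ := exists_carryParam hF
      exact ⟨F', rfl⟩
    · intro F
      rw [← carryParam_eq_zero_iff hn hνs]
      exact Subtype.ext_iff
    · intro g F
      exact Subtype.ext (carryParam_permRep hC hν g F)
    · rintro g (x | x | x)
      · exact hν g x
      · exact hν g x
      · rfl
  refine TpowCds.coker hf hM hπ (r₁ := rU) (r₂ := permRep Q (Ω × Ω)) (i := (carryKer ν).subtype)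
    (q := (ℤ ∙ (sepFun Ω).mkQ (carry ν)).mkQ ∘ₗ (sepFun Ω).mkQ) ⟨?_, ?_, ?_⟩
    (fun _ _ => rfl) (fun _ _ => rfl) hU
    (tpowCds_permRep_of_map hM hπ x₀ ha hac (fun x => ν x.1) fun g x => hν g x.1)
  · exact Subtype.val_injective
  · exact (Submodule.mkQ_surjective _).comp (Submodule.mkQ_surjective _)
  · intro F
    exact (Submodule.Quotient.mk_eq_zero _).trans ⟨fun h => ⟨⟨F, h⟩, rfl⟩, by rintro ⟨x, rfl⟩; exact x.2⟩

end CarryCds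

section Criteria

variable {k : Type} [Ring k] {G Q : Type} [Group G] [Group Q] {f : ℕ → NNReal} {π : G →* Q}
  {M : Type} [AddCommGroup M] [Module (MonoidAlgebra k G) M] {n : ℕ} [NeZero n]

/-- The action by translations through an additive character. -/
abbrev translateAction (μ : Q → ZMod n) (hμ : ∀ g h, μ (g * h) = μ g + μ h) :
    MulAction Q (ZMod n) where
  smul g c := c + μ g
  one_smul c := by
    have := hμ 1 1
    rw [mul_one, left_eq_add] at this
    exact (congrArg (c + ·) this).trans (add_zero c)
  mul_smul g h c := by
    change c + μ (g * h) = c + μ h + μ g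
    rw [hμ]
    ring

lemma free_carryQuot {Ω : Type} [Finite Ω] {ν : Ω → ZMod n} (hn : 1 < n) (hν : Surjective ν) :
    Module.Free ℤ (((Ω × Ω → ℤ) ⧸ sepFun Ω) ⧸ (ℤ ∙ (sepFun Ω).mkQ (carry ν))) := by
  have := isTorsionFree_carry hn hν
  exact Module.free_of_finite_type_torsion_free'

lemma one_lt_of_ne_zero {c : ZMod n} (hc : c ≠ 0) : 1 < n := by
  by_contra h
  have h₀ := NeZero.ne n
  obtain rfl : n = 1 := by omega
  exact hc (Subsingleton.elim _ _)

/-- A proper-subgroup criterion: an additive character that does not vanish on `p`-th powers. -/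
theorem hasCds_of_character [Finite Q] {p m : ℕ} (hQ : Nat.card Q = p ^ m)
    (hf : IsProperComplexityFunction f) (hM : ProperCds k f π M) (hπ : Surjective π)
    {χ : Q → ZMod n} (hχ : ∀ g h, χ (g * h) = χ g + χ h) {a : Q} (ha : (p : ZMod n) * χ a ≠ 0) :
    HasCds (MonoidAlgebra k G) f M := by
  let _ : MulAction Q (ZMod n) := translateAction (fun g => (p : ZMod n) * χ g) fun g h => by
    rw [hχ]
    ring
  have hC : ∀ (g : Q) (c c' : ZMod n), g • (c + c') = g • c + c' := fun g c c' => by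
    change c + c' + _ = c + _ + c'
    ring
  have hn := one_lt_of_ne_zero ha
  have hχ₁ : χ 1 = 0 := by simpa using hχ 1 1
  have : Nontrivial Q := ⟨a, 1, fun h => ha (by rw [h, hχ₁, mul_zero])⟩
  have : MulAction.IsPretransitive Q Unit := ⟨fun _ _ => ⟨1, rfl⟩⟩
  let Ω := Q × ZMod n
  let ν : Ω → ZMod n := Prod.snd
  have hν : ∀ (g : Q) ω, ν (g • ω) = g • ν ω := fun g ω => rfl
  have hνs : Surjective ν := Prod.snd_surjective
  let l : Ω → ZMod n := fun ω => χ ω.1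
  have hl : ∀ (g : Q) ω, l (g⁻¹ • ω) = l ω + χ g⁻¹ := fun g ω => (hχ _ _).trans (add_comm _ _)
  have hac : ∀ c : ZMod n, a • c ≠ c := fun c h =>
    ha (add_eq_left.1 (show c + p * χ a = c from h))
  have := free_carryQuot hn hνs
  refine hasCds_of_smul_eq hQ hf hM hπ (isSES_carry hn hνs) (carryRep_mkQ_carry hC hν)
    (rW := (carryRep Q Ω).quotient _ (span_carry_le_comap hC hν)) (fun _ _ => rfl)
    (tpowCds_carryQuot hf hM hπ hn hC hν hνs () rfl hac)
    (tpowCds_permRep_of_map hM hπ () rfl hac (fun x : Ω × Ω => ν x.1) fun g x => hν g x.1)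
    (E := (sepFun Ω).mkQ) (fun _ _ => rfl) (d := carryDefect p l ν 0) (fun g => ?_)
    (φ := (sepFun Ω).mkQ (carry l)) (fun g => ?_) ?_
  · rw [permRep_carryDefect]
    exact carryDefect_congr (t₁ := χ g⁻¹) (t₂ := p * χ g⁻¹) (t₃ := 0) (hl g) (fun ω => rfl)
      (fun ω => by simp) (by simp)
  · rw [← mkQ_permRep, permRep_carry]
    exact mkQ_carry_eq (hl g)
  · have := carry_relation_mem (p : ℤ) l ν 0
    have h₀ : carry (0 : Ω → ZMod n) = 0 := funext fun x => by simp [carry]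
    rw [h₀, sub_zero, sub_sub] at this
    rw [← map_smul, ← map_add]
    exact (Submodule.Quotient.eq _).2 this

end Criteria

section Commutator

variable {k : Type} [Ring k] {G Q : Type} [Group G] [Group Q] {f : ℕ → NNReal} {π : G →* Q}
  {M : Type} [AddCommGroup M] [Module (MonoidAlgebra k G) M] {n : ℕ} [NeZero n]

/-- The equivariant family of translates of a vector fixed by a subgroup. -/
def translates {V : Type} [AddCommGroup V] (r : Representation ℤ Q V) {A : Subgroup Q} {v : V}
    (hv : ∀ a ∈ A, r a v = v) : Q ⧸ A → V :=
  Quotient.lift (fun g => r g v) fun g h hgh => by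
    have := hv _ (QuotientGroup.leftRel_apply.1 hgh)
    rw [map_mul, Module.End.mul_apply] at this
    change r g v = r h v
    rw [← this, ← Module.End.mul_apply, ← map_mul, mul_inv_cancel, map_one, Module.End.one_apply,
      this]

lemma translates_mk {V : Type} [AddCommGroup V] (r : Representation ℤ Q V) {A : Subgroup Q} {v : V}
    (hv : ∀ a ∈ A, r a v = v) (g : Q) : translates r hv (g : Q ⧸ A) = r g v := rfl

lemma translates_smul {V : Type} [AddCommGroup V] (r : Representation ℤ Q V) {A : Subgroup Q}
    {v : V} (hv : ∀ a ∈ A, r a v = v) (g : Q) (x : Q ⧸ A) :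
    r g (translates r hv x) = translates r hv (g • x) := by
  induction x using QuotientGroup.induction_on with
  | H h => exact (congrArg (fun T => T v) (map_mul r g h)).symm

/-- Every additive character of a normal subgroup is the restriction of a twisted-additive
function. -/
lemma exists_extension (A : Subgroup Q) [A.Normal] {χ : A → ZMod n}
    (hχ : ∀ g h, χ (g * h) = χ g + χ h) : ∃ l : Q → ZMod n, ∀ (a : A) q, l (a * q) = l q + χ a := by
  have h : ∀ q : Q, q * (q : Q ⧸ A).out⁻¹ ∈ A := fun q => by
    obtain ⟨h, hh⟩ := QuotientGroup.mk_out_eq_mul A q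
    rw [hh, mul_inv_rev, ← mul_assoc]
    exact ‹A.Normal›.conj_mem _ (A.inv_mem h.2) q
  refine ⟨fun q => χ ⟨_, h q⟩, fun a q => ?_⟩
  have hq : ((a * q : Q) : Q ⧸ A) = q := by
    rw [QuotientGroup.eq, mul_inv_rev]
    simpa using ‹A.Normal›.conj_mem _ (A.inv_mem a.2) q⁻¹
  rw [add_comm, ← hχ]
  refine congrArg χ (Subtype.ext ?_)
  change a * q * (((a * q : Q) : Q ⧸ A).out)⁻¹ = a * (q * (q : Q ⧸ A).out⁻¹)
  rw [hq, mul_assoc]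

/-- A proper-subgroup criterion for nonabelian quotients. -/
theorem hasCds_of_commutator [Finite Q]
    (hf : IsProperComplexityFunction f) (hM : ProperCds k f π M) (hπ : Surjective π)
    (A : Subgroup Q) [A.Normal] {χ : A → ZMod n} (hχ : ∀ g h, χ (g * h) = χ g + χ h) {b : Q}
    {μ : Q → ZMod n} (hμ : ∀ g h, μ (g * h) = μ g + μ h)
    (hμχ : ∀ a a' : A, (a' : Q) = b⁻¹ * a * b → χ a' = χ a + μ a) {a₀ : Q} (ha₀ : a₀ ∈ A)
    (hμa : μ a₀ ≠ 0) : HasCds (MonoidAlgebra k G) f M := by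
  classical
  let _ : MulAction Q (ZMod n) := translateAction μ hμ
  have hC : ∀ (g : Q) (c c' : ZMod n), g • (c + c') = g • c + c' := fun g c c' => by
    change c + c' + _ = c + _ + c'
    ring
  have hn := one_lt_of_ne_zero hμa
  let _ := Fintype.ofFinite (Q ⧸ A)
  let Ω := Q × ZMod n
  let ν : Ω → ZMod n := Prod.snd
  have hν : ∀ (g : Q) ω, ν (g • ω) = g • ν ω := fun g ω => rfl
  have hνs : Surjective ν := Prod.snd_surjective
  obtain ⟨l₀, hl₀⟩ := exists_extension A hχ
  let l : Ω → ZMod n := fun ω => l₀ ω.1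
  have hac : ∀ c : ZMod n, a₀ • c ≠ c := fun c h =>
    hμa (add_eq_left.1 (show c + μ a₀ = c from h))
  have hl : ∀ (a : Q) (ha : a ∈ A) ω, l (a⁻¹ • ω) = l ω + χ ⟨a⁻¹, A.inv_mem ha⟩ :=
    fun a ha ω => hl₀ ⟨a⁻¹, A.inv_mem ha⟩ ω.1
  have hb : ∀ a ∈ A, b⁻¹ * a⁻¹ * b ∈ A := fun a ha => by
    simpa using ‹A.Normal›.conj_mem _ (A.inv_mem ha) b⁻¹
  have hlb : ∀ (a : Q) (ha : a ∈ A) ω, l (b⁻¹ • a⁻¹ • ω) = l (b⁻¹ • ω) + χ ⟨_, hb a ha⟩ :=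
    fun a ha ω => by
      rw [← hl₀]
      change l₀ _ = l₀ _
      congr 1
      change b⁻¹ * (a⁻¹ * ω.1) = b⁻¹ * a⁻¹ * b * (b⁻¹ * ω.1)
      group
  let d₀ := carryDefect 1 (fun ω => l (b⁻¹ • ω)) l ν
  have hφ₀ : ∀ a ∈ A, carryRep Q Ω a ((sepFun Ω).mkQ (carry l)) = (sepFun Ω).mkQ (carry l) :=
    fun a ha => by
      rw [← mkQ_permRep, permRep_carry]
      exact mkQ_carry_eq (hl a ha)
  have hd₀ : ∀ a ∈ A, permRep Q (Ω × Ω) a d₀ = d₀ := fun a ha => by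
    rw [permRep_carryDefect]
    refine carryDefect_congr (hlb a ha) (hl a ha) (t₃ := μ a⁻¹) (fun ω => rfl) ?_
    rw [Int.cast_one, one_mul]
    exact hμχ ⟨a⁻¹, A.inv_mem ha⟩ _ rfl
  let θ : Equiv.Perm (Q ⧸ A) := Equiv.mulRight (b : Q ⧸ A)
  have hx₀ : a₀ • ((1 : Q) : Q ⧸ A) = ((1 : Q) : Q ⧸ A) := by
    rw [MulAction.Quotient.smul_mk, QuotientGroup.eq]
    simpa using ha₀
  have := free_carryQuot hn hνs
  refine hasCds_of_perm (I := Q ⧸ A) hf hM hπ (isSES_carry hn hνs) (carryRep_mkQ_carry hC hν)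
    (rW := (carryRep Q Ω).quotient _ (span_carry_le_comap hC hν)) (fun _ _ => rfl)
    (tpowCds_carryQuot hf hM hπ hn hC hν hνs _ hx₀ hac)
    (tpowCds_permRep_of_map hM hπ _ hx₀ hac (fun x : Ω × Ω => ν x.1) fun g x => hν g x.1)
    (E := (sepFun Ω).mkQ) (fun _ _ => rfl) (translates_smul _ hd₀) (translates_smul _ hφ₀) θ
    (fun g x => ?_) (fun x => ?_)
  · induction x using QuotientGroup.induction_on with
    | H h => exact congrArg _ (mul_assoc g h b)
  · induction x using QuotientGroup.induction_on with
    | H h =>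
      have key : (sepFun Ω).mkQ (permRep Q _ b (carry l)) =
          (sepFun Ω).mkQ (carry l) + (sepFun Ω).mkQ (carry ν) + (sepFun Ω).mkQ d₀ := by
        have := carry_relation_mem 1 (fun ω => l (b⁻¹ • ω)) l ν
        rw [one_smul, sub_sub, sub_sub] at this
        rw [← map_add, ← map_add]
        refine (Submodule.Quotient.eq _).2 ?_
        rw [permRep_carry, add_assoc]
        exact this
      change translates _ hφ₀ ((h * b : Q) : Q ⧸ A) = _
      rw [translates_mk, translates_mk, translates_mk, map_mul, Module.End.mul_apply,
        ← mkQ_permRep, key, map_add, map_add, carryRep_mkQ_carry hC hν, mkQ_permRep]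

end Commutator

section GroupTheory

lemma exists_character {A : Type} [Group A] [Finite A] (hA : ∀ a b : A, a * b = b * a) {x : A}
    (hx : x ≠ 1) : ∃ (n : ℕ) (_ : NeZero n) (χ : A → ZMod n),
      (∀ a b, χ (a * b) = χ a + χ b) ∧ χ x ≠ 0 := by
  let _ : CommGroup A := { ‹Group A› with mul_comm := hA }
  let n := Monoid.exponent A
  have : NeZero n := ⟨Monoid.exponent_ne_zero_of_finite⟩
  have : HasEnoughRootsOfUnity (Multiplicative (ZMod n)) n := by
    refine ⟨⟨Multiplicative.ofAdd 1, ?_⟩, ?_⟩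
    · rw [IsPrimitiveRoot.iff_orderOf, orderOf_ofAdd_eq_addOrderOf, ZMod.addOrderOf_one]
    · have : IsCyclic (Multiplicative (ZMod n))ˣ :=
        isCyclic_of_surjective toUnits toUnits.surjective
      infer_instance
  obtain ⟨φ, hφ⟩ := CommGroup.exists_apply_ne_one_of_hasEnoughRootsOfUnity A
    (Multiplicative (ZMod n)) hx
  refine ⟨n, inferInstance, fun a => (φ a : Multiplicative (ZMod n)).toAdd, fun a b => ?_, fun h => hφ ?_⟩
  · beta_reduce
    rw [map_mul, Units.val_mul, toAdd_mul]
  · exact Units.ext (Multiplicative.toAdd.injective h)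

lemma exists_addEquiv_of_smul_eq_zero {A : Type} [AddCommGroup A] [Finite A] {p : ℕ}
    (hp : p.Prime) (h : ∀ a : A, p • a = 0) : ∃ r : ℕ, Nonempty (A ≃+ (Fin r → ZMod p)) := by
  have : Fact p.Prime := ⟨hp⟩
  have key : ∀ [Module (ZMod p) A], Nonempty (A ≃+ (Fin (Module.finrank (ZMod p) A) → ZMod p)) :=
    ⟨(Module.finBasis (ZMod p) A).equivFun.toAddEquiv⟩
  exact ⟨_, @key (AddCommGroup.zmodModule h)⟩

lemma isElementaryAbelian_of_pow_eq_one {A : Type} [Group A] [Finite A]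
    (hA : ∀ a b : A, a * b = b * a) {p : ℕ} (hp : p.Prime) (h : ∀ a : A, a ^ p = 1) :
    IsElementaryAbelian A := by
  let _ : CommGroup A := { ‹Group A› with mul_comm := hA }
  obtain ⟨r, ⟨e⟩⟩ := exists_addEquiv_of_smul_eq_zero (A := Additive A) hp fun a => h a.toMul
  exact ⟨p, r, hp, ⟨AddEquiv.toMultiplicativeRight e⟩⟩

end GroupTheory

section ProperStep

variable {k : Type} [Ring k] {G Q : Type} [Group G] [Group Q] {f : ℕ → NNReal} {π : G →* Q}
  {M : Type} [AddCommGroup M] [Module (MonoidAlgebra k G) M]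

lemma hasCds_of_commutator_central [Finite Q] (hf : IsProperComplexityFunction f)
    (hM : ProperCds k f π M) (hπ : Surjective π)
    (hQ : ∀ x y : Q, x * y * x⁻¹ * y⁻¹ ∈ Subgroup.center Q) {a b : Q} (hab : a * b ≠ b * a) :
    HasCds (MonoidAlgebra k G) f M := by
  let A := Subgroup.centralizer (Subgroup.centralizer {a} : Set Q)
  have haA : a ∈ A := Subgroup.mem_centralizer_iff.2 fun x hx =>
    (Subgroup.mem_centralizer_iff.1 hx a rfl).symm
  have haA' : a ∈ Subgroup.centralizer {a} := Subgroup.mem_centralizer_iff.2 fun x hx => by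
    rw [Set.mem_singleton_iff.1 hx]
  have hA : ∀ x y : A, x * y = y * x := fun x y => Subtype.ext <| by
    refine Subgroup.mem_centralizer_iff.1 y.2 x (Subgroup.mem_centralizer_iff.2 fun c hc => ?_)
    rw [Set.mem_singleton_iff.1 hc]
    exact Subgroup.mem_centralizer_iff.1 x.2 a haA'
  have hZ : Subgroup.center Q ≤ A := Subgroup.center_le_centralizer _
  have : A.Normal := ⟨fun x hx g => by
    have := A.mul_mem (hZ (hQ g x)) hx
    rwa [inv_mul_cancel_right] at this⟩
  have hc : ∀ q : Q, b⁻¹ * q * b * q⁻¹ ∈ Subgroup.center Q := fun q => by simpa using hQ b⁻¹ q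
  obtain ⟨n, _, χ, hχ, hx⟩ := exists_character hA (x := ⟨_, hZ (hc a)⟩) fun h => by
    have h : b⁻¹ * a * b * a⁻¹ = 1 := congrArg Subtype.val h
    rw [mul_inv_eq_one, mul_assoc, inv_mul_eq_iff_eq_mul] at h
    exact hab h
  refine hasCds_of_commutator hf hM hπ A hχ (b := b) (μ := fun q => χ ⟨_, hZ (hc q)⟩)
    (fun g h => ?_) (fun x y hxy => ?_) haA hx
  · rw [← hχ]
    refine congrArg χ (Subtype.ext ?_)
    change b⁻¹ * (g * h) * b * (g * h)⁻¹ = b⁻¹ * g * b * g⁻¹ * (b⁻¹ * h * b * h⁻¹)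
    have := Subgroup.mem_center_iff.1 (hc h) g⁻¹
    rw [mul_assoc _ g⁻¹, this]
    group
  · rw [← hχ, hA]
    refine congrArg χ (Subtype.ext ?_)
    rw [hxy]
    exact (inv_mul_cancel_right (b⁻¹ * x * b) (x : Q)).symm

lemma ProperCds.comp (hM : ProperCds k f π M) {Q' : Type} [Group Q'] {σ : Q →* Q'}
    (hσ : Surjective σ) : ProperCds k f (σ.comp π) M := fun U hU =>
  hM (U.comap σ) fun h => hU (Subgroup.comap_injective hσ (h.trans (Subgroup.comap_top σ).symm))

lemma hasCds_of_not_commute {p : ℕ} (hp : p.Prime) (hf : IsProperComplexityFunction f)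
    {m : ℕ} : ∀ {Q : Type} [Group Q] [Finite Q] (_ : IsPGroup p Q) (_ : Nat.card Q = m)
    {π : G →* Q} (_ : ProperCds k f π M) (_ : Surjective π) {a b : Q} (_ : a * b ≠ b * a),
    HasCds (MonoidAlgebra k G) f M := by
  have : Fact p.Prime := ⟨hp⟩
  induction m using Nat.strong_induction_on with
  | _ m ih =>
    intro Q _ _ hQ hm π hM hπ a b hab
    by_cases h : ∃ x y : Q ⧸ Subgroup.center Q, x * y ≠ y * x
    · obtain ⟨x, y, hxy⟩ := h
      have : Nontrivial Q := ⟨a * b, b * a, hab⟩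
      have := hQ.center_nontrivial
      refine ih _ ?_ (hQ.to_quotient (Subgroup.center Q)) rfl
        (hM.comp (QuotientGroup.mk'_surjective _)) ((QuotientGroup.mk'_surjective _).comp hπ) hxy
      rw [← hm, Subgroup.card_eq_card_quotient_mul_card_subgroup (Subgroup.center Q)]
      exact (Nat.lt_mul_iff_one_lt_right Nat.card_pos).2 Finite.one_lt_card
    · push Not at h
      refine hasCds_of_commutator_central hf hM hπ (fun x y => ?_) hab
      rw [← QuotientGroup.eq_one_iff, QuotientGroup.mk_mul, QuotientGroup.mk_mul,
        QuotientGroup.mk_mul, h x y, QuotientGroup.mk_inv, QuotientGroup.mk_inv,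
        mul_inv_cancel_right, mul_inv_cancel]

/-- The bound passes from the preimages of proper subgroups of a finite `p`-group to the whole
group, unless the `p`-group is elementary abelian. -/
theorem hasCds_of_properCds [Finite Q] {p m : ℕ} (hp : p.Prime) (hQ : Nat.card Q = p ^ m)
    (hf : IsProperComplexityFunction f) (hM : ProperCds k f π M) (hπ : Surjective π)
    (h : ¬ IsElementaryAbelian Q) : HasCds (MonoidAlgebra k G) f M := by
  by_cases hc : ∀ a b : Q, a * b = b * a
  · have : ∃ a : Q, a ^ p ≠ 1 := by
      by_contra h'
      push Not at h'
      exact h (isElementaryAbelian_of_pow_eq_one hc hp h')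
    obtain ⟨a, ha⟩ := this
    obtain ⟨n, _, χ, hχ, hx⟩ := exists_character hc ha
    refine hasCds_of_character hQ hf hM hπ hχ (a := a) ?_
    have : ∀ j : ℕ, χ (a ^ j) = j * χ a := fun j => by
      induction j with
      | zero => simpa using hχ 1 1
      | succ j ih => rw [pow_succ, hχ, ih]; push_cast; ring
    rwa [← this]
  · push Not at hc
    obtain ⟨a, b, hab⟩ := hc
    exact hasCds_of_not_commute hp hf (IsPGroup.of_card hQ) rfl hM hπ hab

end ProperStep

section Assembly

variable {k : Type} [Ring k] {G N : Type} [Group G] [Group N] {f : ℕ → NNReal}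

lemma HasCds.of_mulEquiv {M M' : Type} [AddCommGroup M] [Module (MonoidAlgebra k G) M]
    [AddCommGroup M'] [Module (MonoidAlgebra k N) M'] (h : HasCds (MonoidAlgebra k N) f M')
    (e : N ≃* G) (ε : M' ≃+ M)
    (hε : ∀ n (a : k) m, ε (MonoidAlgebra.single n a • m) = MonoidAlgebra.single (e n) a • ε m) :
    HasCds (MonoidAlgebra k G) f M := by
  let D : InductionData N G Unit :=
    { hom := e
      inj := e.injective
      base := ()
      sec := 1
      sec_smul := fun _ => rfl
      stab := fun g => ⟨fun _ => ⟨e.symm g, e.apply_symm_apply g⟩, fun _ => rfl⟩ }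
  refine (D.hasCds_tw_perm ε hε h).of_equiv (linearEquivOfSingle
    { toFun := fun F => F ()
      invFun := fun m _ => m
      left_inv := fun _ => rfl
      right_inv := fun _ => rfl
      map_add' := fun _ _ => rfl } fun g a F => Tw.single_smul_perm g a F ())

lemma hasCds_resMod_map {M : Type} [AddCommGroup M] [Module (MonoidAlgebra k G) M]
    (K : Subgroup G) (U : Subgroup K)
    (h : HasCds (MonoidAlgebra k (U.map K.subtype)) f
      (resMod k (U.map K.subtype) (ModuleCat.of (MonoidAlgebra k G) M))) :
    HasCds (MonoidAlgebra k U) f (resMod k U (ModuleCat.of (MonoidAlgebra k K)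
      (resMod k K (ModuleCat.of (MonoidAlgebra k G) M)))) := by
  let e := U.equivMapOfInjective K.subtype K.subtype_injective
  refine h.of_mulEquiv e.symm ((resModEquiv k M _).trans
    ((resModEquiv k M K).symm.trans (resModEquiv k _ U).symm)) fun n a m => ?_
  obtain ⟨u, rfl⟩ := e.surjective n
  rw [e.symm_apply_apply, AddEquiv.trans_apply, AddEquiv.trans_apply, AddEquiv.symm_apply_eq,
    resModEquiv_single_smul, AddEquiv.symm_apply_eq, resModEquiv_single_smul,
    resModEquiv_single_smul, AddEquiv.trans_apply, AddEquiv.trans_apply,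
    AddEquiv.apply_symm_apply, AddEquiv.apply_symm_apply]
  rfl

lemma hasCds_resMod {H : Subgroup G} [H.Normal] {p l : ℕ} (hp : p.Prime) (hindex : H.index = p ^ l)
    {M : Type} [AddCommGroup M] [Module (MonoidAlgebra k G) M]
    (hf : IsProperComplexityFunction f)
    (hyp : ∀ E : Subgroup G, H ≤ E → IsElementaryAbelian (E ⧸ H.subgroupOf E) →
      HasCds (MonoidAlgebra k E) f (resMod k E (ModuleCat.of (MonoidAlgebra k G) M)))
    {c : ℕ} : ∀ K : Subgroup G, H ≤ K → H.relIndex K = c →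
      HasCds (MonoidAlgebra k K) f (resMod k K (ModuleCat.of (MonoidAlgebra k G) M)) := by
  induction c using Nat.strong_induction_on with
  | _ c ih =>
    intro K hK hc
    by_cases hE : IsElementaryAbelian (K ⧸ H.subgroupOf K)
    · exact hyp K hK hE
    obtain ⟨m, -, hm⟩ := (Nat.dvd_prime_pow hp).1 (hindex ▸ Subgroup.relIndex_dvd_index_of_normal H K)
    have hcard : Nat.card (K ⧸ H.subgroupOf K) = p ^ m := hm
    have hpos : H.relIndex K ≠ 0 := by
      rw [hm]
      exact pow_ne_zero _ hp.ne_zero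
    have : Finite (K ⧸ H.subgroupOf K) := Nat.finite_of_card_ne_zero hpos
    refine hasCds_of_properCds (π := QuotientGroup.mk' (H.subgroupOf K)) hp hcard hf (fun U hU => ?_)
      (QuotientGroup.mk'_surjective _) hE
    have hHU : H ≤ (U.comap (QuotientGroup.mk' (H.subgroupOf K))).map K.subtype := fun x hx => by
      refine ⟨⟨x, hK hx⟩, ?_, rfl⟩
      change ((⟨x, hK hx⟩ : K) : K ⧸ H.subgroupOf K) ∈ U
      rw [(QuotientGroup.eq_one_iff _).2 (Subgroup.mem_subgroupOf.2 hx)]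
      exact U.one_mem
    have hUK := Subgroup.map_subtype_le (U.comap (QuotientGroup.mk' (H.subgroupOf K)))
    have hmul := Subgroup.relIndex_mul_relIndex H _ K hHU hUK
    refine hasCds_resMod_map K _ (ih _ ?_ _ hHU rfl)
    rw [← hc, ← hmul]
    have h₀ := mul_ne_zero_iff.1 (hmul ▸ hpos)
    refine (Nat.lt_mul_iff_one_lt_right (Nat.pos_of_ne_zero h₀.1)).2
      (lt_of_le_of_ne (Nat.one_le_iff_ne_zero.2 h₀.2) fun h => hU ?_)
    rw [eq_comm, Subgroup.relIndex_eq_one] at h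
    refine (Subgroup.eq_top_iff' U).2 fun x => ?_
    obtain ⟨y, rfl⟩ := QuotientGroup.mk'_surjective _ x
    obtain ⟨z, hz, hzy⟩ := h y.2
    rw [← Subtype.ext hzy]
    exact hz

end Assembly

/-- If `H ⊴ G` has index `p ^ l` (`p` prime) and `cds_{kE}(M) ≤ f` for every subgroup
`H ≤ E ≤ G` with `E/H` elementary abelian, then `cds_{kG}(M) ≤ f`. -/
theorem cds_of_elementary_abelian_quotients_pPower
    (k : Type) [Ring k] (G : Type) [Group G]
    (H : Subgroup G) [H.Normal] (p l : ℕ) (hp : p.Prime) (hindex : H.index = p ^ l)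
    (M : ModuleCat.{0} (MonoidAlgebra k G))
    (f : ℕ → NNReal) (hf : IsProperComplexityFunction f)
    (hyp : ∀ E : Subgroup G, H ≤ E → IsElementaryAbelian (E ⧸ H.subgroupOf E) →
      CdsLE (MonoidAlgebra k E) (resMod k E M) f) :
    CdsLE (MonoidAlgebra k G) M f := by
  have h := hasCds_resMod (M := M) hp hindex hf
    (fun E hE hE' => cdsLE_iff_hasCds.1 (hyp E hE hE')) ⊤ le_top rfl
  exact cdsLE_iff_hasCds.2 (h.of_mulEquiv Subgroup.topEquiv (resModEquiv k M ⊤)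
    (resModEquiv_single_smul ⊤))
end
end

section
/- Let k be a ring, G a group, and H a subgroup of G of finite index such that the index [G:H] is invertible in k. Let M be a kG-module and f a proper complexity function. If cds_{kH}(M) ≤ f, then cds_{kG}(M) ≤ f. -/
open CategoryTheory

noncomputable section

section Frobenius

variable {R S : Type} [Ring R] [Ring S]

/-- A Frobenius system for a ring homomorphism `φ : R →+* S`: an `R`-bimodule map `π : S → R`
together with dual bases `x`, `y` of `S` over `R` with respect to `π`. -/
structure FrobeniusSystem (φ : R →+* S) (ι : Type) [Fintype ι] where
  π : S →+ R
  π_map_mul : ∀ r s, π (φ r * s) = r * π s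
  π_mul_map : ∀ s r, π (s * φ r) = π s * r
  x : ι → S
  y : ι → S
  sum_π_mul : ∀ s, ∑ i, φ (π (s * x i)) * y i = s
  sum_mul_π : ∀ s, ∑ i, x i * φ (π (y i * s)) = s

open ModuleCat

/-- The additive map `S → M` underlying an element of the coextension of `M`. -/
def coextendEval {φ : R →+* S} {M : ModuleCat.{0} R} (g : (coextendScalars φ).obj M) : S →+ M :=
  (CoextendScalars.equiv φ M g).toAddMonoidHom

section CoextendEval

variable {φ : R →+* S} {M : ModuleCat.{0} R}

lemma coextendEval_map_mul (g : (coextendScalars φ).obj M) (r : R) (s : S) :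
    coextendEval g (φ r * s) = r • coextendEval g s :=
  (CoextendScalars.equiv φ M g).map_smul r s

lemma coextendEval_smul (g : (coextendScalars φ).obj M) (s t : S) :
    coextendEval (s • g) t = coextendEval g (t * s) := rfl

lemma coextendEval_add (g h : (coextendScalars φ).obj M) :
    coextendEval (g + h) = coextendEval g + coextendEval h := rfl

lemma coextendEval_sum {ι : Type} (g : ι → (coextendScalars φ).obj M) (t : Finset ι) (s : S) :
    coextendEval (∑ i ∈ t, g i) s = ∑ i ∈ t, coextendEval (g i) s :=
  map_sum (AddMonoidHom.mk' (fun g : (coextendScalars φ).obj M => coextendEval g s)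
    fun _ _ => rfl) g t

lemma coextendEval_ext {g h : (coextendScalars φ).obj M}
    (H : ∀ s, coextendEval g s = coextendEval h s) : g = h :=
  CoextendScalars.ext (LinearMap.ext H)

/-- `coextendEval` with values in an `S`-module `X` rather than in its restriction to `R`. -/
def coextendResEval {X : ModuleCat.{0} S}
    (g : (coextendScalars φ).obj ((restrictScalars φ).obj X)) : S →+ X :=
  coextendEval (M := (restrictScalars φ).obj X) g

lemma coextendResEval_map_mul {X : ModuleCat.{0} S}
    (g : (coextendScalars φ).obj ((restrictScalars φ).obj X)) (r : R) (s : S) :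
    coextendResEval g (φ r * s) = φ r • coextendResEval g s :=
  coextendEval_map_mul g r s

lemma coextendResEval_smul {X : ModuleCat.{0} S}
    (g : (coextendScalars φ).obj ((restrictScalars φ).obj X)) (s t : S) :
    coextendResEval (s • g) t = coextendResEval g (t * s) := rfl

lemma coextendResEval_add {X : ModuleCat.{0} S}
    (g h : (coextendScalars φ).obj ((restrictScalars φ).obj X)) :
    coextendResEval (g + h) = coextendResEval g + coextendResEval h := rfl

end CoextendEval

instance coextendScalars_additive (φ : R →+* S) :
    (coextendScalars.{0, 0, 0} φ).Additive where
  map_add {_ _ _ _} := by ext; rfl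

namespace FrobeniusSystem

variable {φ : R →+* S} {ι : Type} [Fintype ι] (F : FrobeniusSystem φ ι)

/-- The `R`-linear map `S → M`, `s ↦ π s • m`, as an element of the coextension of `M`. -/
def unitElem {M : ModuleCat.{0} R} (m : M) : (coextendScalars φ).obj M :=
  (CoextendScalars.equiv φ M).symm
    { toFun := fun s : S => F.π s • m
      map_add' := fun s t : S => by rw [← add_smul]; exact congrArg (· • m) (F.π.map_add s t)
      map_smul' := fun r (s : S) => by
        rw [RingHom.id_apply, ← mul_smul, ← F.π_map_mul]; rfl }

lemma coextendEval_unitElem {M : ModuleCat.{0} R} (m : M) (s : S) :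
    coextendEval (F.unitElem m) s = F.π s • m := rfl

lemma unitElem_add {M : ModuleCat.{0} R} (m m' : M) :
    F.unitElem (m + m') = F.unitElem m + F.unitElem m' :=
  coextendEval_ext fun s => by simp [coextendEval_add, coextendEval_unitElem]

lemma unitElem_smul {M : ModuleCat.{0} R} (r : R) (m : M) :
    F.unitElem (r • m) = φ r • F.unitElem m :=
  coextendEval_ext fun s => by
    rw [coextendEval_smul, coextendEval_unitElem, coextendEval_unitElem, F.π_mul_map, mul_smul]

/-- Every element of the coextension is recovered from its values on one of the dual bases. -/
lemma sum_smul_unitElem {M : ModuleCat.{0} R} (g : (coextendScalars φ).obj M) :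
    ∑ i, F.x i • F.unitElem (coextendEval g (F.y i)) = g :=
  coextendEval_ext fun s => by
    rw [coextendEval_sum]
    conv_rhs => rw [← F.sum_π_mul s, map_sum]
    simp only [coextendEval_smul, coextendEval_unitElem, coextendEval_map_mul]

/-- The `S`-linear trace map from the coextension of the restriction of `X` to `X`. -/
def counitMap (X : ModuleCat.{0} S) :
    (coextendScalars φ).obj ((restrictScalars φ).obj X) →ₗ[S] X where
  toFun g := ∑ i, F.x i • coextendResEval g (F.y i)
  map_add' g h := by simp [coextendResEval_add, Finset.sum_add_distrib]
  map_smul' s g := by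
    have key (t : S) :
        coextendResEval g t = ∑ j, φ (F.π (t * F.x j)) • coextendResEval g (F.y j) := by
      conv_lhs => rw [← F.sum_π_mul t, map_sum]
      simp only [coextendResEval_map_mul]
    calc ∑ i, F.x i • coextendResEval (s • g) (F.y i)
        = ∑ i, ∑ j, (F.x i * φ (F.π (F.y i * (s * F.x j)))) • coextendResEval g (F.y j) :=
          Finset.sum_congr rfl fun i _ => by
            rw [coextendResEval_smul, key, Finset.smul_sum]
            simp only [mul_smul, mul_assoc]
      _ = ∑ j, (s * F.x j) • coextendResEval g (F.y j) := by
          rw [Finset.sum_comm]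
          simp only [← Finset.sum_smul, F.sum_mul_π]
      _ = s • ∑ j, F.x j • coextendResEval g (F.y j) := by
          simp only [Finset.smul_sum, mul_smul]

lemma counitMap_apply (X : ModuleCat.{0} S)
    (g : (coextendScalars φ).obj ((restrictScalars φ).obj X)) :
    F.counitMap X g = ∑ i, F.x i • coextendResEval g (F.y i) := rfl

lemma counitMap_unitElem {X : ModuleCat.{0} S} (m : X) :
    F.counitMap X (F.unitElem (M := (restrictScalars φ).obj X) m) = m := by
  calc ∑ i, F.x i • φ (F.π (F.y i)) • m = (∑ i, F.x i * φ (F.π (F.y i * 1))) • m := by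
        simp only [Finset.sum_smul, mul_smul, mul_one]
    _ = m := by rw [F.sum_mul_π, one_smul]

/-- A Frobenius system makes coextension of scalars left adjoint to restriction of scalars. -/
def coextendRestrictScalarsAdj :
    coextendScalars.{0, 0, 0} φ ⊣ restrictScalars.{0, 0, 0} φ :=
  Adjunction.mkOfUnitCounit
    { unit :=
        { app := fun M => ofHom (Y := (restrictScalars φ).obj ((coextendScalars φ).obj M))
            { toFun := F.unitElem
              map_add' := F.unitElem_add
              map_smul' := F.unitElem_smul }
          naturality := fun M N h => hom_ext <| LinearMap.ext fun m =>
            coextendEval_ext fun s => (h.hom.map_smul (F.π s) m).symm }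
      counit :=
        { app := fun X => ofHom (F.counitMap X)
          naturality := fun X Y h => hom_ext <| LinearMap.ext
            fun g : (coextendScalars φ).obj ((restrictScalars φ).obj X) => by
              change ∑ i, F.x i • h.hom (coextendResEval g (F.y i)) = h.hom (F.counitMap X g)
              simp only [counitMap_apply, map_sum, map_smul] }
      left_triangle := NatTrans.ext <| funext fun M => hom_ext <| LinearMap.ext
        fun g : (coextendScalars φ).obj M => F.sum_smul_unitElem g
      right_triangle := NatTrans.ext <| funext fun X => hom_ext <| LinearMap.ext
        fun m : X => F.counitMap_unitElem m }

lemma rankLE_coextendScalars (F : FrobeniusSystem φ ι) {M : ModuleCat.{0} R} {b : NNReal}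
    (h : RankLE R M b) : RankLE S ((coextendScalars φ).obj M) b := by
  classical
  obtain ⟨t, ht, hb⟩ := h
  refine ⟨t.image F.unitElem, ?_, le_trans (by exact_mod_cast Finset.card_image_le) hb⟩
  have hmem (m : M) : F.unitElem m ∈ Submodule.span S (t.image F.unitElem : Set _) := by
    have hm : m ∈ Submodule.span R (t : Set M) := ht ▸ Submodule.mem_top
    induction hm using Submodule.span_induction with
    | mem m hm => exact Submodule.subset_span (by simpa using ⟨m, hm, rfl⟩)
    | zero =>
      have : F.unitElem (0 : M) = 0 := by simpa using F.unitElem_smul 0 (0 : M)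
      rw [this]; exact zero_mem _
    | add a b _ _ ha hb => rw [unitElem_add]; exact add_mem ha hb
    | smul r a _ ha => rw [unitElem_smul]; exact Submodule.smul_mem _ _ ha
  refine eq_top_iff.2 fun g _ => ?_
  rw [← F.sum_smul_unitElem g]
  exact Submodule.sum_mem _ fun i _ => Submodule.smul_mem _ _ (hmem _)

lemma complexityLE_coextendScalars (F : FrobeniusSystem φ ι) {M : ModuleCat.{0} R}
    {f : ℕ → NNReal} (h : ComplexityLE R M f) :
    ComplexityLE S ((coextendScalars φ).obj M) f := by
  obtain ⟨P, d, hP⟩ := h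
  have := F.coextendRestrictScalarsAdj.isLeftAdjoint
  have : (coextendScalars.{0, 0, 0} φ).PreservesProjectiveObjects :=
    ⟨fun hX => F.coextendRestrictScalarsAdj.map_projective _ hX⟩
  exact ⟨(coextendScalars φ).mapProjectiveResolution P, d,
    fun n => F.rankLE_coextendScalars (hP n)⟩

end FrobeniusSystem

end Frobenius

section Retract

variable {R : Type} [Ring R]

lemma ComplexityLE.of_iso {M N : ModuleCat.{0} R} {f : ℕ → NNReal} (e : M ≅ N)
    (h : ComplexityLE R M f) : ComplexityLE R N f := by
  obtain ⟨P, d, hP⟩ := h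
  exact ⟨{ complex := P.complex, π := P.π ≫ (ChainComplex.single₀ _).map e.hom }, d, hP⟩

/-- A module inherits `CdsLE` from any module of which it is a retract. -/
lemma ComplexityLE.cdsLE_of_retract {M X : ModuleCat.{0} R} {f : ℕ → NNReal}
    (h : ComplexityLE R X f) (i : M →ₗ[R] X) (p : X →ₗ[R] M) (hpi : p ∘ₗ i = LinearMap.id) :
    CdsLE R M f := by
  refine ⟨ModuleCat.of R (LinearMap.ker p), h.of_iso (LinearEquiv.toModuleIso ?_)⟩
  exact ((LinearEquiv.prodComm R M (LinearMap.ker p)).trans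
    (lequivProdOfRightSplitExact (LinearMap.ker p).injective_subtype
      (Submodule.range_subtype _) hpi)).symm

lemma CdsLE.exists_retract {M : ModuleCat.{0} R} {f : ℕ → NNReal} (h : CdsLE R M f) :
    ∃ X : ModuleCat.{0} R, ComplexityLE R X f ∧ Nonempty (Retract M X) := by
  obtain ⟨N, hN⟩ := h
  exact ⟨_, hN, ⟨ModuleCat.ofHom (LinearMap.inl R M N), ModuleCat.ofHom (LinearMap.fst R M N),
    by ext; rfl⟩⟩

end Retract

open ModuleCat in
/-- For a Frobenius extension `R → S` whose Casimir element maps to a central unit of `S`,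
`CdsLE` can be checked after restricting scalars to `R`. -/
lemma FrobeniusSystem.cdsLE_of_restrictScalars {R S : Type} [Ring R] [Ring S] {φ : R →+* S}
    {ι : Type} [Fintype ι] (F : FrobeniusSystem φ ι) (z : S) (hz : ∀ s, z * s = s * z)
    (hxy : z * ∑ i, F.x i * F.y i = 1) {M : ModuleCat.{0} S} {f : ℕ → NNReal}
    (h : CdsLE R ((restrictScalars φ).obj M) f) : CdsLE S M f := by
  obtain ⟨X, hX, ⟨ρ⟩⟩ := h.exists_retract
  let u : M →ₗ[S] (coextendScalars φ).obj ((restrictScalars φ).obj M) :=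
    RestrictionCoextensionAdj.app' φ M
  let c : (coextendScalars φ).obj ((restrictScalars φ).obj M) →ₗ[S] M :=
    { toFun := fun g => z • F.counitMap M g
      map_add' := fun g g' => by rw [map_add, smul_add]
      map_smul' := fun s g => by
        rw [map_smul, ← mul_smul, hz, mul_smul, RingHom.id_apply] }
  let σ := ρ.map (coextendScalars φ)
  refine (F.complexityLE_coextendScalars hX).cdsLE_of_retract (σ.i.hom ∘ₗ u) (c ∘ₗ σ.r.hom) ?_
  refine LinearMap.ext fun m => ?_
  have hρ : σ.r.hom (σ.i.hom (u m)) = u m := congrArg (fun h => h.hom (u m)) σ.retract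
  rw [LinearMap.comp_apply, LinearMap.comp_apply, LinearMap.comp_apply, hρ]
  change z • ∑ i, F.x i • F.y i • m = m
  simp only [← mul_smul, ← Finset.sum_smul, hxy, one_smul]

section Subgroup

variable (k : Type) [Ring k] {G : Type} [Group G] (H : Subgroup G)

open MonoidAlgebra

lemma subgroupRingHom_single (h : H) (a : k) :
    subgroupRingHom k H (single h a) = single (h : G) a := by
  simp [subgroupRingHom]

/-- The projection `k[G] → k[H]` that forgets the coefficients outside of `H`. -/
def subgroupProj : MonoidAlgebra k G →+ MonoidAlgebra k H :=
  comapDomainAddMonoidHom H.subtype H.subtype_injective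

lemma subgroupProj_single_of_mem {g : G} (hg : g ∈ H) (a : k) :
    subgroupProj k H (single g a) = single ⟨g, hg⟩ a :=
  comapDomain_single_map H.subtype H.subtype_injective ⟨g, hg⟩ a

lemma subgroupProj_single_of_notMem {g : G} (hg : g ∉ H) (a : k) :
    subgroupProj k H (single g a) = 0 :=
  comapDomain_single_of_not_mem_range (by simpa using hg) H.subtype_injective

lemma subgroupProj_map_mul (r : MonoidAlgebra k H) (s : MonoidAlgebra k G) :
    subgroupProj k H (subgroupRingHom k H r * s) = r * subgroupProj k H s := by
  induction r using MonoidAlgebra.induction_linear with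
  | zero => simp
  | add r r' hr hr' => simp [add_mul, hr, hr']
  | single h a =>
    induction s using MonoidAlgebra.induction_linear with
    | zero => simp
    | add s s' hs hs' => simp only [mul_add, map_add, hs, hs']
    | single g b =>
      rw [subgroupRingHom_single, single_mul_single]
      by_cases hg : g ∈ H
      · rw [subgroupProj_single_of_mem k H hg, single_mul_single,
          subgroupProj_single_of_mem k H (H.mul_mem h.2 hg)]
        rfl
      · rw [subgroupProj_single_of_notMem k H hg, mul_zero, subgroupProj_single_of_notMem]
        rwa [H.mul_mem_cancel_left h.2]

lemma subgroupProj_mul_map (s : MonoidAlgebra k G) (r : MonoidAlgebra k H) :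
    subgroupProj k H (s * subgroupRingHom k H r) = subgroupProj k H s * r := by
  induction r using MonoidAlgebra.induction_linear with
  | zero => simp
  | add r r' hr hr' => simp [mul_add, hr, hr']
  | single h a =>
    induction s using MonoidAlgebra.induction_linear with
    | zero => simp
    | add s s' hs hs' => simp only [add_mul, map_add, hs, hs']
    | single g b =>
      rw [subgroupRingHom_single, single_mul_single]
      by_cases hg : g ∈ H
      · rw [subgroupProj_single_of_mem k H hg, single_mul_single,
          subgroupProj_single_of_mem k H (H.mul_mem hg h.2)]
        rfl
      · rw [subgroupProj_single_of_notMem k H hg, zero_mul, subgroupProj_single_of_notMem]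
        rwa [H.mul_mem_cancel_right h.2]

open Classical in
lemma subgroupRingHom_subgroupProj_single (g : G) (a : k) :
    subgroupRingHom k H (subgroupProj k H (single g a)) = if g ∈ H then single g a else 0 := by
  split_ifs with hg
  · rw [subgroupProj_single_of_mem k H hg, subgroupRingHom_single]
  · rw [subgroupProj_single_of_notMem k H hg, map_zero]

/-- The Frobenius system of the group ring extension `k[H] → k[G]` given by representatives
of the left cosets of `H` and their inverses. -/
def subgroupFrobeniusSystem [Fintype (G ⧸ H)] :
    FrobeniusSystem (subgroupRingHom k H) (G ⧸ H) where
  π := subgroupProj k H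
  π_map_mul := subgroupProj_map_mul k H
  π_mul_map := subgroupProj_mul_map k H
  x q := single q.out 1
  y q := single q.out⁻¹ 1
  sum_π_mul s := by
    classical
    induction s using MonoidAlgebra.induction_linear with
    | zero => simp
    | add s s' hs hs' => simp only [add_mul, map_add, Finset.sum_add_distrib, hs, hs']
    | single g a =>
      have hmem (q : G ⧸ H) : g * q.out ∈ H ↔ q = (g⁻¹ : G) := by
        rw [← inv_inv g, ← QuotientGroup.eq, QuotientGroup.out_eq', inv_inv, eq_comm]
      simp [single_mul_single, subgroupRingHom_subgroupProj_single, hmem]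
  sum_mul_π s := by
    classical
    induction s using MonoidAlgebra.induction_linear with
    | zero => simp
    | add s s' hs hs' => simp only [mul_add, map_add, Finset.sum_add_distrib, hs, hs']
    | single g a =>
      have hmem (q : G ⧸ H) : q.out⁻¹ * g ∈ H ↔ q = (g : G) := by
        rw [← QuotientGroup.eq, QuotientGroup.out_eq']
      simp [single_mul_single, subgroupRingHom_subgroupProj_single, hmem]

end Subgroup

/-- If `H ≤ G` has finite index invertible in `k` and `cds_{kH}(M) ≤ f`,
then `cds_{kG}(M) ≤ f`. -/
theorem cds_of_invertible_index
    (k : Type) [Ring k] (G : Type) [Group G]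
    (H : Subgroup G) [H.FiniteIndex] (hinv : IsUnit ((H.index : k)))
    (M : ModuleCat.{0} (MonoidAlgebra k G))
    (f : ℕ → NNReal) (hf : IsProperComplexityFunction f)
    (hyp : CdsLE (MonoidAlgebra k H) (resMod k H M) f) :
    CdsLE (MonoidAlgebra k G) M f := by
  have : Fintype (G ⧸ H) := Subgroup.fintypeQuotientOfFiniteIndex
  obtain ⟨u, hu⟩ := hinv
  have hcomm (a : k) : ↑u⁻¹ * a = a * ↑u⁻¹ := by
    have : Commute (u : k) a := hu ▸ Nat.cast_commute _ _
    exact this.units_inv_left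
  refine (subgroupFrobeniusSystem k H).cdsLE_of_restrictScalars
    (MonoidAlgebra.single 1 ↑u⁻¹)
    (MonoidAlgebra.single_commute (fun g => Commute.one_left g) hcomm) ?_ hyp
  have hsum : ∑ q : G ⧸ H, (subgroupFrobeniusSystem k H).x q * (subgroupFrobeniusSystem k H).y q
      = (H.index : MonoidAlgebra k G) := by
    simp [subgroupFrobeniusSystem, MonoidAlgebra.single_mul_single, ← MonoidAlgebra.one_def,
      Subgroup.index, Nat.card_eq_fintype_card]
  rw [hsum, MonoidAlgebra.natCast_def, ← hu, MonoidAlgebra.single_mul_single, Units.inv_mul,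
    one_mul, MonoidAlgebra.one_def]
end
end
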